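/- arXiv:1211.6974 — 3 statements merged into one kernel-verified Lean document; each statement's English description precedes it below -/
import Mathlib

section
/- Let G = (V,E) be a finite connected graph with conductances c : E → ℝ_{>0}, and let α assign to every oriented simple cycle γ of G a weight α(γ) ∈ [0,1], with α(γ) > 0 for at least one cycle γ. Consider the cycle-popping algorithm: maintain a growing oriented subgraph Γ (initially empty); repeatedly start a random walk from a vertex not yet in Γ, where each step from v goes to a neighbour v' with probability c(vv')/Σ_{w∼v} c(vw); whenever the walk first revisits a vertex of its current path, forming an oriented simple cycle γ, keep γ with probability α(γ) (an independent Bernoulli trial) and otherwise erase γ and continue the walk; stop the walk when it hits Γ or when a cycle has been kept, and add the traced path (with its kept cycle, if any) to Γ; repeat until Γ contains all vertices. Then the algorithm terminates almost surely, its output is an oriented cycle-rooted spanning forest of G, and the output is distributed according to the probability measure μ_{c,α} which gives an oriented CRSF Γ probability proportional to Π_{e∈Γ} c(e) · Π_{oriented cycles γ⊆Γ} α(γ). -/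
/-!
STATEMENT 0 (the cycle-popping algorithm).

An oriented CRSF of a finite graph `G` is encoded by a function `f : V → V` such that
`v` is adjacent to `f v` for every `v` and `f` has no two-point orbits (each connected
component of the functional graph of such an `f` contains a unique oriented cycle, and
the edges `{v, f v}` form a CRSF).

The cycle-popping algorithm is encoded as a deterministic machine `algStep` consuming a
list of elementary random choices ("moves" in `V ⊕ Bool`): a move `Sum.inl w` is a step
of the random walk to the vertex `w` (with probability `c(v,w)/Σ_u c(v,u)` from the
current vertex `v`), and a move `Sum.inr b` is the outcome of the Bernoulli trial
performed when the walk has just closed an oriented simple cycle `γ` (`b = true`, keep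
the cycle, has probability `α(γ)`, and `b = false`, erase it, probability `1 − α(γ)`).
A new walk is started, at the vertex chosen by the (arbitrary) selection function
`start`, whenever the previous walk has ended by hitting the current subgraph `Γ` or by
keeping a cycle; the machine stops when all vertices are in `Γ`.

The theorem states: the algorithm terminates almost surely (the probabilities of the
complete runs sum to `1`), every complete run outputs an oriented CRSF of `G`, and the
probability of outputting a given oriented CRSF `f` is
`Π_{e∈f} c(e) · Π_{cycles γ of f} α(γ)`, normalized — i.e. the output has law
`μ_{c,α}`.
-/

open Classical

noncomputable section

namespace CyclePopping

variable {V : Type*} [Fintype V] [DecidableEq V]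

/-- `f` encodes an oriented cycle-rooted spanning forest of `G`: every vertex points to
a neighbour, and no edge is used in both directions. -/
def IsOCRSF (G : SimpleGraph V) (f : V → V) : Prop :=
  (∀ v, G.Adj v (f v)) ∧ ∀ v, f (f v) ≠ v

/-- The periodic points of `f`, i.e. the vertices lying on cycles of `f`. -/
def periodicPts (f : V → V) : Finset V :=
  Finset.univ.filter fun v => ∃ k : ℕ, 0 < k ∧ f^[k] v = v

/-- The forward orbit of `v` under `f`. -/
def fwdOrbit (f : V → V) (v : V) : Finset V :=
  Finset.univ.filter fun w => ∃ k : ℕ, f^[k] v = w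

/-- The cycles of the functional graph of `f`, as a finite collection of orbits. -/
def cyclesOfFun (f : V → V) : Finset (Finset V) :=
  (periodicPts f).image (fwdOrbit f)

/-- The list `[v, f v, f² v, …]` of length `k`. -/
def cycleListAt (f : V → V) (v : V) (k : ℕ) : List V :=
  (List.range k).map fun i => f^[i] v

/-- A list representing the oriented cycle of `f` with vertex set `s` (starting at an
arbitrarily chosen point of `s`; for a rotation-invariant cycle weight the choice is
immaterial). -/
def orbitCycleList (f : V → V) (s : Finset V) : List V :=
  if h : s.Nonempty then cycleListAt f h.choose s.card else []

/-- `l` is the vertex list of an oriented simple cycle of `G`, the oriented edges being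
`l[i] → l[i+1]` together with `l.getLast → l.head`. -/
def IsCycleListOf (G : SimpleGraph V) (l : List V) : Prop :=
  3 ≤ l.length ∧ l.Nodup ∧ List.Chain' G.Adj (l ++ l.take 1)

/-- The `μ_{c,α}`-weight of the oriented CRSF `f`:
`Π_{e∈f} c(e) · Π_{oriented cycles γ ⊆ f} α(γ)`. -/
def ocrsfWeight (c : V → V → ℝ) (α : List V → ℝ) (f : V → V) : ℝ :=
  (∏ v, c v (f v)) * ∏ s ∈ cyclesOfFun f, α (orbitCycleList f s)

/-- The internal state of the cycle-popping machine: `assigned` is the growing oriented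
subgraph `Γ` (each vertex of `Γ` points to its successor), `path` is the current walk
(most recent vertex first), and `pending` records that the walk has just closed a
simple cycle and awaits a Bernoulli trial. -/
structure AlgState (V : Type*) where
  assigned : V → Option V
  path : List V
  pending : Bool

/-- The initial state: empty subgraph, no walk. -/
def initState : AlgState V := ⟨fun _ => none, [], false⟩

/-- Record the successive steps of a walk (listed in walk order) in the subgraph. -/
def assignAlong : (V → Option V) → List V → (V → Option V)
  | a, [] => a
  | a, [_] => a
  | a, x :: y :: l => assignAlong (Function.update a x (some y)) (y :: l)

/-- The cycle (in walk order) closed by a walk whose path, most recent vertex first,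
is the given list. -/
def cycleOfPath : List V → List V
  | [] => []
  | w :: p => w :: (p.takeWhile fun u => decide (u ≠ w)).reverse

/-- One step of the cycle-popping machine. -/
def algStep (G : SimpleGraph V) (start : (V → Option V) → V)
    (st : AlgState V) (mv : V ⊕ Bool) : Option (AlgState V) :=
  if ∀ v, (st.assigned v).isSome then none   -- the algorithm has already terminated
  else if st.pending then
    match mv with
    | Sum.inr true =>   -- keep the cycle: the walk ends and is added to Γ
        some ⟨assignAlong st.assigned st.path.reverse, [], false⟩
    | Sum.inr false =>  -- pop the cycle and continue the walk
        match st.path with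
        | [] => none
        | w :: p => some ⟨st.assigned, p.dropWhile fun u => decide (u ≠ w), false⟩
    | Sum.inl _ => none
  else
    match mv with
    | Sum.inl w =>
        -- if no walk is in progress, a new walk starts at `start st.assigned`
        match (if st.path = [] then [start st.assigned] else st.path) with
        | [] => none
        | v :: p' =>
            if G.Adj v w then
              if (st.assigned w).isSome then
                -- the walk hits Γ: add the traced path to Γ
                some ⟨assignAlong st.assigned ((v :: p').reverse ++ [w]), [], false⟩
              else if w ∈ v :: p' then
                if (v :: p').tail.head? = some w then
                  -- backtracking closes a 2-step loop, not a simple cycle: erase it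
                  some ⟨st.assigned, (v :: p').dropWhile fun u => decide (u ≠ w), false⟩
                else
                  -- a simple cycle has been closed: await the Bernoulli trial
                  some ⟨st.assigned, w :: v :: p', true⟩
              else some ⟨st.assigned, w :: v :: p', false⟩
            else none
    | Sum.inr _ => none

/-- The probability of an elementary move from a given state. -/
def moveProb (c : V → V → ℝ) (α : List V → ℝ) (start : (V → Option V) → V)
    (st : AlgState V) (mv : V ⊕ Bool) : ℝ :=
  if st.pending then
    match mv with
    | Sum.inr true => α (cycleOfPath st.path)
    | Sum.inr false => 1 - α (cycleOfPath st.path)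
    | Sum.inl _ => 0
  else
    match mv with
    | Sum.inl w =>
        match (if st.path = [] then [start st.assigned] else st.path) with
        | v :: _ => c v w / ∑ u, c v u
        | [] => 0
    | Sum.inr _ => 0

/-- The state reached after a run (a list of moves), if all moves are legal. -/
def runState (G : SimpleGraph V) (start : (V → Option V) → V) :
    AlgState V → List (V ⊕ Bool) → Option (AlgState V)
  | st, [] => some st
  | st, mv :: r =>
      match algStep G start st mv with
      | some st' => runState G start st' r
      | none => none

/-- The probability of a run: the product of the probabilities of its moves. -/
def runProb (G : SimpleGraph V) (c : V → V → ℝ) (α : List V → ℝ)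
    (start : (V → Option V) → V) : AlgState V → List (V ⊕ Bool) → ℝ
  | _, [] => 1
  | st, mv :: r =>
      moveProb c α start st mv *
        match algStep G start st mv with
        | some st' => runProb G c α start st' r
        | none => 0

/-- A run after which the algorithm has terminated: all vertices belong to `Γ`. -/
def CompleteRun (G : SimpleGraph V) (start : (V → Option V) → V)
    (r : List (V ⊕ Bool)) : Prop :=
  ∃ st, runState G start initState r = some st ∧ ∀ v, (st.assigned v).isSome

/-- The run `r` is complete and outputs the oriented CRSF `f`. -/
def RunOutputs (G : SimpleGraph V) (start : (V → Option V) → V)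
    (r : List (V ⊕ Bool)) (f : V → V) : Prop :=
  ∃ st, runState G start initState r = some st ∧ ∀ v, st.assigned v = some (f v)

section Helpers

/-- `P` (most recent vertex first) is a self-avoiding path of unassigned vertices, following `b`,
whose last step goes to `w`. -/
def PathTo (G : SimpleGraph V) (a : V → Option V) (b : V → V) : V → List V → Prop
  | _, [] => True
  | w, v :: rest => b v = w ∧ G.Adj v w ∧ a v = none ∧ v ∉ rest ∧ PathTo G a b v rest

/-- Consistency of the subgraph `a` with the total map `b`. -/
def GoodA (G : SimpleGraph V) (a : V → Option V) (b : V → V) : Prop :=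
  ∀ x y, a x = some y → y = b x ∧ G.Adj x y ∧ (a y).isSome ∧ a y ≠ some x

def abar (α : List V → ℝ) (g : V → V) (s : Finset V) : ℝ :=
  if 3 ≤ s.card then α (orbitCycleList g s) else 0

def AB (α : List V → ℝ) (B : Finset V) (g : V → V) : ℝ :=
  ∏ s ∈ (cyclesOfFun g).filter (fun s => s ⊆ B), abar α g s

def Pg (p : V → V → ℝ) (g : V → V) : ℝ := ∏ x, p x (g x)

def ZB (p : V → V → ℝ) (α : List V → ℝ) (B : Finset V) : ℝ := ∑ g : V → V, Pg p g * AB α B g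

def ov (B : Finset V) (b g : V → V) : V → V := fun x => if x ∈ B then g x else b x

def EB (p : V → V → ℝ) (B : Finset V) (b : V → V) (φ : (V → V) → ℝ) : ℝ :=
  ∑ g : V → V, Pg p g * φ (ov B b g)

def Exit (B : Finset V) (g : V → V) (x z : V) : Prop :=
  z ∉ B ∧ ∃ n : ℕ, g^[n] x = z ∧ ∀ m < n, g^[m] x ∈ B


lemma Pg_update (p : V → V → ℝ) (g : V → V) (v w : V) :
    p v (g v) * Pg p (Function.update g v w) = p v w * Pg p g := by
  unfold Pg
  rw [← Finset.mul_prod_erase Finset.univ _ (Finset.mem_univ v),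
    ← Finset.mul_prod_erase Finset.univ (fun x => p x (g x)) (Finset.mem_univ v)]
  have : ∏ x ∈ Finset.univ.erase v, p x (Function.update g v w x)
      = ∏ x ∈ Finset.univ.erase v, p x (g x) := by
    apply Finset.prod_congr rfl
    intro x hx
    rw [Function.update_of_ne (Finset.ne_of_mem_erase hx)]
  rw [this, Function.update_self]
  ring

lemma resample (p : V → V → ℝ) (hp : ∀ x, ∑ w, p x w = 1) (v : V) (φ : (V → V) → ℝ) :
    ∑ g : V → V, Pg p g * φ g = ∑ w, p v w * ∑ g : V → V, Pg p g * φ (Function.update g v w) := by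
  have h1 : ∑ w, p v w * ∑ g : V → V, Pg p g * φ (Function.update g v w)
      = ∑ q : V × (V → V), p v q.1 * (Pg p q.2 * φ (Function.update q.2 v q.1)) := by
    rw [Fintype.sum_prod_type]
    simp only [Finset.mul_sum]
  have h2 : ∑ g : V → V, Pg p g * φ g
      = ∑ q : V × (V → V), p v q.1 * (Pg p q.2 * φ q.2) := by
    rw [Fintype.sum_prod_type]
    simp only [← Finset.mul_sum]
    rw [← Finset.sum_mul, hp, one_mul]
  rw [h1, h2]
  refine Finset.sum_nbij' (fun q => (q.2 v, Function.update q.2 v q.1))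
    (fun q => (q.2 v, Function.update q.2 v q.1)) ?_ ?_ ?_ ?_ ?_
  · intros; simp
  · intros; simp
  · rintro ⟨w, g⟩ _; simp
  · rintro ⟨w, g⟩ _; simp
  · rintro ⟨w, g⟩ _
    have := Pg_update p g v w
    simp only [Function.update_self, Function.update_idem, Function.update_eq_self]
    rw [← mul_assoc, ← this, mul_assoc]

lemma EB_split (p : V → V → ℝ) (hp : ∀ x, ∑ w, p x w = 1) (B : Finset V) (b : V → V) (v : V)
    (hv : v ∈ B) (φ : (V → V) → ℝ) :
    EB p B b φ = ∑ w, p v w * EB p (B.erase v) (Function.update b v w) φ := by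
  unfold EB
  rw [resample p hp v (fun g => φ (ov B b g))]
  refine Finset.sum_congr rfl fun w _ => ?_
  congr 1
  refine Finset.sum_congr rfl fun g _ => ?_
  congr 2
  funext x
  unfold ov
  by_cases hx : x = v
  · subst hx; simp [hv]
  · simp [hx, Finset.mem_erase]

lemma mem_fwdOrbit {g : V → V} {x y : V} : y ∈ fwdOrbit g x ↔ ∃ k : ℕ, g^[k] x = y := by
  simp [fwdOrbit]

lemma iter_congr {B : Finset V} {g g' : V → V} (h : ∀ x ∈ B, g x = g' x) {x : V}
    (hx : ∀ k : ℕ, g^[k] x ∈ B) (k : ℕ) : g^[k] x = g'^[k] x := by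
  induction k with
  | zero => rfl
  | succ k ih => rw [Function.iterate_succ_apply', Function.iterate_succ_apply', ← ih, h _ (hx k)]

lemma iter_mul {g : V → V} {x : V} {k : ℕ} (h : g^[k] x = x) (m : ℕ) : g^[k*m] x = x := by
  induction m with
  | zero => rfl
  | succ m ih => rw [Nat.mul_succ, Function.iterate_add_apply, h, ih]

lemma fwdOrbit_eq_of_mem {g : V → V} {x y : V} (hx : ∃ k : ℕ, 0 < k ∧ g^[k] x = x)
    (hy : y ∈ fwdOrbit g x) : fwdOrbit g y = fwdOrbit g x ∧ ∃ k : ℕ, 0 < k ∧ g^[k] y = y := by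
  obtain ⟨k, hk, hkx⟩ := hx
  obtain ⟨j, rfl⟩ := mem_fwdOrbit.1 hy
  refine ⟨?_, k, hk, ?_⟩
  · ext z
    rw [mem_fwdOrbit, mem_fwdOrbit]
    constructor
    · rintro ⟨i, rfl⟩
      exact ⟨i + j, Function.iterate_add_apply _ _ _ _⟩
    · rintro ⟨i, rfl⟩
      refine ⟨i + (k * j - j), ?_⟩
      have : j ≤ k * j := Nat.le_mul_of_pos_left j hk
      rw [← Function.iterate_add_apply, show i + (k*j - j) + j = i + k*j by omega,
        Function.iterate_add_apply, iter_mul hkx]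
  · rw [← Function.iterate_add_apply, add_comm, Function.iterate_add_apply, hkx]

lemma mem_cycles {g : V → V} {s : Finset V} :
    s ∈ cyclesOfFun g ↔ ∃ x, (∃ k : ℕ, 0 < k ∧ g^[k] x = x) ∧ fwdOrbit g x = s := by
  simp [cyclesOfFun, periodicPts]

lemma self_mem_fwdOrbit (g : V → V) (x : V) : x ∈ fwdOrbit g x := mem_fwdOrbit.2 ⟨0, rfl⟩

lemma cycles_local_aux {B : Finset V} {g g' : V → V} (h : ∀ x ∈ B, g x = g' x) {s : Finset V}
    (hs : s ∈ cyclesOfFun g) (hsB : s ⊆ B) :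
    s ∈ cyclesOfFun g' ∧ orbitCycleList g s = orbitCycleList g' s := by
  obtain ⟨x, ⟨k, hk, hkx⟩, rfl⟩ := mem_cycles.1 hs
  have key : ∀ y ∈ fwdOrbit g x, ∀ k : ℕ, g^[k] y ∈ B := by
    intro y hy k
    apply hsB
    rw [← (fwdOrbit_eq_of_mem ⟨_, hk, hkx⟩ hy).1]
    exact mem_fwdOrbit.2 ⟨k, rfl⟩
  have hit := fun y hy k => iter_congr h (key y hy) k
  have hx := self_mem_fwdOrbit g x
  constructor
  · refine mem_cycles.2 ⟨x, ⟨k, hk, ?_⟩, ?_⟩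
    · rw [← hit x hx, hkx]
    · ext z
      simp only [mem_fwdOrbit, hit x hx]
  · unfold orbitCycleList
    have hne : (fwdOrbit g x).Nonempty := ⟨x, hx⟩
    rw [dif_pos hne, dif_pos hne]
    unfold cycleListAt
    apply List.map_congr_left
    intro i _
    exact hit _ hne.choose_spec i

lemma AB_local (α : List V → ℝ) {B : Finset V} {g g' : V → V} (h : ∀ x ∈ B, g x = g' x) :
    AB α B g = AB α B g' := by
  have h' : ∀ x ∈ B, g' x = g x := fun x hx => (h x hx).symm
  unfold AB
  apply Finset.prod_congr
  · ext s
    simp only [Finset.mem_filter]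
    exact ⟨fun ⟨h1, h2⟩ => ⟨(cycles_local_aux h h1 h2).1, h2⟩,
      fun ⟨h1, h2⟩ => ⟨(cycles_local_aux h' h1 h2).1, h2⟩⟩
  · intro s hs
    simp only [Finset.mem_filter] at hs
    unfold abar
    rw [(cycles_local_aux h' hs.1 hs.2).2]

lemma EB_AB (p : V → V → ℝ) (α : List V → ℝ) {B B' : Finset V} (hB : B' ⊆ B) (b : V → V) :
    EB p B b (AB α B') = ZB p α B' := by
  unfold EB ZB
  refine Finset.sum_congr rfl fun g _ => ?_
  congr 1
  apply AB_local
  intro x hx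
  simp [ov, hB hx]

lemma exit_not_mem {B : Finset V} {g : V → V} {w z : V} (hw : w ∉ B) :
    Exit B g w z ↔ z = w := by
  constructor
  · rintro ⟨_, n, hn, hm⟩
    rcases Nat.eq_zero_or_pos n with rfl | hpos
    · exact hn.symm
    · exact absurd (hm 0 hpos) hw
  · rintro rfl
    exact ⟨hw, 0, rfl, by simp⟩

lemma exit_step {B : Finset V} {g : V → V} {v z : V} (hv : v ∈ B) (hz : z ∉ B) :
    Exit B g v z ↔ Exit (B.erase v) g (g v) z := by
  constructor
  · rintro ⟨_, n, hn, hm⟩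
    refine ⟨fun h => hz (Finset.mem_of_mem_erase h), ?_⟩
    rcases n with _ | n
    · exact absurd (by rw [← hn]; exact hv) hz
    refine ⟨n, hn, fun m hmn => ?_⟩
    have h1 : g^[m] (g v) = g^[m+1] v := rfl
    rw [h1, Finset.mem_erase]
    refine ⟨fun he => hz ?_, hm _ (by omega)⟩
    have : n + 1 = (n - m) + (m + 1) := by omega
    rw [← hn, this, Function.iterate_add_apply, he]
    exact hm _ (by omega)
  · rintro ⟨_, n, hn, hm⟩
    refine ⟨hz, n + 1, hn, fun m hmn => ?_⟩
    rcases m with _ | m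
    · exact hv
    · exact Finset.mem_of_mem_erase (hm m (by omega))

lemma exit_self {B : Finset V} {g : V → V} {v : V} (hv : v ∈ B) :
    Exit (B.erase v) g (g v) v ↔ (∃ k : ℕ, 0 < k ∧ g^[k] v = v) ∧ fwdOrbit g v ⊆ B := by
  constructor
  · rintro ⟨_, n, hn, hm⟩
    have hn' : g^[n+1] v = v := hn
    refine ⟨⟨n + 1, by omega, hn⟩, fun y hy => ?_⟩
    obtain ⟨k, rfl⟩ := mem_fwdOrbit.1 hy
    clear hy
    induction k using Nat.strong_induction_on with
    | _ k ih =>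
      rcases k with _ | k
      · exact hv
      · by_cases hk : k < n
        · exact Finset.mem_of_mem_erase (hm k hk)
        · have : k + 1 = (k - n) + (n + 1) := by omega
          rw [this, Function.iterate_add_apply, hn']
          exact ih _ (by omega)
  · rintro ⟨hk, hB⟩
    refine ⟨by simp, ?_⟩
    have hs := Nat.find_spec hk
    have hmin := fun m => Nat.find_min hk (m := m)
    obtain ⟨n, hn⟩ : ∃ n, Nat.find hk = n + 1 := ⟨Nat.find hk - 1, by omega⟩
    rw [hn] at hs hmin
    refine ⟨n, hs.2, fun m hm => ?_⟩
    have h1 : g^[m] (g v) = g^[m+1] v := rfl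
    rw [h1, Finset.mem_erase]
    exact ⟨fun he => hmin (m+1) (by omega) ⟨by omega, he⟩, hB (mem_fwdOrbit.2 ⟨_, rfl⟩)⟩

lemma AB_erase (α : List V → ℝ) {B : Finset V} {g : V → V} {v : V} (hv : v ∈ B) :
    AB α B g = AB α (B.erase v) g *
      (if Exit (B.erase v) g (g v) v then abar α g (fwdOrbit g v) else 1) := by
  have hsplit : ∀ s ∈ cyclesOfFun g, s ⊆ B → v ∈ s →
      s = fwdOrbit g v ∧ Exit (B.erase v) g (g v) v := by
    intro s hs hsB hvs
    obtain ⟨x, hx, rfl⟩ := mem_cycles.1 hs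
    have := fwdOrbit_eq_of_mem hx hvs
    exact ⟨this.1.symm, (exit_self hv).2 ⟨this.2, by rw [this.1]; exact hsB⟩⟩
  unfold AB
  split_ifs with h
  · have h' := (exit_self hv).1 h
    have : (cyclesOfFun g).filter (fun s => s ⊆ B)
        = insert (fwdOrbit g v) ((cyclesOfFun g).filter (fun s => s ⊆ B.erase v)) := by
      ext s
      simp only [Finset.mem_filter, Finset.mem_insert, Finset.subset_erase]
      constructor
      · rintro ⟨h1, h2⟩
        by_cases hvs : v ∈ s
        · exact Or.inl (hsplit s h1 h2 hvs).1
        · exact Or.inr ⟨h1, h2, hvs⟩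
      · rintro (rfl | ⟨h1, h2, _⟩)
        · exact ⟨mem_cycles.2 ⟨v, h'.1, rfl⟩, h'.2⟩
        · exact ⟨h1, h2⟩
    rw [this, Finset.prod_insert, mul_comm]
    simp only [Finset.mem_filter, Finset.subset_erase, not_and, not_not]
    intro _ _
    exact self_mem_fwdOrbit g v
  · rw [mul_one]
    apply Finset.prod_congr _ (fun _ _ => rfl)
    ext s
    simp only [Finset.mem_filter, Finset.subset_erase]
    exact ⟨fun ⟨h1, h2⟩ => ⟨h1, h2, fun hvs => h (hsplit s h1 h2 hvs).2⟩, fun ⟨h1, h2, _⟩ => ⟨h1, h2⟩⟩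

lemma cycleListAt_rotate {g : V → V} {x : V} {k : ℕ} (hk : 0 < k) (h : g^[k] x = x) :
    cycleListAt g (g x) k = (cycleListAt g x k).rotate 1 := by
  obtain ⟨n, rfl⟩ : ∃ n, k = n + 1 := ⟨k - 1, by omega⟩
  have h1 : cycleListAt g x (n+1) = x :: (List.range n).map (fun i => g^[i] (g x)) := by
    unfold cycleListAt
    rw [List.range_succ_eq_map]
    simp [Function.comp_def]
  rw [h1, List.rotate_cons_succ, List.rotate_zero]
  unfold cycleListAt
  rw [List.range_succ, List.map_append]
  have : g^[n] (g x) = x := h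
  simp [this]

/-- `x, g x, …` is an oriented simple cycle of `G` with `k` vertices. -/
structure IsCyc (G : SimpleGraph V) (g : V → V) (x : V) (k : ℕ) : Prop where
  three : 3 ≤ k
  per : g^[k] x = x
  nodup : (cycleListAt g x k).Nodup
  adj : ∀ i : ℕ, G.Adj (g^[i] x) (g^[i+1] x)

lemma IsCyc.list {G : SimpleGraph V} {g : V → V} {x : V} {k : ℕ} (h : IsCyc G g x k) :
    IsCycleListOf G (cycleListAt g x k) := by
  refine ⟨by simpa [cycleListAt] using h.three, h.nodup, ?_⟩
  have h1 : cycleListAt g x k ++ (cycleListAt g x k).take 1 = cycleListAt g x (k+1) := by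
    have h3 := h.three
    obtain ⟨n, rfl⟩ : ∃ n, k = n + 1 := ⟨k - 1, by omega⟩
    have hp := h.per
    unfold cycleListAt
    rw [List.range_succ (n := n+1), List.map_append]
    congr 1
    rw [List.range_succ_eq_map]
    simp only [List.map_cons, List.take_succ_cons, List.take_zero, List.map_nil]
    rw [hp]; rfl
  rw [h1]
  unfold cycleListAt
  show List.IsChain _ _
  rw [List.isChain_iff_getElem]
  intro i hi
  rw [List.getElem_map, List.getElem_map, List.getElem_range, List.getElem_range]
  exact h.adj i

lemma IsCyc.next {G : SimpleGraph V} {g : V → V} {x : V} {k : ℕ} (h : IsCyc G g x k) :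
    IsCyc G g (g x) k := by
  refine ⟨h.three, ?_, ?_, fun i => h.adj (i+1)⟩
  · rw [← Function.iterate_succ_apply, Function.iterate_succ_apply', h.per]
  · rw [cycleListAt_rotate (by have := h.three; omega) h.per]
    exact List.nodup_rotate.2 h.nodup

lemma IsCyc.iter {G : SimpleGraph V} {g : V → V} {x : V} {k : ℕ} (h : IsCyc G g x k) (j : ℕ) :
    IsCyc G g (g^[j] x) k := by
  induction j with
  | zero => exact h
  | succ j ih => rw [Function.iterate_succ_apply']; exact ih.next

lemma IsCyc.alpha {G : SimpleGraph V} {α : List V → ℝ}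
    (hαrot : ∀ l, IsCycleListOf G l → α (l.rotate 1) = α l)
    {g : V → V} {x : V} {k : ℕ} (h : IsCyc G g x k) (j : ℕ) :
    α (cycleListAt g (g^[j] x) k) = α (cycleListAt g x k) := by
  induction j with
  | zero => rfl
  | succ j ih =>
    have hj := h.iter j
    rw [Function.iterate_succ_apply', cycleListAt_rotate (by have := h.three; omega) hj.per,
      hαrot _ hj.list, ih]

lemma fwdOrbit_eq_toFinset {g : V → V} {x : V} {k : ℕ} (hk : 0 < k) (h : g^[k] x = x) :
    fwdOrbit g x = (cycleListAt g x k).toFinset := by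
  ext y
  simp only [mem_fwdOrbit, cycleListAt, List.mem_toFinset, List.mem_map, List.mem_range]
  constructor
  · rintro ⟨i, rfl⟩
    refine ⟨i % k, Nat.mod_lt _ hk, ?_⟩
    conv_rhs => rw [← Nat.mod_add_div i k, Function.iterate_add_apply, iter_mul h]
  · rintro ⟨i, _, rfl⟩
    exact ⟨i, rfl⟩

lemma IsCyc.card {G : SimpleGraph V} {g : V → V} {x : V} {k : ℕ} (h : IsCyc G g x k) :
    (fwdOrbit g x).card = k := by
  have := h.three
  rw [fwdOrbit_eq_toFinset (by omega) h.per, List.toFinset_card_of_nodup h.nodup]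
  simp [cycleListAt]

lemma IsCyc.orbitList {G : SimpleGraph V} {α : List V → ℝ}
    (hαrot : ∀ l, IsCycleListOf G l → α (l.rotate 1) = α l)
    {g : V → V} {x : V} {k : ℕ} (h : IsCyc G g x k) :
    α (orbitCycleList g (fwdOrbit g x)) = α (cycleListAt g x k) := by
  unfold orbitCycleList
  have hne : (fwdOrbit g x).Nonempty := ⟨x, self_mem_fwdOrbit g x⟩
  rw [dif_pos hne]
  obtain ⟨j, hj⟩ := mem_fwdOrbit.1 hne.choose_spec
  rw [← hj, h.card, h.alpha hαrot]

lemma IsCyc.abar_eq {G : SimpleGraph V} {α : List V → ℝ}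
    (hαrot : ∀ l, IsCycleListOf G l → α (l.rotate 1) = α l)
    {g : V → V} {x : V} {k : ℕ} (h : IsCyc G g x k) :
    abar α g (fwdOrbit g x) = α (cycleListAt g x k) := by
  unfold abar
  rw [if_pos (by rw [h.card]; exact h.three), h.orbitList hαrot]

lemma abar_two {α : List V → ℝ} {g : V → V} {x : V} (h : g (g x) = x) :
    abar α g (fwdOrbit g x) = 0 := by
  unfold abar
  rw [if_neg]
  have h2 : g^[2] x = x := h
  rw [fwdOrbit_eq_toFinset (by norm_num) h2]
  have := List.toFinset_card_le (cycleListAt g x 2)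
  simp only [cycleListAt, List.length_map, List.length_range] at this ⊢
  omega

lemma ocrsf_cyc {G : SimpleGraph V} {f : V → V} (hf : IsOCRSF G f) {s : Finset V}
    (hs : s ∈ cyclesOfFun f) : ∃ x k, IsCyc G f x k ∧ s = fwdOrbit f x := by
  obtain ⟨x, ⟨k, hk, hkx⟩, rfl⟩ := mem_cycles.1 hs
  refine ⟨x, Function.minimalPeriod f x, ⟨?_, ?_, ?_, ?_⟩, rfl⟩
  · have h0 : 0 < Function.minimalPeriod f x :=
      Function.minimalPeriod_pos_of_mem_periodicPts ⟨k, hk, hkx⟩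
    have hp : f^[Function.minimalPeriod f x] x = x := Function.iterate_minimalPeriod
    by_contra hlt
    have : Function.minimalPeriod f x = 1 ∨ Function.minimalPeriod f x = 2 := by omega
    rcases this with h | h <;> rw [h] at hp
    · have := hf.1 x
      rw [show f x = x from hp] at this
      exact G.irrefl this
    · exact hf.2 x hp
  · exact Function.iterate_minimalPeriod
  · unfold cycleListAt
    refine List.Nodup.map_on ?_ List.nodup_range
    intro i hi j hj hij
    exact Function.iterate_injOn_Iio_minimalPeriod (by simpa using hi) (by simpa using hj) hij
  · intro i
    rw [Function.iterate_succ_apply']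
    exact hf.1 _

lemma AB_ocrsf {G : SimpleGraph V} (α : List V → ℝ) {f : V → V} (hf : IsOCRSF G f) :
    AB α Finset.univ f = ∏ s ∈ cyclesOfFun f, α (orbitCycleList f s) := by
  unfold AB
  rw [Finset.filter_true_of_mem (fun _ _ => Finset.subset_univ _)]
  refine Finset.prod_congr rfl fun s hs => ?_
  obtain ⟨x, k, h, rfl⟩ := ocrsf_cyc hf hs
  unfold abar
  rw [if_pos (by rw [h.card]; exact h.three)]

lemma AB_not_ocrsf (α : List V → ℝ) {f : V → V} {v : V} (h : f (f v) = v) :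
    AB α Finset.univ f = 0 := by
  unfold AB
  refine Finset.prod_eq_zero (i := fwdOrbit f v) ?_ (abar_two h)
  simp only [Finset.subset_univ, Finset.filter_true]
  exact mem_cycles.2 ⟨v, ⟨2, by norm_num, h⟩, rfl⟩

/-! paths -/

lemma PathTo.congr {G : SimpleGraph V} {a : V → Option V} {b g : V → V} :
    ∀ {P : List V} {w : V}, PathTo G a b w P → (∀ x ∈ P, g x = b x) → PathTo G a g w P
  | [], _, _, _ => trivial
  | v :: rest, w, h, hg => by
    obtain ⟨h1, h2, h3, h4, h5⟩ := h
    exact ⟨by rw [hg v (by simp), h1], h2, h3, h4,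
      h5.congr (fun x hx => hg x (by simp [hx]))⟩

lemma PathTo.nodup {G : SimpleGraph V} {a : V → Option V} {b : V → V} :
    ∀ {P : List V} {w : V}, PathTo G a b w P → P.Nodup
  | [], _, _ => List.nodup_nil
  | _ :: _, _, h => List.nodup_cons.2 ⟨h.2.2.2.1, h.2.2.2.2.nodup⟩

lemma PathTo.unassigned {G : SimpleGraph V} {a : V → Option V} {b : V → V} :
    ∀ {P : List V} {w : V}, PathTo G a b w P → ∀ x ∈ P, a x = none
  | [], _, _ => by simp
  | v :: rest, _, h => by
    intro x hx
    rcases List.mem_cons.1 hx with rfl | hx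
    · exact h.2.2.1
    · exact h.2.2.2.2.unassigned x hx

lemma PathTo.adj {G : SimpleGraph V} {a : V → Option V} {b : V → V} :
    ∀ {P : List V} {w : V}, PathTo G a b w P → ∀ x ∈ P, G.Adj x (b x)
  | [], _, _ => by simp
  | v :: rest, _, h => by
    intro x hx
    rcases List.mem_cons.1 hx with rfl | hx
    · rw [h.1]; exact h.2.1
    · exact h.2.2.2.2.adj x hx

lemma PathTo.map_mem {G : SimpleGraph V} {a : V → Option V} {b : V → V} :
    ∀ {P : List V} {w : V}, PathTo G a b w P → ∀ x ∈ P, b x = w ∨ b x ∈ P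
  | [], _, _ => by simp
  | v :: rest, _, h => by
    intro x hx
    rcases List.mem_cons.1 hx with rfl | hx
    · exact Or.inl h.1
    · rcases h.2.2.2.2.map_mem x hx with h | h
      · right; simp [h]
      · right; simp [h]

lemma PathTo.two {G : SimpleGraph V} {a : V → Option V} {b : V → V} :
    ∀ {P : List V} {w : V}, PathTo G a b w P → w ∉ P → ∀ x ∈ P, b x ∈ P → b (b x) ≠ x
  | [], _, _ => by simp
  | v :: rest, w, h => by
    intro hw x hx hbx
    obtain ⟨h1, h2, h3, h4, h5⟩ := h
    rcases List.mem_cons.1 hx with rfl | hx'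
    · rw [h1] at hbx; exact absurd hbx hw
    · rcases List.mem_cons.1 hbx with h | h
      · rw [h, h1]; rintro rfl; exact hw hx
      · exact h5.two h4 x hx' h

lemma PathTo.head {G : SimpleGraph V} {a : V → Option V} {b : V → V}
    {P : List V} {w y : V} (h : PathTo G a b w P) (hw : w ∉ P) (hy : y ∈ P) (hb : b y = w) :
    P.head? = some y := by
  cases P with
  | nil => simp at hy
  | cons r t =>
    rcases List.mem_cons.1 hy with rfl | hy
    · rfl
    · exfalso
      apply hw
      rw [← hb]
      rcases h.2.2.2.2.map_mem y hy with h | h <;> simp [h]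

lemma PathTo.drop {G : SimpleGraph V} {a : V → Option V} {b : V → V} :
    ∀ {P : List V} {w z : V}, PathTo G a b w P → z ∈ P →
      ∃ rest, P.dropWhile (fun u => decide (u ≠ z)) = z :: rest ∧ a z = none ∧ z ∉ rest ∧
        PathTo G a b z rest
  | [], _, _, _, hz => by simp at hz
  | v :: rest, w, z, h, hz => by
    by_cases hvz : v = z
    · subst hvz
      exact ⟨rest, by simp, h.2.2.1, h.2.2.2.1, h.2.2.2.2⟩
    · obtain ⟨r, hr⟩ := h.2.2.2.2.drop (z := z) (by
        rcases List.mem_cons.1 hz with h | h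
        · exact absurd h.symm hvz
        · exact h)
      refine ⟨r, ?_, hr.2⟩
      rw [← hr.1]
      simp [hvz]

lemma PathTo.cyc_aux {G : SimpleGraph V} {a : V → Option V} {b : V → V} {w : V} :
    ∀ {P : List V} {y : V}, PathTo G a b y P → w ∈ P →
      b^[(P.takeWhile (fun u => decide (u ≠ w))).length + 1] w = y ∧
      w :: (P.takeWhile (fun u => decide (u ≠ w))).reverse
        = cycleListAt b w ((P.takeWhile (fun u => decide (u ≠ w))).length + 1)
  | [], _, _, hw => by simp at hw
  | v :: rest, y, h, hw => by
    by_cases hvw : v = w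
    · subst hvw
      simp [cycleListAt, h.1]
    · have hw' : w ∈ rest := by
        rcases List.mem_cons.1 hw with h | h
        · exact absurd h.symm hvw
        · exact h
      obtain ⟨i1, i2⟩ := h.2.2.2.2.cyc_aux hw'
      have ht : (v :: rest).takeWhile (fun u => decide (u ≠ w))
          = v :: rest.takeWhile (fun u => decide (u ≠ w)) := by simp [hvw]
      rw [ht]
      constructor
      · rw [List.length_cons, Function.iterate_succ_apply', i1, h.1]
      · rw [List.length_cons, List.reverse_cons, ← List.cons_append, i2]
        conv_rhs => unfold cycleListAt
        rw [List.range_succ, List.map_append]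
        simp only [List.map_cons, List.map_nil]
        rw [i1]; rfl

lemma PathTo.isCyc {G : SimpleGraph V} {a : V → Option V} {b : V → V} {w v : V} {rest : List V}
    (h : PathTo G a b w (v :: rest)) (hw : w ∈ v :: rest) (hne : rest.head? ≠ some w) :
    ∃ k, IsCyc G b w k ∧ cycleOfPath (w :: v :: rest) = cycleListAt b w k := by
  obtain ⟨h1, h2⟩ := h.cyc_aux hw
  have hvw : v ≠ w := G.ne_of_adj h.2.1
  have hor : ∀ i : ℕ, b^[i] w ∈ v :: rest := by
    intro i
    induction i with
    | zero => exact hw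
    | succ i ih =>
      rw [Function.iterate_succ_apply']
      rcases h.map_mem _ ih with h | h
      · rw [h]; exact hw
      · exact h
  refine ⟨_, ⟨?_, h1, ?_, ?_⟩, h2⟩
  · cases rest with
    | nil => simp [hvw.symm] at hw
    | cons r t =>
      have hr : r ≠ w := by simpa using hne
      simp [hvw, hr]
  · rw [← h2, List.nodup_cons]
    constructor
    · intro hm
      have := List.mem_takeWhile_imp (List.mem_reverse.1 hm)
      simp at this
    · exact List.nodup_reverse.2 (h.nodup.sublist (List.takeWhile_sublist _))
  · intro i
    rw [Function.iterate_succ_apply']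
    exact h.adj _ (hor i)

lemma assignAlong_append (a : V → Option V) (l : List V) (v w : V) :
    assignAlong a (l ++ [v, w]) = Function.update (assignAlong a (l ++ [v])) v (some w) := by
  induction l generalizing a with
  | nil => rfl
  | cons x l ih =>
    cases l with
    | nil => rfl
    | cons y l =>
      simp only [List.cons_append, assignAlong] at ih ⊢
      exact ih _

lemma PathTo.assign {G : SimpleGraph V} {a : V → Option V} {b : V → V} :
    ∀ {P : List V} {w : V}, PathTo G a b w P →
      assignAlong a (P.reverse ++ [w]) = fun x => if x ∈ P then some (b x) else a x
  | [], w, _ => by funext x; simp [assignAlong]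
  | v :: rest, w, h => by
    rw [List.reverse_cons, List.append_assoc]
    show assignAlong a (rest.reverse ++ [v, w]) = _
    rw [assignAlong_append, h.2.2.2.2.assign]
    funext x
    by_cases hx : x = v
    · subst hx; simp [h.1]
    · simp [hx]

lemma GoodA.extend {G : SimpleGraph V} {a : V → Option V} {b : V → V} {w v : V} {rest : List V}
    (ha : GoodA G a b) (h : PathTo G a b w (v :: rest))
    (hw : (a w).isSome ∨ (w ∈ v :: rest ∧ rest.head? ≠ some w)) :
    GoodA G (fun x => if x ∈ v :: rest then some (b x) else a x) b := by
  intro x y hxy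
  have hnone := h.unassigned
  by_cases hx : x ∈ v :: rest
  · simp only [hx, if_true, Option.some.injEq] at hxy
    subst hxy
    refine ⟨rfl, h.adj x hx, ?_, ?_⟩
    · by_cases hb : b x ∈ v :: rest
      · simp [hb]
      · simp only [hb, if_false]
        rcases h.map_mem x hx with h' | h'
        · rw [h']
          rcases hw with hw | hw
          · exact hw
          · exact absurd (h' ▸ hw.1) hb
        · exact absurd h' hb
    · by_cases hb : b x ∈ v :: rest
      · simp only [hb, if_true, ne_eq, Option.some.injEq]
        by_cases hwP : w ∈ v :: rest
        · have hhead : rest.head? ≠ some w := by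
            rcases hw with hw | hw
            · rw [hnone w hwP] at hw; simp at hw
            · exact hw.2
          obtain ⟨h1, h2, h3, h4, h5⟩ := h
          have hvw : v ≠ w := G.ne_of_adj h2
          have hwr : w ∈ rest := by
            rcases List.mem_cons.1 hwP with h | h
            · exact absurd h.symm hvw
            · exact h
          rcases List.mem_cons.1 hx with rfl | hx'
          · rw [h1]
            intro hh
            exact hhead (h5.head h4 hwr hh)
          · rcases List.mem_cons.1 hb with hb' | hb'
            · rw [hb', h1]
              rintro rfl
              exact hhead (h5.head h4 hwr hb')
            · exact h5.two h4 x hx' hb'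
        · exact h.two hwP x hx hb
      · simp only [hb, if_false]
        intro hh
        have := (ha _ _ hh).2.2.1
        rw [hnone x hx] at this
        simp at this
  · simp only [hx, if_false] at hxy
    obtain ⟨h1, h2, h3, h4⟩ := ha x y hxy
    have hy : y ∉ v :: rest := by
      intro hy
      rw [hnone y hy] at h3
      simp at h3
    refine ⟨h1, h2, ?_, ?_⟩
    · simp only [hy, if_false]; exact h3
    · simp only [hy, if_false]; exact h4

def NPInv (G : SimpleGraph V) (a : V → Option V) (b : V → V) (path : List V) : Prop :=
  ∀ v rest, path = v :: rest → a v = none ∧ v ∉ rest ∧ PathTo G a b v rest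

def Inv (G : SimpleGraph V) (st : AlgState V) : Prop :=
  ∃ b, GoodA G st.assigned b ∧
    ((st.pending = true ∧ ∃ w v rest, st.path = w :: v :: rest ∧ w ∈ v :: rest ∧
      rest.head? ≠ some w ∧ PathTo G st.assigned b w (v :: rest)) ∨
     (st.pending = false ∧ NPInv G st.assigned b st.path))

lemma inv_init (G : SimpleGraph V) : Inv G (initState : AlgState V) := by
  refine ⟨id, ?_, Or.inr ⟨rfl, ?_⟩⟩
  · intro x y h; simp [initState] at h
  · intro v rest h; simp [initState] at h

lemma algStep_full {G : SimpleGraph V} {start : (V → Option V) → V} {st : AlgState V}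
    (h : ∀ v, (st.assigned v).isSome) (mv : V ⊕ Bool) : algStep G start st mv = none := by
  unfold algStep
  rw [if_pos h]

lemma algStep_inl {G : SimpleGraph V} {start : (V → Option V) → V} {a : V → Option V}
    {path : List V} {v : V} {rest : List V} (hf : ¬ ∀ v, (a v).isSome)
    (heff : (if path = [] then [start a] else path) = v :: rest) (w : V) :
    algStep G start ⟨a, path, false⟩ (Sum.inl w) =
      if G.Adj v w then
        if (a w).isSome then some ⟨assignAlong a ((v :: rest).reverse ++ [w]), [], false⟩
        else if w ∈ v :: rest then
          if rest.head? = some w then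
            some ⟨a, (v :: rest).dropWhile fun u => decide (u ≠ w), false⟩
          else some ⟨a, w :: v :: rest, true⟩
        else some ⟨a, w :: v :: rest, false⟩
      else none := by
  unfold algStep
  rw [if_neg hf, if_neg (by simp)]
  simp only [heff]
  rfl

lemma eff_path {G : SimpleGraph V} {start : (V → Option V) → V}
    (hstart : ∀ a : V → Option V, (∃ v, a v = none) → a (start a) = none)
    {a : V → Option V} {b : V → V} {path : List V} (hf : ¬ ∀ v, (a v).isSome)
    (h : NPInv G a b path) :
    ∃ v rest, (if path = [] then [start a] else path) = v :: rest ∧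
      a v = none ∧ v ∉ rest ∧ PathTo G a b v rest := by
  by_cases hp : path = []
  · refine ⟨start a, [], by simp [hp], hstart a ?_, by simp, trivial⟩
    push Not at hf
    obtain ⟨v, hv⟩ := hf
    exact ⟨v, by simpa using hv⟩
  · obtain ⟨v, rest, rfl⟩ := List.exists_cons_of_ne_nil hp
    exact ⟨v, rest, by simp, h v rest rfl⟩

lemma PathTo.push {G : SimpleGraph V} {a : V → Option V} {b : V → V} {v w : V} {rest : List V}
    (hv : a v = none) (hvr : v ∉ rest) (h : PathTo G a b v rest) (hadj : G.Adj v w) :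
    PathTo G a (Function.update b v w) w (v :: rest) := by
  refine ⟨by simp, hadj, hv, hvr, h.congr fun x hx => ?_⟩
  rw [Function.update_of_ne]
  rintro rfl
  exact hvr hx

lemma GoodA.upd {G : SimpleGraph V} {a : V → Option V} {b : V → V} {v : V} (w : V)
    (ha : GoodA G a b) (hv : a v = none) : GoodA G a (Function.update b v w) := by
  intro x y h
  rw [Function.update_of_ne]
  · exact ha x y h
  · rintro rfl
    rw [hv] at h
    exact absurd h (by simp)

lemma npinv_drop {G : SimpleGraph V} {a : V → Option V} {b : V → V} {w z : V} {P : List V}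
    (h : PathTo G a b w P) (hz : z ∈ P) :
    NPInv G a b (P.dropWhile fun u => decide (u ≠ z)) := by
  obtain ⟨r, hr, h1⟩ := h.drop hz
  intro v rest he
  rw [hr] at he
  obtain ⟨rfl, rfl⟩ := List.cons.inj he
  exact h1

lemma npinv_nil {G : SimpleGraph V} {a : V → Option V} {b : V → V} : NPInv G a b [] := by
  intro v rest h
  exact absurd h (by simp)

lemma algStep_keep {G : SimpleGraph V} {start : (V → Option V) → V} {a : V → Option V}
    {path : List V} (hf : ¬ ∀ v, (a v).isSome) :
    algStep G start ⟨a, path, true⟩ (Sum.inr true) =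
      some ⟨assignAlong a path.reverse, [], false⟩ := by
  unfold algStep
  rw [if_neg hf]
  simp

lemma algStep_pop {G : SimpleGraph V} {start : (V → Option V) → V} {a : V → Option V}
    {w : V} {p : List V} (hf : ¬ ∀ v, (a v).isSome) :
    algStep G start ⟨a, w :: p, true⟩ (Sum.inr false) =
      some ⟨a, p.dropWhile fun u => decide (u ≠ w), false⟩ := by
  unfold algStep
  rw [if_neg hf]
  simp

lemma algStep_pend_inl {G : SimpleGraph V} {start : (V → Option V) → V} {a : V → Option V}
    {path : List V} (x : V) :
    algStep G start ⟨a, path, true⟩ (Sum.inl x) = none := by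
  unfold algStep
  split_ifs <;> simp_all

lemma algStep_np_inr {G : SimpleGraph V} {start : (V → Option V) → V} {a : V → Option V}
    {path : List V} (x : Bool) :
    algStep G start ⟨a, path, false⟩ (Sum.inr x) = none := by
  unfold algStep
  split_ifs <;> simp_all

lemma inv_step {G : SimpleGraph V} {start : (V → Option V) → V}
    (hstart : ∀ a : V → Option V, (∃ v, a v = none) → a (start a) = none)
    {st st' : AlgState V} {mv : V ⊕ Bool} (h : Inv G st) (hs : algStep G start st mv = some st') :
    Inv G st' := by
  obtain ⟨a, path, pending⟩ := st
  have hf : ¬ ∀ v, (a v).isSome := by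
    intro hf
    rw [algStep_full (st := ⟨a, path, pending⟩) hf] at hs
    exact absurd hs (by simp)
  obtain ⟨b, hg, ⟨hp, w, v, rest, h1, h2, h3, h4⟩ | ⟨hp, h1⟩⟩ := h
  · simp only at hp h1 hg h4
    subst hp h1
    rcases mv with x | (_ | _)
    · rw [algStep_pend_inl] at hs; exact absurd hs (by simp)
    · rw [algStep_pop hf] at hs
      obtain rfl := Option.some.inj hs
      exact ⟨b, hg, Or.inr ⟨rfl, npinv_drop h4 h2⟩⟩
    · rw [algStep_keep hf, List.reverse_cons, h4.assign] at hs
      obtain rfl := Option.some.inj hs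
      exact ⟨b, hg.extend h4 (Or.inr ⟨h2, h3⟩), Or.inr ⟨rfl, npinv_nil⟩⟩
  · simp only at hp h1 hg
    subst hp
    rcases mv with w | x
    swap
    · rw [algStep_np_inr] at hs; exact absurd hs (by simp)
    obtain ⟨v, rest, heff, hv, hvr, hP⟩ := eff_path (start := start) hstart hf h1
    rw [algStep_inl hf heff] at hs
    split_ifs at hs with c1 c2 c3 c4
    · have hP' := hP.push hv hvr c1
      rw [hP'.assign] at hs
      obtain rfl := Option.some.inj hs
      exact ⟨_, (hg.upd w hv).extend hP' (Or.inl c2), Or.inr ⟨rfl, npinv_nil⟩⟩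
    · obtain rfl := Option.some.inj hs
      exact ⟨_, hg.upd w hv, Or.inr ⟨rfl, npinv_drop (hP.push hv hvr c1) c3⟩⟩
    · obtain rfl := Option.some.inj hs
      exact ⟨_, hg.upd w hv, Or.inl ⟨rfl, w, v, rest, rfl, c3, c4, hP.push hv hvr c1⟩⟩
    · obtain rfl := Option.some.inj hs
      refine ⟨_, hg.upd w hv, Or.inr ⟨rfl, ?_⟩⟩
      intro v' rest' he
      obtain ⟨rfl, rfl⟩ := List.cons.inj he
      exact ⟨by simpa using c2, c3, hP.push hv hvr c1⟩

lemma inv_run {G : SimpleGraph V} {start : (V → Option V) → V}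
    (hstart : ∀ a : V → Option V, (∃ v, a v = none) → a (start a) = none) :
    ∀ (r : List (V ⊕ Bool)) {st st' : AlgState V}, Inv G st →
      runState G start st r = some st' → Inv G st'
  | [], st, st', h, hr => by
    obtain rfl := Option.some.inj hr
    exact h
  | mv :: r, st, st', h, hr => by
    unfold runState at hr
    cases hs : algStep G start st mv with
    | none => rw [hs] at hr; simp at hr
    | some s =>
      rw [hs] at hr
      exact inv_run hstart r (inv_step hstart h hs) hr

lemma inv_output {G : SimpleGraph V} {st : AlgState V} {f : V → V} (h : Inv G st)
    (hf : ∀ v, st.assigned v = some (f v)) : IsOCRSF G f := by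
  obtain ⟨b, hg, _⟩ := h
  refine ⟨fun v => (hg v _ (hf v)).2.1, fun v hv => ?_⟩
  have := (hg v _ (hf v)).2.2.2
  rw [hf, hv] at this
  exact this rfl

/-! probabilities -/

def pc (c : V → V → ℝ) (v w : V) : ℝ := c v w / ∑ u, c v u

def nextVal (G : SimpleGraph V) (start : (V → Option V) → V) (d : AlgState V → ℝ)
    (st : AlgState V) (mv : V ⊕ Bool) : ℝ :=
  match algStep G start st mv with
  | some st' => d st'
  | none => 0

lemma nextVal_some {G : SimpleGraph V} {start : (V → Option V) → V} {d : AlgState V → ℝ}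
    {st st' : AlgState V} {mv : V ⊕ Bool} (h : algStep G start st mv = some st') :
    nextVal G start d st mv = d st' := by
  unfold nextVal; rw [h]

lemma sum_moves_np {c : V → V → ℝ} {α : List V → ℝ} {start : (V → Option V) → V}
    {a : V → Option V} {path : List V} {v : V} {rest : List V}
    (heff : (if path = [] then [start a] else path) = v :: rest) (F : V ⊕ Bool → ℝ) :
    ∑ mv, moveProb c α start ⟨a, path, false⟩ mv * F mv = ∑ w, pc c v w * F (Sum.inl w) := by
  rw [Fintype.sum_sum_type]
  have h2 : ∑ x : Bool, moveProb c α start ⟨a, path, false⟩ (Sum.inr x) * F (Sum.inr x) = 0 := by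
    apply Finset.sum_eq_zero
    intro x _
    simp [moveProb]
  rw [h2, add_zero]
  refine Finset.sum_congr rfl fun w _ => ?_
  congr 1
  simp only [moveProb, heff, Bool.false_eq_true, if_false, pc]

lemma sum_moves_pend {c : V → V → ℝ} {α : List V → ℝ} {start : (V → Option V) → V}
    {a : V → Option V} {path : List V} (F : V ⊕ Bool → ℝ) :
    ∑ mv, moveProb c α start ⟨a, path, true⟩ mv * F mv =
      α (cycleOfPath path) * F (Sum.inr true) + (1 - α (cycleOfPath path)) * F (Sum.inr false) := by
  rw [Fintype.sum_sum_type]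
  simp [moveProb]

def ind (f g : V → V) : ℝ := if g = f then 1 else 0

def unas (a : V → Option V) : Finset V := Finset.univ.filter fun x => a x = none

def Psi (α : List V → ℝ) (d : AlgState V → ℝ) (f : V → V) (a : V → Option V) (B : Finset V)
    (rest : List V) (v : V) (g : V → V) : ℝ :=
  ind f g + ∑ z ∈ rest.toFinset, if Exit B g v z then
    (1 - abar α g (fwdOrbit g z)) *
      (d ⟨a, rest.dropWhile fun u => decide (u ≠ z), false⟩ - ind f g) else 0

lemma EB_congr {p : V → V → ℝ} {B : Finset V} {b : V → V} {φ ψ : (V → V) → ℝ}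
    (h : ∀ g, φ (ov B b g) = ψ (ov B b g)) : EB p B b φ = EB p B b ψ := by
  unfold EB
  exact Finset.sum_congr rfl fun g _ => by rw [h]

lemma EB_lin {p : V → V → ℝ} {B : Finset V} {b : V → V} (φ ψ : (V → V) → ℝ) (s t : ℝ) :
    EB p B b (fun g => s * φ g + t * ψ g) = s * EB p B b φ + t * EB p B b ψ := by
  unfold EB
  rw [Finset.mul_sum, Finset.mul_sum, ← Finset.sum_add_distrib]
  exact Finset.sum_congr rfl fun g _ => by ring

lemma Psi_nil {α : List V → ℝ} {d : AlgState V → ℝ} {f : V → V} {a : V → Option V}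
    {B : Finset V} {v : V} {g : V → V} : Psi α d f a B [] v g = ind f g := by
  simp [Psi]

lemma Psi_out {α : List V → ℝ} {d : AlgState V → ℝ} {f : V → V} {a : V → Option V}
    {B : Finset V} {P : List V} {w : V} {g : V → V} (hw : w ∉ B) (hP : w ∉ P) :
    Psi α d f a B P w g = ind f g := by
  unfold Psi
  rw [Finset.sum_eq_zero, add_zero]
  intro z hz
  rw [if_neg]
  rw [exit_not_mem hw]
  rintro rfl
  exact hP (List.mem_toFinset.1 hz)

lemma Psi_in {α : List V → ℝ} {d : AlgState V → ℝ} {f : V → V} {a : V → Option V}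
    {B : Finset V} {P : List V} {w : V} {g : V → V} (hw : w ∉ B) (hP : w ∈ P) :
    Psi α d f a B P w g = ind f g + (1 - abar α g (fwdOrbit g w)) *
      (d ⟨a, P.dropWhile fun u => decide (u ≠ w), false⟩ - ind f g) := by
  unfold Psi
  rw [Finset.sum_eq_single w]
  · rw [if_pos ((exit_not_mem hw).2 rfl)]
  · intro z _ hz
    rw [if_neg]
    rw [exit_not_mem hw]
    exact hz
  · intro h
    exact absurd (List.mem_toFinset.2 hP) h

lemma pointwise {α : List V → ℝ} {d : AlgState V → ℝ} {f : V → V} {a : V → Option V}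
    {B : Finset V} {rest : List V} {v : V} {g : V → V} (hv : v ∈ B) (hvr : v ∉ rest)
    (hr : ∀ z ∈ rest, z ∉ B) :
    AB α (B.erase v) g * Psi α d f a (B.erase v) (v :: rest) (g v) g =
      AB α B g * Psi α d f a B rest v g +
        (AB α (B.erase v) g - AB α B g) * d ⟨a, v :: rest, false⟩ := by
  have h1 : Psi α d f a (B.erase v) (v :: rest) (g v) g = Psi α d f a B rest v g +
      if Exit (B.erase v) g (g v) v then
        (1 - abar α g (fwdOrbit g v)) * (d ⟨a, v :: rest, false⟩ - ind f g) else 0 := by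
    unfold Psi
    rw [List.toFinset_cons, Finset.sum_insert (by simpa using hvr), add_assoc]
    congr 1
    rw [add_comm]
    congr 1
    · refine Finset.sum_congr rfl fun z hz => ?_
      have hz' := List.mem_toFinset.1 hz
      have hvz : v ≠ z := by rintro rfl; exact hvr hz'
      rw [List.dropWhile_cons_of_pos (by simpa using hvz)]
      simp only [exit_step hv (hr z hz')]
    · rw [List.dropWhile_cons_of_neg (by simp)]
  rw [h1, AB_erase α hv]
  split_ifs with h
  · have h2 : Psi α d f a B rest v g = ind f g := by
      unfold Psi
      rw [Finset.sum_eq_zero, add_zero]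
      intro z hz
      rw [if_neg]
      rintro ⟨hzB, n, hn, _⟩
      exact hzB (((exit_self hv).1 h).2 (mem_fwdOrbit.2 ⟨n, hn⟩))
    rw [h2]
    ring
  · ring

section Claims

variable {G : SimpleGraph V} {c : V → V → ℝ} {α : List V → ℝ} {start : (V → Option V) → V}
  {d : AlgState V → ℝ} {f : V → V}

lemma step_eq
    (Hstep : ∀ st, Inv G st → (¬ ∀ v, (st.assigned v).isSome) →
      d st = ∑ mv, moveProb c α start st mv * nextVal G start d st mv)
    {a : V → Option V} {b : V → V} {path : List V} {v : V} {rest : List V}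
    (hg : GoodA G a b) (hnp : NPInv G a b path)
    (heff : (if path = [] then [start a] else path) = v :: rest) (hv : a v = none) :
    d ⟨a, path, false⟩ = ∑ w, pc c v w * nextVal G start d ⟨a, path, false⟩ (Sum.inl w) := by
  rw [Hstep ⟨a, path, false⟩ ⟨b, hg, Or.inr ⟨rfl, hnp⟩⟩ (by
    intro h
    have := h v
    simp [hv] at this)]
  exact sum_moves_np heff _

lemma star
    (hαrot : ∀ l, IsCycleListOf G l → α (l.rotate 1) = α l)
    (Hstep : ∀ st, Inv G st → (¬ ∀ v, (st.assigned v).isSome) →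
      d st = ∑ mv, moveProb c α start st mv * nextVal G start d st mv)
    {a : V → Option V}
    (IHtop : ∀ a' b', GoodA G a' b' → (unas a').card < (unas a).card →
      ZB (pc c) α (unas a') * d ⟨a', [], false⟩
        = EB (pc c) (unas a') b' (fun g => AB α (unas a') g * ind f g))
    {b : V → V} {path : List V} {v : V} {rest : List V} {B : Finset V}
    (hB : B = (unas a \ rest.toFinset).erase v)
    (hg : GoodA G a b) (hv : a v = none) (hvr : v ∉ rest) (hP : PathTo G a b v rest)
    (heff : (if path = [] then [start a] else path) = v :: rest) {w : V} (hadj : G.Adj v w)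
    (IH : w ∈ B → ZB (pc c) α B * d ⟨a, w :: v :: rest, false⟩ =
      EB (pc c) B (Function.update b v w)
        (fun g => AB α B g * Psi α d f a B (v :: rest) w g)) :
    ZB (pc c) α B * nextVal G start d ⟨a, path, false⟩ (Sum.inl w) =
      EB (pc c) B (Function.update b v w)
        (fun g => AB α B g * Psi α d f a B (v :: rest) w g) := by
  have hf : ¬ ∀ v, (a v).isSome := by
    intro h
    have := h v
    simp [hv] at this
  have hP' := hP.push hv hvr hadj
  have hg' := hg.upd w hv
  have hstep := algStep_inl (G := G) hf heff w
  rw [if_pos hadj] at hstep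
  have hmemB : ∀ x, x ∈ B ↔ a x = none ∧ x ∉ v :: rest := by
    intro x
    rw [hB]
    simp only [unas, Finset.mem_erase, Finset.mem_sdiff, Finset.mem_filter, Finset.mem_univ,
      true_and, List.mem_toFinset, List.mem_cons]
    tauto
  have hU : unas (fun x => if x ∈ v :: rest then some (Function.update b v w x) else a x) = B := by
    ext x
    rw [hmemB]
    simp only [unas, Finset.mem_filter, Finset.mem_univ, true_and]
    split_ifs with h <;> simp [h]
  have hcard : B.card < (unas a).card := by
    apply Finset.card_lt_card
    refine ⟨fun x hx => by simp [unas, ((hmemB x).1 hx).1], fun h => ?_⟩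
    have := h (show v ∈ unas a by simp [unas, hv])
    rw [hmemB] at this
    simp at this
  have htop : ((a w).isSome ∨ (w ∈ v :: rest ∧ rest.head? ≠ some w)) →
      ZB (pc c) α B * d ⟨assignAlong a ((v :: rest).reverse ++ [w]), [], false⟩ =
      EB (pc c) B (Function.update b v w) (fun g => AB α B g * ind f g) := by
    intro h
    have := IHtop _ _ (hg'.extend hP' h) (by rw [hU]; exact hcard)
    rw [hU] at this
    rw [hP'.assign]
    exact this
  have hov : ∀ g, PathTo G a (ov B (Function.update b v w) g) w (v :: rest) := by
    intro g
    refine hP'.congr fun x hx => ?_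
    unfold ov
    rw [if_neg]
    rw [hmemB]
    tauto
  by_cases c2 : (a w).isSome
  · rw [if_pos c2] at hstep
    rw [nextVal_some hstep, htop (Or.inl c2)]
    refine EB_congr fun g => ?_
    rw [Psi_out]
    · rw [hmemB]; rintro ⟨h, _⟩; simp [h] at c2
    · intro h; simp [hP'.unassigned w h] at c2
  rw [if_neg c2] at hstep
  by_cases c3 : w ∈ v :: rest
  · have hwB : w ∉ B := by rw [hmemB]; tauto
    rw [if_pos c3] at hstep
    have hexp : ∀ κ : ℝ, (∀ g, abar α (ov B (Function.update b v w) g)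
        (fwdOrbit (ov B (Function.update b v w) g) w) = κ) →
        EB (pc c) B (Function.update b v w) (fun g => AB α B g * Psi α d f a B (v :: rest) w g)
        = ((1 - κ) * d ⟨a, (v :: rest).dropWhile fun u => decide (u ≠ w), false⟩) * ZB (pc c) α B
          + κ * EB (pc c) B (Function.update b v w) (fun g => AB α B g * ind f g) := by
      intro κ hκ
      rw [← EB_AB (pc c) α (Finset.Subset.refl B) (Function.update b v w), ← EB_lin]
      refine EB_congr fun g => ?_
      rw [Psi_in hwB c3, hκ]
      ring
    by_cases c4 : rest.head? = some w
    · rw [if_pos c4] at hstep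
      rw [nextVal_some hstep, hexp 0]
      · ring
      · intro g
        apply abar_two
        have h := hov g
        obtain ⟨t, rfl⟩ : ∃ t, rest = w :: t := by
          cases rest with
          | nil => simp at c4
          | cons x t => exact ⟨t, by simpa using c4⟩
        rw [h.2.2.2.2.1, h.1]
    · rw [if_neg c4] at hstep
      have hpend : d ⟨a, w :: v :: rest, true⟩ = α (cycleOfPath (w :: v :: rest)) *
            d ⟨assignAlong a ((v :: rest).reverse ++ [w]), [], false⟩ +
          (1 - α (cycleOfPath (w :: v :: rest))) *
            d ⟨a, (v :: rest).dropWhile fun u => decide (u ≠ w), false⟩ := by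
        rw [Hstep _ ⟨_, hg', Or.inl ⟨rfl, w, v, rest, rfl, c3, c4, hP'⟩⟩ hf, sum_moves_pend,
          nextVal_some (algStep_keep hf), nextVal_some (algStep_pop hf), List.reverse_cons]
      rw [nextVal_some hstep, hpend, hexp (α (cycleOfPath (w :: v :: rest))),
        ← htop (Or.inr ⟨c3, c4⟩)]
      · ring
      · intro g
        obtain ⟨k, hk, hk'⟩ := (hov g).isCyc c3 c4
        rw [hk.abar_eq hαrot, hk']
  · rw [if_neg c3] at hstep
    rw [nextVal_some hstep]
    exact IH ((hmemB w).2 ⟨by simpa using c2, c3⟩)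

lemma path_claim
    (hp : ∀ x, ∑ w, pc c x w = 1)
    (hc_zero : ∀ v w, ¬G.Adj v w → c v w = 0)
    (hαrot : ∀ l, IsCycleListOf G l → α (l.rotate 1) = α l)
    (Hstep : ∀ st, Inv G st → (¬ ∀ v, (st.assigned v).isSome) →
      d st = ∑ mv, moveProb c α start st mv * nextVal G start d st mv)
    {a : V → Option V}
    (IHtop : ∀ a' b', GoodA G a' b' → (unas a').card < (unas a).card →
      ZB (pc c) α (unas a') * d ⟨a', [], false⟩
        = EB (pc c) (unas a') b' (fun g => AB α (unas a') g * ind f g)) (n : ℕ) :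
    ∀ (b : V → V) (v : V) (rest : List V) (B : Finset V), B = unas a \ rest.toFinset →
      B.card = n → GoodA G a b → a v = none → v ∉ rest → PathTo G a b v rest →
      ZB (pc c) α B * d ⟨a, v :: rest, false⟩ =
        EB (pc c) B b (fun g => AB α B g * Psi α d f a B rest v g) := by
  induction n using Nat.strong_induction_on with
  | _ n IH =>
  intro b v rest B hB hn hg hv hvr hP
  have hvB : v ∈ B := by rw [hB]; simp [unas, hv, hvr]
  have hrB : ∀ z ∈ rest, z ∉ B := by intro z hz; rw [hB]; simp [hz]
  have hnp : NPInv G a b (v :: rest) := by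
    intro v' rest' he
    obtain ⟨rfl, rfl⟩ := List.cons.inj he
    exact ⟨hv, hvr, hP⟩
  have heff : (if v :: rest = [] then [start a] else v :: rest) = v :: rest := by simp
  have h1 := step_eq Hstep hg hnp heff hv
  have hstar : ∀ w, G.Adj v w →
      ZB (pc c) α (B.erase v) * nextVal G start d ⟨a, v :: rest, false⟩ (Sum.inl w) =
      EB (pc c) (B.erase v) (Function.update b v w)
        (fun g => AB α (B.erase v) g * Psi α d f a (B.erase v) (v :: rest) w g) := by
    intro w hadj
    refine star hαrot Hstep IHtop (by rw [hB]) hg hv hvr hP heff hadj ?_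
    intro hw
    have hw' := Finset.mem_erase.1 hw
    have hw2 := hw'.2
    rw [hB] at hw2
    simp only [unas, Finset.mem_sdiff, Finset.mem_filter, Finset.mem_univ, true_and,
      List.mem_toFinset] at hw2
    refine IH (B.erase v).card ?_ _ w (v :: rest) _ ?_ rfl (hg.upd w hv) hw2.1 ?_
      (hP.push hv hvr hadj)
    · rw [← hn]; exact Finset.card_erase_lt_of_mem hvB
    · rw [hB, List.toFinset_cons]
      ext x
      simp only [Finset.mem_erase, Finset.mem_sdiff, Finset.mem_insert]
      tauto
    · simp only [List.mem_cons, not_or]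
      exact ⟨hw'.1, hw2.2⟩
  have h2 : ZB (pc c) α (B.erase v) * d ⟨a, v :: rest, false⟩ =
      EB (pc c) B b
        (fun g => AB α (B.erase v) g * Psi α d f a (B.erase v) (v :: rest) (g v) g) := by
    rw [EB_split (pc c) hp B b v hvB]
    conv_lhs => rw [h1, Finset.mul_sum]
    refine Finset.sum_congr rfl fun w _ => ?_
    by_cases hadj : G.Adj v w
    · rw [mul_left_comm, hstar w hadj]
      congr 1
      refine EB_congr fun g => ?_
      have : ov (B.erase v) (Function.update b v w) g v = w := by simp [ov]
      rw [this]
    · have : pc c v w = 0 := by simp [pc, hc_zero v w hadj]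
      rw [this]; ring
  have h3 : EB (pc c) B b
        (fun g => AB α (B.erase v) g * Psi α d f a (B.erase v) (v :: rest) (g v) g)
      = EB (pc c) B b (fun g => AB α B g * Psi α d f a B rest v g)
        + d ⟨a, v :: rest, false⟩ * (ZB (pc c) α (B.erase v) - ZB (pc c) α B) := by
    have e1 := EB_AB (pc c) α (Finset.erase_subset v B) b
    have e2 := EB_AB (pc c) α (Finset.Subset.refl B) b
    rw [← e1, ← e2]
    unfold EB
    rw [← Finset.sum_sub_distrib, Finset.mul_sum, ← Finset.sum_add_distrib]
    refine Finset.sum_congr rfl fun g _ => ?_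
    beta_reduce
    rw [pointwise hvB hvr hrB]
    ring
  rw [h3] at h2
  linarith

lemma top_claim
    (hp : ∀ x, ∑ w, pc c x w = 1)
    (hc_zero : ∀ v w, ¬G.Adj v w → c v w = 0)
    (hαrot : ∀ l, IsCycleListOf G l → α (l.rotate 1) = α l)
    (hstart : ∀ a : V → Option V, (∃ v, a v = none) → a (start a) = none)
    (Hfull : ∀ st : AlgState V, (∀ v, (st.assigned v).isSome) →
      d st = if ∀ v, st.assigned v = some (f v) then 1 else 0)
    (Hstep : ∀ st, Inv G st → (¬ ∀ v, (st.assigned v).isSome) →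
      d st = ∑ mv, moveProb c α start st mv * nextVal G start d st mv)
    (n : ℕ) :
    ∀ (a : V → Option V) (b : V → V), GoodA G a b → (unas a).card = n →
      ZB (pc c) α (unas a) * d ⟨a, [], false⟩
        = EB (pc c) (unas a) b (fun g => AB α (unas a) g * ind f g) := by
  induction n using Nat.strong_induction_on with
  | _ n IH =>
  intro a b hg hn
  by_cases hf : ∀ v, (a v).isSome
  · have hU : unas a = ∅ := by
      ext x
      have := hf x
      simp only [unas, Finset.mem_filter, Finset.mem_univ, true_and, Finset.notMem_empty,
        iff_false]
      intro h
      simp [h] at this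
    have hab : ∀ x, a x = some (b x) := by
      intro x
      obtain ⟨y, hy⟩ := Option.isSome_iff_exists.1 (hf x)
      rw [hy, (hg x y hy).1]
    rw [hU, ← EB_AB (pc c) α (Finset.Subset.refl ∅) b, Hfull _ hf]
    unfold EB
    rw [Finset.sum_mul]
    refine Finset.sum_congr rfl fun g _ => ?_
    have h1 : ov ∅ b g = b := by funext x; simp [ov]
    have h2 : (∀ v, a v = some (f v)) ↔ b = f := by
      simp only [hab, Option.some.injEq, funext_iff]
    rw [h1, mul_assoc]
    congr 2
    unfold ind
    simp only [h2]
  · obtain ⟨v, rest, heff, hv, hvr, hP⟩ :=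
      eff_path (G := G) (b := b) (path := []) (start := start) hstart hf npinv_nil
    have hrest : rest = [] ∧ v = start a := by
      simp only [if_true] at heff
      obtain ⟨h1, h2⟩ := List.cons.inj heff
      exact ⟨h2.symm, h1.symm⟩
    obtain ⟨rfl, rfl⟩ := hrest
    have hd : d ⟨a, [], false⟩ = d ⟨a, [start a], false⟩ := by
      have hnp : NPInv G a b [start a] := by
        intro v' rest' he
        obtain ⟨rfl, rfl⟩ := List.cons.inj he
        exact ⟨hv, hvr, hP⟩
      have heff2 : (if [start a] = [] then [start a] else [start a]) = [start a] := by simp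
      rw [step_eq Hstep hg npinv_nil heff hv, step_eq Hstep hg hnp heff2 hv]
      refine Finset.sum_congr rfl fun w _ => ?_
      unfold nextVal
      rw [algStep_inl hf heff, algStep_inl hf heff2]
    rw [hd, path_claim (f := f) hp hc_zero hαrot Hstep
      (fun a' b' hg' hlt => IH _ (by omega) a' b' hg' rfl) n b (start a) [] (unas a) (by simp) hn hg
      hv hvr hP]
    simp only [Psi_nil]

lemma init_claim
    (hp : ∀ x, ∑ w, pc c x w = 1)
    (hc_zero : ∀ v w, ¬G.Adj v w → c v w = 0)
    (hαrot : ∀ l, IsCycleListOf G l → α (l.rotate 1) = α l)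
    (hstart : ∀ a : V → Option V, (∃ v, a v = none) → a (start a) = none)
    (Hfull : ∀ st : AlgState V, (∀ v, (st.assigned v).isSome) →
      d st = if ∀ v, st.assigned v = some (f v) then 1 else 0)
    (Hstep : ∀ st, Inv G st → (¬ ∀ v, (st.assigned v).isSome) →
      d st = ∑ mv, moveProb c α start st mv * nextVal G start d st mv) :
    ZB (pc c) α Finset.univ * d initState = Pg (pc c) f * AB α Finset.univ f := by
  have hg : GoodA G (fun _ : V => none) id := by intro x y h; simp at h
  have h := top_claim hp hc_zero hαrot hstart Hfull Hstep _ _ id hg rfl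
  have hU : unas (fun _ : V => (none : Option V)) = Finset.univ := by simp [unas]
  rw [hU] at h
  unfold initState
  rw [h]
  unfold EB
  rw [Finset.sum_eq_single f]
  · have : ov Finset.univ id f = f := by funext x; simp [ov]
    simp [this, ind]
  · intro g _ hgf
    have : ov Finset.univ id g = g := by funext x; simp [ov]
    simp [this, ind, hgf]
  · simp

end Claims

/-! summation over runs -/

def phi (G : SimpleGraph V) (c : V → V → ℝ) (α : List V → ℝ) (start : (V → Option V) → V)
    (f : V → V) (st : AlgState V) (r : List (V ⊕ Bool)) : ℝ :=
  if ∃ st', runState G start st r = some st' ∧ ∀ v, st'.assigned v = some (f v) then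
    runProb G c α start st r else 0

def runsLe (V : Type*) [Fintype V] [DecidableEq V] : ℕ → Finset (List (V ⊕ Bool))
  | 0 => {[]}
  | n + 1 => insert [] ((Finset.univ ×ˢ runsLe V n).image fun q => q.1 :: q.2)

lemma mem_runsLe (n : ℕ) (r : List (V ⊕ Bool)) : r ∈ runsLe V n ↔ r.length ≤ n := by
  induction n generalizing r with
  | zero => simp [runsLe]
  | succ n ih =>
    cases r with
    | nil => simp [runsLe]
    | cons x r => simp [runsLe, ih]

lemma sum_runsLe (n : ℕ) (F : List (V ⊕ Bool) → ℝ) :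
    ∑ r ∈ runsLe V (n+1), F r = F [] + ∑ mv, ∑ r ∈ runsLe V n, F (mv :: r) := by
  rw [runsLe, Finset.sum_insert (by simp), Finset.sum_image, Finset.sum_product]
  rintro ⟨x, r⟩ _ ⟨x', r'⟩ _ h
  simpa using h

section Sums

variable {G : SimpleGraph V} {c : V → V → ℝ} {α : List V → ℝ} {start : (V → Option V) → V}
  {f : V → V}

lemma phi_nil (st : AlgState V) :
    phi G c α start f st [] = if ∀ v, st.assigned v = some (f v) then 1 else 0 := by
  simp [phi, runState, runProb]

lemma phi_cons (st : AlgState V) (mv : V ⊕ Bool) (r : List (V ⊕ Bool)) :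
    phi G c α start f st (mv :: r) =
      moveProb c α start st mv * nextVal G start (fun s => phi G c α start f s r) st mv := by
  have e1 : runState G start st (mv :: r) = (match algStep G start st mv with
      | some st' => runState G start st' r
      | none => none) := rfl
  unfold phi nextVal
  rw [e1, runProb]
  cases h : algStep G start st mv with
  | none => simp
  | some s =>
    simp only
    split_ifs <;> simp

lemma nextVal_sum (S : Finset (List (V ⊕ Bool))) (F : AlgState V → List (V ⊕ Bool) → ℝ)
    (st : AlgState V) (mv : V ⊕ Bool) :
    ∑ r ∈ S, nextVal G start (fun s => F s r) st mv
      = nextVal G start (fun s => ∑ r ∈ S, F s r) st mv := by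
  unfold nextVal
  cases h : algStep G start st mv <;> simp

lemma phi_sum_succ (n : ℕ) (st : AlgState V) :
    ∑ r ∈ runsLe V (n+1), phi G c α start f st r = phi G c α start f st [] +
      ∑ mv, moveProb c α start st mv *
        nextVal G start (fun s => ∑ r ∈ runsLe V n, phi G c α start f s r) st mv := by
  rw [sum_runsLe]
  congr 1
  refine Finset.sum_congr rfl fun mv _ => ?_
  simp only [phi_cons]
  rw [← Finset.mul_sum, nextVal_sum]

lemma moveProb_nonneg (hc : ∀ v w, 0 ≤ c v w)
    (hα01 : ∀ l, IsCycleListOf G l → 0 ≤ α l ∧ α l ≤ 1)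
    {st : AlgState V} (h : Inv G st) (mv : V ⊕ Bool) : 0 ≤ moveProb c α start st mv := by
  obtain ⟨a, path, pending⟩ := st
  obtain ⟨b, hg, ⟨hp, w, v, rest, h1, h2, h3, h4⟩ | ⟨hp, h1⟩⟩ := h
  · simp only at hp h1 h4
    subst hp h1
    obtain ⟨k, hk, hk'⟩ := h4.isCyc h2 h3
    have := hα01 _ hk.list
    rw [← hk'] at this
    rcases mv with x | (_ | _)
    · simp [moveProb]
    · simp only [moveProb, if_true]; linarith
    · simp only [moveProb, if_true]; linarith
  · simp only at hp
    subst hp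
    rcases mv with w | x
    · simp only [moveProb, Bool.false_eq_true, if_false]
      split
      · exact div_nonneg (hc _ _) (Finset.sum_nonneg fun _ _ => hc _ _)
      · exact le_refl _
    · simp [moveProb]

lemma moveProb_sum (hp : ∀ x, ∑ w, pc c x w = 1)
    (hstart : ∀ a : V → Option V, (∃ v, a v = none) → a (start a) = none)
    {st : AlgState V} (h : Inv G st) (hf : ¬ ∀ v, (st.assigned v).isSome) :
    ∑ mv, moveProb c α start st mv = 1 := by
  have h0 : ∑ mv, moveProb c α start st mv = ∑ mv, moveProb c α start st mv * (fun _ => 1) mv := by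
    simp
  rw [h0]
  obtain ⟨a, path, pending⟩ := st
  obtain ⟨b, hg, ⟨hpe, _⟩ | ⟨hpe, h1⟩⟩ := h
  · simp only at hpe
    subst hpe
    rw [sum_moves_pend]; ring
  · simp only at hpe h1
    subst hpe
    obtain ⟨v, rest, heff, _⟩ := eff_path (start := start) hstart hf h1
    rw [sum_moves_np heff]
    simpa using hp v

lemma nextVal_full {d : AlgState V → ℝ} {st : AlgState V} (hf : ∀ v, (st.assigned v).isSome)
    (mv : V ⊕ Bool) : nextVal G start d st mv = 0 := by
  unfold nextVal; rw [algStep_full hf]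

lemma nextVal_nonneg {d : AlgState V → ℝ}
    (hstart : ∀ a : V → Option V, (∃ v, a v = none) → a (start a) = none)
    {st : AlgState V} (h : Inv G st) (hd : ∀ s, Inv G s → 0 ≤ d s)
    (mv : V ⊕ Bool) : 0 ≤ nextVal G start d st mv := by
  unfold nextVal
  cases hs : algStep G start st mv with
  | none => simp
  | some s => exact hd s (inv_step hstart h hs)

lemma nextVal_le {d : AlgState V → ℝ}
    (hstart : ∀ a : V → Option V, (∃ v, a v = none) → a (start a) = none)
    {st : AlgState V} (h : Inv G st) (hd : ∀ s, Inv G s → d s ≤ 1)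
    (mv : V ⊕ Bool) : nextVal G start d st mv ≤ 1 := by
  unfold nextVal
  cases hs : algStep G start st mv with
  | none => simp
  | some s => exact hd s (inv_step hstart h hs)

lemma phi_nonneg (hc : ∀ v w, 0 ≤ c v w)
    (hα01 : ∀ l, IsCycleListOf G l → 0 ≤ α l ∧ α l ≤ 1)
    (hstart : ∀ a : V → Option V, (∃ v, a v = none) → a (start a) = none)
    (r : List (V ⊕ Bool)) : ∀ {st : AlgState V}, Inv G st → 0 ≤ phi G c α start f st r := by
  induction r with
  | nil => intro st _; rw [phi_nil]; split_ifs <;> norm_num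
  | cons mv r ih =>
    intro st h
    rw [phi_cons]
    exact mul_nonneg (moveProb_nonneg hc hα01 h mv)
      (nextVal_nonneg hstart h (fun s hs => ih hs) mv)

lemma phi_bound (hp : ∀ x, ∑ w, pc c x w = 1) (hc : ∀ v w, 0 ≤ c v w)
    (hα01 : ∀ l, IsCycleListOf G l → 0 ≤ α l ∧ α l ≤ 1)
    (hstart : ∀ a : V → Option V, (∃ v, a v = none) → a (start a) = none)
    (n : ℕ) : ∀ {st : AlgState V}, Inv G st →
      ∑ r ∈ runsLe V n, phi G c α start f st r ≤ 1 := by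
  have h1 : ∀ st : AlgState V, phi G c α start f st [] ≤ 1 := by
    intro st; rw [phi_nil]; split_ifs <;> norm_num
  induction n with
  | zero => intro st _; simpa [runsLe] using h1 st
  | succ n ih =>
    intro st h
    rw [phi_sum_succ]
    by_cases hf : ∀ v, (st.assigned v).isSome
    · simp only [nextVal_full hf, mul_zero, Finset.sum_const_zero, add_zero]
      exact h1 st
    · have h0 : phi G c α start f st [] = 0 := by
        rw [phi_nil, if_neg]
        intro hh
        exact hf fun v => by rw [hh v]; rfl
      rw [h0, zero_add, ← moveProb_sum (α := α) hp hstart h hf]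
      refine Finset.sum_le_sum fun mv _ => ?_
      exact mul_le_of_le_one_right (moveProb_nonneg hc hα01 h mv)
        (nextVal_le hstart h (fun s hs => ih hs) mv)

lemma phi_summable (hp : ∀ x, ∑ w, pc c x w = 1) (hc : ∀ v w, 0 ≤ c v w)
    (hα01 : ∀ l, IsCycleListOf G l → 0 ≤ α l ∧ α l ≤ 1)
    (hstart : ∀ a : V → Option V, (∃ v, a v = none) → a (start a) = none)
    {st : AlgState V} (h : Inv G st) : Summable (phi G c α start f st) := by
  refine summable_of_sum_le (c := 1) (fun r => phi_nonneg hc hα01 hstart r h) fun u => ?_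
  refine le_trans ?_ (phi_bound (f := f) hp hc hα01 hstart (u.sup List.length) h)
  refine Finset.sum_le_sum_of_subset_of_nonneg ?_ fun r _ _ => phi_nonneg hc hα01 hstart r h
  intro r hr
  rw [mem_runsLe]
  exact Finset.le_sup (f := List.length) hr

lemma runsLe_tendsto : Filter.Tendsto (runsLe V) Filter.atTop Filter.atTop := by
  apply Filter.tendsto_atTop_finset_of_monotone
  · intro m n hmn r hr
    rw [mem_runsLe] at hr ⊢
    omega
  · intro r
    exact ⟨r.length, (mem_runsLe _ _).2 le_rfl⟩

lemma tsum_step (hp : ∀ x, ∑ w, pc c x w = 1) (hc : ∀ v w, 0 ≤ c v w)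
    (hα01 : ∀ l, IsCycleListOf G l → 0 ≤ α l ∧ α l ≤ 1)
    (hstart : ∀ a : V → Option V, (∃ v, a v = none) → a (start a) = none)
    (st : AlgState V) (h : Inv G st) (hf : ¬ ∀ v, (st.assigned v).isSome) :
    ∑' r, phi G c α start f st r = ∑ mv, moveProb c α start st mv *
      nextVal G start (fun s => ∑' r, phi G c α start f s r) st mv := by
  have ht : ∀ s, Inv G s → Filter.Tendsto (fun n => ∑ r ∈ runsLe V n, phi G c α start f s r)
      Filter.atTop (nhds (∑' r, phi G c α start f s r)) := fun s hs =>
    (phi_summable (f := f) hp hc hα01 hstart hs).hasSum.comp runsLe_tendsto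
  have h1 := (ht st h).comp (Filter.tendsto_add_atTop_nat 1)
  refine tendsto_nhds_unique h1 ?_
  have h0 : phi G c α start f st [] = 0 := by
    rw [phi_nil, if_neg]
    intro hh
    exact hf fun v => by rw [hh v]; rfl
  have h2 : ((fun n => ∑ r ∈ runsLe V n, phi G c α start f st r) ∘ fun n => n + 1) =
      fun n => ∑ mv, moveProb c α start st mv *
        nextVal G start (fun s => ∑ r ∈ runsLe V n, phi G c α start f s r) st mv := by
    funext n
    simp only [Function.comp]
    rw [phi_sum_succ, h0, zero_add]
  rw [h2]
  refine tendsto_finsetSum _ fun mv _ => Filter.Tendsto.const_mul _ ?_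
  unfold nextVal
  cases hs : algStep G start st mv with
  | none => exact tendsto_const_nhds
  | some s => exact ht s (inv_step hstart h hs)

lemma tsum_full (st : AlgState V) (hf : ∀ v, (st.assigned v).isSome) :
    ∑' r, phi G c α start f st r = if ∀ v, st.assigned v = some (f v) then 1 else 0 := by
  rw [tsum_eq_single [], phi_nil]
  intro r hr
  cases r with
  | nil => exact absurd rfl hr
  | cons mv r => rw [phi_cons, nextVal_full hf, mul_zero]

end Sums

/-! positivity -/

lemma card_two {g : V → V} {x : V} (h : g (g x) = x) : (fwdOrbit g x).card ≤ 2 := by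
  have h2 : g^[2] x = x := h
  rw [fwdOrbit_eq_toFinset (by norm_num) h2]
  have := List.toFinset_card_le (cycleListAt g x 2)
  simpa only [cycleListAt, List.length_map, List.length_range] using this

lemma exists_pos {G : SimpleGraph V} (hG : G.Connected) {l : List V} (hl : IsCycleListOf G l) :
    ∃ f x, IsOCRSF G f ∧ IsCyc G f x l.length ∧ cycleListAt f x l.length = l ∧
      ∀ s ∈ cyclesOfFun f, s = fwdOrbit f x := by
  obtain ⟨h3, hnd, hch⟩ := hl
  have hk : 0 < l.length := by omega
  have hcl : ∀ x0 x : V, x ≠ x0 → ∃ y, G.Adj x y ∧ G.dist y x0 < G.dist x x0 := by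
    intro x0 x hx
    obtain ⟨p, hp⟩ := hG.exists_walk_length_eq_dist x x0
    cases p with
    | nil => exact absurd rfl hx
    | cons hadj q =>
      refine ⟨_, hadj, ?_⟩
      rw [← hp, SimpleGraph.Walk.length_cons]
      exact Nat.lt_succ_of_le (SimpleGraph.dist_le q)
  let x0 : V := l[0]
  choose! nx hnx using hcl x0
  let f : V → V := fun x => if x ∈ l then l[(l.idxOf x + 1) % l.length]'(Nat.mod_lt _ hk) else nx x
  have hfl : ∀ i (hi : i < l.length), f l[i] = l[(i+1) % l.length]'(Nat.mod_lt _ hk) := by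
    intro i hi
    simp only [f]
    rw [if_pos (List.getElem_mem hi)]
    simp only [hnd.idxOf_getElem i hi]
  have hit : ∀ j : ℕ, f^[j] x0 = l[j % l.length]'(Nat.mod_lt _ hk) := by
    intro j
    induction j with
    | zero => simp [x0]
    | succ j ih =>
      rw [Function.iterate_succ_apply', ih, hfl]
      simp
  have hnl : ∀ x, x ∉ l → G.Adj x (f x) ∧ G.dist (f x) x0 < G.dist x x0 := by
    intro x hx
    simp only [f, if_neg hx]
    apply hnx
    rintro rfl
    exact hx (List.getElem_mem hk)
  have hladj : ∀ i (hi : i < l.length), G.Adj l[i] (l[(i+1) % l.length]'(Nat.mod_lt _ hk)) := by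
    intro i hi
    have hch' : List.IsChain G.Adj (l ++ l.take 1) := hch
    rw [List.isChain_iff_getElem] at hch'
    have hlen : (l ++ l.take 1).length = l.length + 1 := by simp; omega
    have h := hch' i (by omega)
    rw [List.getElem_append_left hi] at h
    by_cases hi' : i + 1 < l.length
    · rw [List.getElem_append_left hi'] at h
      simpa only [Nat.mod_eq_of_lt hi'] using h
    · have he : i + 1 = l.length := by omega
      rw [List.getElem_append_right (by omega)] at h
      simpa [he] using h
  have hadj : ∀ x, G.Adj x (f x) := by
    intro x
    by_cases hx : x ∈ l
    · obtain ⟨i, hi, rfl⟩ := List.getElem_of_mem hx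
      rw [hfl]; exact hladj i hi
    · exact (hnl x hx).1
  have hlist : cycleListAt f x0 l.length = l := by
    apply List.ext_getElem
    · simp [cycleListAt]
    · intro i h1 h2
      have e : (cycleListAt f x0 l.length)[i] = f^[i] x0 := by simp [cycleListAt]
      rw [e, hit]
      simp only [Nat.mod_eq_of_lt h2]
  have hcyc : IsCyc G f x0 l.length := by
    refine ⟨h3, ?_, by rw [hlist]; exact hnd, fun i => ?_⟩
    · rw [hit]; simp [x0]
    · rw [Function.iterate_succ_apply']; exact hadj _
  have hhit : ∀ n, ∀ x, G.dist x x0 = n → ∃ i : ℕ, f^[i] x ∈ l := by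
    intro n
    induction n using Nat.strong_induction_on with
    | _ n IH =>
      intro x hx
      by_cases hxl : x ∈ l
      · exact ⟨0, hxl⟩
      · obtain ⟨i, hi⟩ := IH _ (by rw [← hx]; exact (hnl x hxl).2) (f x) rfl
        exact ⟨i + 1, hi⟩
  have horb : ∀ x, (∃ k : ℕ, 0 < k ∧ f^[k] x = x) → fwdOrbit f x = fwdOrbit f x0 := by
    intro x hx
    obtain ⟨i, hi⟩ := hhit _ x rfl
    rw [← (fwdOrbit_eq_of_mem hx (mem_fwdOrbit.2 ⟨i, rfl⟩)).1]
    refine (fwdOrbit_eq_of_mem ⟨_, hk, hcyc.per⟩ ?_).1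
    rw [fwdOrbit_eq_toFinset hk hcyc.per, hlist]
    exact List.mem_toFinset.2 hi
  refine ⟨f, x0, ⟨hadj, fun v hv => ?_⟩, hcyc, hlist, fun s hs => ?_⟩
  · have h1 := card_two hv
    rw [horb v ⟨2, by norm_num, hv⟩, hcyc.card] at h1
    omega
  · obtain ⟨x, hx, rfl⟩ := mem_cycles.1 hs
    exact horb x hx

end Helpers

theorem cycle_popping_algorithm
    (G : SimpleGraph V) (hG : G.Connected)
    (c : V → V → ℝ) (α : List V → ℝ) (start : (V → Option V) → V)
    (hc_symm : ∀ v w, c v w = c w v)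
    (hc_pos : ∀ v w, G.Adj v w → 0 < c v w)
    (hc_zero : ∀ v w, ¬G.Adj v w → c v w = 0)
    -- `α` takes values in [0,1] on the oriented simple cycles of `G` …
    (hα01 : ∀ l, IsCycleListOf G l → 0 ≤ α l ∧ α l ≤ 1)
    -- … is a function of the oriented cycle only (rotation invariance) …
    (hαrot : ∀ l, IsCycleListOf G l → α (l.rotate 1) = α l)
    -- … and is positive on at least one cycle
    (hαpos : ∃ l, IsCycleListOf G l ∧ 0 < α l)
    -- `start` always selects a vertex not yet in Γ
    (hstart : ∀ a : V → Option V, (∃ v, a v = none) → a (start a) = none) :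
    -- (1) the algorithm terminates almost surely
    HasSum
      (fun r : List (V ⊕ Bool) =>
        if CompleteRun G start r then runProb G c α start initState r else 0) 1 ∧
    -- (2) the output of a complete run is an oriented CRSF of `G`
    (∀ (r : List (V ⊕ Bool)) (f : V → V), RunOutputs G start r f → IsOCRSF G f) ∧
    -- (3) the output is distributed according to `μ_{c,α}`
    (∀ f : V → V, IsOCRSF G f →
      HasSum
        (fun r : List (V ⊕ Bool) =>
          if RunOutputs G start r f then runProb G c α start initState r else 0)
        (ocrsfWeight c α f / ∑ g ∈ Finset.univ.filter (IsOCRSF G), ocrsfWeight c α g)) := by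
  obtain ⟨l, hl, hlpos⟩ := hαpos
  obtain ⟨f₀, x₀, hf₀, hcyc₀, hlist₀, hall₀⟩ := exists_pos hG hl
  have hc : ∀ v w, 0 ≤ c v w := by
    intro v w
    by_cases h : G.Adj v w
    · exact (hc_pos v w h).le
    · rw [hc_zero v w h]
  have hcs : ∀ v, 0 < ∑ u, c v u := fun v =>
    Finset.sum_pos' (fun u _ => hc v u) ⟨f₀ v, Finset.mem_univ _, hc_pos _ _ (hf₀.1 v)⟩
  have hp : ∀ x, ∑ w, pc c x w = 1 := by
    intro x
    unfold pc
    rw [← Finset.sum_div, div_self (hcs x).ne']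
  have hC : 0 < ∏ v, ∑ u, c v u := Finset.prod_pos fun v _ => hcs v
  have hPg : ∀ g : V → V, Pg (pc c) g = (∏ v, c v (g v)) / ∏ v, ∑ u, c v u := by
    intro g
    unfold Pg pc
    rw [Finset.prod_div_distrib]
  have hW : ∀ g : V → V, IsOCRSF G g →
      Pg (pc c) g * AB α Finset.univ g = ocrsfWeight c α g / ∏ v, ∑ u, c v u := by
    intro g hg
    rw [hPg, AB_ocrsf α hg, ocrsfWeight]
    ring
  have hZ : ZB (pc c) α Finset.univ =
      (∑ g ∈ Finset.univ.filter (IsOCRSF G), ocrsfWeight c α g) / ∏ v, ∑ u, c v u := by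
    unfold ZB
    rw [Finset.sum_div, ← Finset.sum_filter_add_sum_filter_not Finset.univ (IsOCRSF G)]
    rw [Finset.sum_eq_zero (s := Finset.univ.filter fun g => ¬ IsOCRSF G g), add_zero]
    · refine Finset.sum_congr rfl fun g hg => hW g ?_
      simpa using hg
    · intro g hg
      have hg' : ¬ IsOCRSF G g := by simpa using hg
      by_cases hadj : ∀ v, G.Adj v (g v)
      · have : ∃ v, g (g v) = v := by
          by_contra hno
          push Not at hno
          exact hg' ⟨hadj, hno⟩
        obtain ⟨v, hv⟩ := this
        rw [AB_not_ocrsf α hv, mul_zero]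
      · push Not at hadj
        obtain ⟨v, hv⟩ := hadj
        rw [hPg, Finset.prod_eq_zero (f := fun v => c v (g v)) (Finset.mem_univ v) (hc_zero _ _ hv)]
        simp
  have hWnn : ∀ g : V → V, IsOCRSF G g → 0 ≤ ocrsfWeight c α g := by
    intro g hg
    refine mul_nonneg (Finset.prod_nonneg fun v _ => hc _ _) (Finset.prod_nonneg fun s hs => ?_)
    obtain ⟨x, k, h, rfl⟩ := ocrsf_cyc hg hs
    rw [h.orbitList hαrot]
    exact (hα01 _ h.list).1
  have hW0 : 0 < ocrsfWeight c α f₀ := by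
    refine mul_pos (Finset.prod_pos fun v _ => hc_pos _ _ (hf₀.1 v)) (Finset.prod_pos fun s hs => ?_)
    rw [hall₀ s hs, hcyc₀.orbitList hαrot, hlist₀]
    exact hlpos
  have hWs : 0 < ∑ g ∈ Finset.univ.filter (IsOCRSF G), ocrsfWeight c α g := by
    refine Finset.sum_pos' (fun g hg => hWnn g (by simpa using hg)) ⟨f₀, by simpa using hf₀, hW0⟩
  have part2 : ∀ (r : List (V ⊕ Bool)) (f : V → V), RunOutputs G start r f → IsOCRSF G f := by
    rintro r f ⟨st, h1, h2⟩
    exact inv_output (inv_run hstart r (inv_init G) h1) h2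
  have part3 : ∀ f : V → V, IsOCRSF G f →
      HasSum
        (fun r : List (V ⊕ Bool) =>
          if RunOutputs G start r f then runProb G c α start initState r else 0)
        (ocrsfWeight c α f / ∑ g ∈ Finset.univ.filter (IsOCRSF G), ocrsfWeight c α g) := by
    intro f hf
    have hs := (phi_summable (f := f) hp hc hα01 hstart (inv_init G)).hasSum
    have hcl := init_claim (d := fun st => ∑' r, phi G c α start f st r) (f := f) hp hc_zero hαrot
      hstart tsum_full (tsum_step hp hc hα01 hstart)
    rw [hW f hf, hZ] at hcl
    have heq : ∑' r, phi G c α start f initState r =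
        ocrsfWeight c α f / ∑ g ∈ Finset.univ.filter (IsOCRSF G), ocrsfWeight c α g := by
      rw [eq_div_iff hWs.ne']
      have hC' := hC.ne'
      field_simp at hcl
      linarith
    rw [heq] at hs
    have hfun : (fun r : List (V ⊕ Bool) =>
        if RunOutputs G start r f then runProb G c α start initState r else 0)
        = phi G c α start f initState := by
      funext r
      unfold phi
      by_cases hr : RunOutputs G start r f
      · rw [if_pos hr, if_pos (by exact hr)]
      · rw [if_neg hr, if_neg (by exact hr)]
    rw [hfun]
    exact hs
  refine ⟨?_, part2, part3⟩
  have hsum := hasSum_sum (s := Finset.univ.filter (IsOCRSF G))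
    (fun f hf => part3 f (by simpa using hf))
  rw [← Finset.sum_div, div_self hWs.ne'] at hsum
  convert hsum using 1
  funext r
  by_cases hr : CompleteRun G start r
  · rw [if_pos hr]
    obtain ⟨st, h1, h2⟩ := hr
    choose f hf using fun v => Option.isSome_iff_exists.1 (h2 v)
    have hout : RunOutputs G start r f := ⟨st, h1, hf⟩
    rw [Finset.sum_eq_single f]
    · rw [if_pos hout]
    · intro g _ hgf
      rw [if_neg]
      rintro ⟨st', h1', h2'⟩
      rw [h1] at h1'
      obtain rfl := Option.some.inj h1'
      apply hgf
      funext v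
      have := h2' v
      rw [hf v] at this
      exact (Option.some.inj this).symm
    · intro h
      exact absurd (by simpa using part2 r f hout) h
  · rw [if_neg hr, Finset.sum_eq_zero]
    intro g _
    rw [if_neg]
    rintro ⟨st, h1, h2⟩
    exact hr ⟨st, h1, fun v => by rw [h2 v]; rfl⟩

end CyclePopping
end
end

section
/- Let G = (V,E) be a finite graph with conductances c : E → ℝ_{>0} and let Φ be a unitary connection on a complex line bundle over G, with line-bundle Laplacian Δ_Φ. Then det(Δ_Φ) = Σ_Γ Π_{e∈Γ} c(e) · Π_{cycles γ of Γ} (2 − ω_γ − ω_γ^{-1}), where the sum is over all cycle-rooted spanning forests Γ of G, the product is over the cycles of Γ, and ω_γ is the monodromy of Φ around the cycle γ (the quantity 2 − ω_γ − ω_γ^{-1} = 2 − 2cos θ_γ, where ω_γ = e^{iθ_γ}, is independent of the choice of orientation and starting vertex of γ). -/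
/-!
STATEMENT 1.  `det(Δ_Φ) = Σ_Γ Π_{e∈Γ} c(e) · Π_{cycles γ of Γ} (2 − ω_γ − ω_γ^{-1})`,
the sum being over all cycle-rooted spanning forests Γ of a finite graph `G` with
conductances `c` and unitary connection `φ`.
-/

open Classical

noncomputable section

namespace CRSFStmt

variable {V : Type*} [Fintype V] [DecidableEq V]

/-- `δ` is the edge set of a simple cycle on the vertex set `V`. -/
def IsCycleEdgeSet (δ : Finset (Sym2 V)) : Prop :=
  ∃ (v : V) (w : (⊤ : SimpleGraph V).Walk v v), w.IsCycle ∧ w.edges.toFinset = δ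

/-- The collection of (edge sets of the) cycles contained in the edge set `Γ`.
For a cycle-rooted spanning forest these are exactly the cycles of its components. -/
def cyclesOf (Γ : Finset (Sym2 V)) : Finset (Finset (Sym2 V)) :=
  Γ.powerset.filter IsCycleEdgeSet

/-- `Γ` is (the edge set of) a cycle-rooted spanning forest of `G`: a spanning subgraph
each of whose connected components has as many edges as vertices. -/
def IsCRSF (G : SimpleGraph V) (Γ : Finset (Sym2 V)) : Prop :=
  ↑Γ ⊆ G.edgeSet ∧
    ∀ C : (SimpleGraph.fromEdgeSet (↑Γ : Set (Sym2 V))).ConnectedComponent,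
      (Γ.filter fun e => ∀ v ∈ e, v ∈ C.supp).card = C.supp.toFinite.toFinset.card

/-- The product of the values of the connection `φ` along the darts of a walk:
the monodromy of `φ` along the walk. -/
def walkHol (φ : V → V → ℂ) {v : V} (w : (⊤ : SimpleGraph V).Walk v v) : ℂ :=
  (w.darts.map fun d => φ d.toProd.1 d.toProd.2).prod

/-- The weight `2 − ω − ω⁻¹` which the connection `φ` attaches to a cycle with edge
set `δ`, where `ω` is the monodromy of `φ` along a traversal of the cycle (for a
unitary connection this quantity does not depend on the choice of traversal). -/
def cycleWeight (φ : V → V → ℂ) (δ : Finset (Sym2 V)) : ℂ :=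
  if h : IsCycleEdgeSet δ then
    2 - walkHol φ h.choose_spec.choose - (walkHol φ h.choose_spec.choose)⁻¹
  else 0

/-- The line-bundle Laplacian of conductances `c` and connection `φ`
(`c` is assumed to vanish off the edges of the graph). -/
def lineLaplacian (c : V → V → ℝ) (φ : V → V → ℂ) : Matrix V V ℂ :=
  Matrix.of fun v w => if v = w then (∑ u, (c v u : ℂ)) else -(c v w : ℂ) * φ w v

/-- The conductance as a function of unoriented edges. -/
def edgeC (c : V → V → ℝ) (hc : ∀ v w, c v w = c w v) : Sym2 V → ℝ :=
  Sym2.lift ⟨c, hc⟩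

/-- The matrix with rows `e_v - φ (f v) v e_{f v}`. -/
def rowMat (φ : V → V → ℂ) (f : V → V) : Matrix V V ℂ :=
  Matrix.of fun v w => (if v = w then 1 else 0) - (if f v = w then φ (f v) v else 0)

lemma det_expand (c : V → V → ℝ) (φ : V → V → ℂ) (h0 : ∀ v, c v v = 0) :
    (lineLaplacian c φ).det = ∑ f : V → V, (∏ v, (c v (f v) : ℂ)) * (rowMat φ f).det := by
  have h1 : lineLaplacian c φ = fun v => ∑ u, ((c v u : ℂ) • (fun w =>
      (if v = w then (1:ℂ) else 0) - (if u = w then φ u v else 0))) := by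
    funext v w
    simp only [lineLaplacian, Matrix.of_apply, Finset.sum_apply, Pi.smul_apply, smul_eq_mul,
      mul_sub, Finset.sum_sub_distrib, mul_ite, mul_zero, mul_one]
    by_cases h : v = w
    · subst h
      simp [h0]
    · simp [h]
  rw [h1]
  change Matrix.detRowAlternating.toMultilinearMap _ = _
  rw [MultilinearMap.map_sum]
  refine Finset.sum_congr rfl fun f _ => ?_
  rw [MultilinearMap.map_smul_univ]
  rfl

/-- Cyclic permutations which follow `f`. -/
def cycPerms (f : V → V) : Finset (Equiv.Perm V) :=
  Finset.univ.filter fun τ => τ.IsCycle ∧ ∀ v ∈ τ.support, τ v = f v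

lemma sign_prod (g : V → ℂ) (σ : Equiv.Perm V) :
    ((Equiv.Perm.sign σ : ℤ) : ℂ) * ∏ i ∈ σ.support, (-g i) =
      ∏ τ ∈ σ.cycleFactorsFinset, (-∏ i ∈ τ.support, g i) := by
  induction σ using Equiv.Perm.cycle_induction_on with
  | base_one => simp
  | base_cycles σ h =>
    rw [Equiv.Perm.cycleFactorsFinset_eq_singleton_iff.2 ⟨h, rfl⟩, Finset.prod_singleton, h.sign,
      Finset.prod_neg]
    push_cast
    rw [← mul_assoc, neg_mul, ← mul_pow]
    simp
  | induction_disjoint σ τ h hc h1 h2 =>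
    rw [h.cycleFactorsFinset_mul_eq_union, Finset.prod_union h.disjoint_cycleFactorsFinset, ← h1,
      ← h2, h.support_mul, Finset.prod_union (by simpa [Equiv.Perm.disjoint_iff_disjoint_support] using h)]
    simp
    ring

lemma cycPerms_disjoint (f : V → V) {τ τ' : Equiv.Perm V} (h : τ ∈ cycPerms f)
    (h' : τ' ∈ cycPerms f) (hne : τ ≠ τ') : τ.Disjoint τ' := by
  simp only [cycPerms, Finset.mem_filter, Finset.mem_univ, true_and] at h h'
  rw [Equiv.Perm.disjoint_iff_disjoint_support]
  by_contra hd
  rw [Finset.not_disjoint_iff] at hd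
  obtain ⟨a, ha, ha'⟩ := hd
  apply hne
  refine h.1.eq_on_support_inter_nonempty_congr h'.1 (x := a) ?_ ?_ ha
  · intro x hx
    rw [Finset.mem_inter] at hx
    rw [h.2 x hx.1, h'.2 x hx.2]
  · rw [h.2 a ha, h'.2 a ha']

lemma det_rowMat (φ : V → V → ℂ) (f : V → V) (hf : ∀ v, f v ≠ v) :
    (rowMat φ f).det = ∏ τ ∈ cycPerms f, (1 - ∏ v ∈ τ.support, φ (f v) v) := by
  have e1 : ∏ τ ∈ cycPerms f, (1 - ∏ v ∈ τ.support, φ (f v) v) =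
      ∑ S ∈ (cycPerms f).powerset, ∏ τ ∈ S, (-∏ v ∈ τ.support, φ (f v) v) := by
    rw [← Finset.prod_one_add]
    simp [sub_eq_add_neg]
  rw [e1, ← Matrix.det_transpose, Matrix.det_apply']
  have e2 : ∑ σ : Equiv.Perm V, ((Equiv.Perm.sign σ : ℤ) : ℂ) * ∏ i, (rowMat φ f).transpose (σ i) i
      = ∑ σ ∈ Finset.univ.filter (fun σ : Equiv.Perm V => ∀ v ∈ σ.support, σ v = f v),
        ((Equiv.Perm.sign σ : ℤ) : ℂ) * ∏ i ∈ σ.support, (-φ (f i) i) := by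
    rw [Finset.sum_filter]
    refine Finset.sum_congr rfl fun σ _ => ?_
    split_ifs with h
    · congr 1
      symm
      rw [← Finset.prod_subset (Finset.subset_univ σ.support)]
      · refine Finset.prod_congr rfl fun i hi => ?_
        have := h i hi
        simp [rowMat, this, (hf i).symm]
      · intro i _ hi
        rw [Equiv.Perm.notMem_support] at hi
        simp [rowMat, hi, hf i]
    · push Not at h
      obtain ⟨v, hv, hv'⟩ := h
      rw [Finset.prod_eq_zero (Finset.mem_univ v), mul_zero]
      rw [Equiv.Perm.mem_support] at hv
      simp [rowMat, hv.symm, hv'.symm]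
  rw [e2]
  refine Finset.sum_bij (fun σ _ => σ.cycleFactorsFinset) ?_ ?_ ?_ ?_
  · intro σ hσ
    rw [Finset.mem_filter] at hσ
    rw [Finset.mem_powerset]
    intro τ hτ
    have h1 := Equiv.Perm.mem_cycleFactorsFinset_iff.1 hτ
    simp only [cycPerms, Finset.mem_filter, Finset.mem_univ, true_and]
    refine ⟨h1.1, fun v hv => ?_⟩
    rw [h1.2 v hv]
    exact hσ.2 v (Equiv.Perm.mem_cycleFactorsFinset_support_le hτ hv)
  · intro σ _ σ' _ h
    exact Equiv.Perm.cycleFactorsFinset_injective h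
  · intro S hS
    rw [Finset.mem_powerset] at hS
    have hp : (S : Set (Equiv.Perm V)).Pairwise Equiv.Perm.Disjoint :=
      fun τ h τ' h' hne => cycPerms_disjoint f (hS h) (hS h') hne
    have hcy : ∀ τ ∈ S, τ.IsCycle := fun τ h => (Finset.mem_filter.1 (hS h)).2.1
    have key := (Equiv.Perm.cycleFactorsFinset_eq_finset (s := S)
      (σ := S.noncommProd id (hp.mono' fun _ _ => Equiv.Perm.Disjoint.commute))).2 ⟨hcy, hp, rfl⟩
    refine ⟨_, ?_, key⟩
    rw [Finset.mem_filter]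
    refine ⟨Finset.mem_univ _, fun v hv => ?_⟩
    have h1 := Equiv.Perm.cycleOf_mem_cycleFactorsFinset_iff.2 hv
    rw [key] at h1
    have h2 := (Finset.mem_filter.1 (hS h1)).2.2 v
      (by rw [Equiv.Perm.mem_support, Equiv.Perm.cycleOf_apply_self]; exact Equiv.Perm.mem_support.1 hv)
    rwa [Equiv.Perm.cycleOf_apply_self] at h2
  · intro σ _
    exact sign_prod (fun v => φ (f v) v) σ

lemma det_rowMat_zero (φ : V → V → ℂ) (f : V → V) {a b : V} (hab : a ≠ b) (h1 : f a = b)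
    (h2 : f b = a) (h : φ a b * φ b a = 1) : (rowMat φ f).det = 0 := by
  have : (rowMat φ f).updateRow b ((-φ a b) • (rowMat φ f) a) = rowMat φ f := by
    ext v w
    by_cases hv : v = b
    · subst hv
      simp only [Matrix.updateRow_self, rowMat, Matrix.of_apply, Pi.smul_apply, h1, h2, smul_eq_mul,
        mul_sub, mul_ite, mul_zero, mul_one, neg_mul, h]
      split_ifs <;> simp_all
    · simp [Matrix.updateRow_ne hv]
  rw [← this, Matrix.det_updateRow_smul, Matrix.det_zero_of_row_eq hab, mul_zero]
  rw [Matrix.updateRow_self, Matrix.updateRow_ne hab]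

lemma prod_loc {V : Type*} {f : V → V} {a b : V} (hinj : Function.Injective fun v => s(v, f v))
    (hab : f a = b) (hba : f b = a) : a = b := by
  apply hinj
  simp [hab, hba]

lemma laplacian_eq (φ : V → V → ℂ) (f : V → V) (hf : ∀ v, f v ≠ v)
    (hinj : Function.Injective fun v => s(v, f v))
    (hu : ∀ v, ‖φ v (f v)‖ = 1) (hs : ∀ v, φ (f v) v = starRingEnd ℂ (φ v (f v))) :
    lineLaplacian (fun a b => if s(a, b) ∈ Finset.univ.image (fun v => s(v, f v)) then 1 else 0) φ
      = (rowMat φ f).conjTranspose * rowMat φ f := by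
  have hc : ∀ a b : V, ((if s(a, b) ∈ Finset.univ.image (fun v => s(v, f v)) then (1:ℝ) else 0 : ℝ) : ℂ)
      = (if f a = b then 1 else 0) + (if f b = a then 1 else 0) := by
    intro a b
    have : s(a, b) ∈ Finset.univ.image (fun v => s(v, f v)) ↔ f a = b ∨ f b = a := by
      simp only [Finset.mem_image, Finset.mem_univ, true_and, Sym2.eq_iff]
      constructor
      · rintro ⟨v, ⟨rfl, rfl⟩ | ⟨rfl, rfl⟩⟩ <;> simp
      · rintro (h | h)
        · exact ⟨a, by simp [h]⟩
        · exact ⟨b, by simp [h]⟩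
    simp only [this]
    by_cases h1 : f a = b <;> by_cases h2 : f b = a
    · exfalso
      have := prod_loc hinj h1 h2
      subst this
      exact hf _ h1
    all_goals simp [h1, h2]
  have hn : ∀ v, starRingEnd ℂ (φ (f v) v) * φ (f v) v = 1 := by
    intro v
    rw [hs, Complex.conj_conj, Complex.mul_conj, Complex.normSq_eq_norm_sq, hu]
    simp
  ext a b
  simp only [lineLaplacian, Matrix.of_apply, hc, Matrix.mul_apply, Matrix.conjTranspose_apply, rowMat]
  simp only [star_sub, RCLike.star_def, sub_mul, mul_sub, Finset.sum_sub_distrib, apply_ite (starRingEnd ℂ), map_one, map_zero, ite_mul, mul_ite, one_mul, mul_one, zero_mul, mul_zero, Finset.sum_add_distrib]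
  by_cases hab : a = b
  · subst hab
    simp only [Finset.sum_ite_eq', Finset.mem_univ, if_true, Finset.sum_ite_eq, if_neg (hf a), hn,
      sub_zero]
    have e : ∀ x, (if f x = a then ((if x = a then φ (f x) x else 0) - if f x = a then (1:ℂ) else 0)
        else 0) = -(if f x = a then 1 else 0) := by
      intro x
      split_ifs with h1 h2
      · subst h2; exact absurd h1 (hf _)
      · simp
      · simp
    simp [e, hf, hn]
  · simp [hab, hn]
    have e : ∀ x, (if f x = b then ((if x = a then φ (f x) x else 0) - if f x = a then (1:ℂ) else 0)
        else 0) = (if x = a then (if f x = b then φ (f x) x else 0) else 0) := by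
      intro x
      split_ifs with h1 h2 h3 h4 <;> simp_all
    simp only [e, Finset.sum_ite_eq', Finset.mem_univ, if_true, if_neg (Ne.symm hab)]
    by_cases h1 : f a = b <;> by_cases h2 : f b = a
    · exact absurd (prod_loc hinj h1 h2) hab
    · simp [h2, h1]
    · have := hs b
      rw [h2] at this
      simp [h1, h2, this]
    · simp [h1, h2]

lemma iter_walk {V : Type*} (f : V → V) (hf : ∀ v, f v ≠ v) (n : ℕ) (x y : V) (hy : f^[n] x = y) :
    ∃ w : (⊤ : SimpleGraph V).Walk x y, w.support = List.iterate f x (n + 1) ∧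
      ∀ d ∈ w.darts, f d.fst = d.snd := by
  induction n generalizing x with
  | zero =>
    simp only [Function.iterate_zero, id] at hy
    subst hy
    exact ⟨.nil, by simp, by simp⟩
  | succ n ih =>
    obtain ⟨w, h1, h2⟩ := ih (f x) hy
    refine ⟨.cons (by simpa using (hf x).symm) w, ?_, ?_⟩
    · rw [SimpleGraph.Walk.support_cons, h1]
      rfl
    · intro d hd
      rw [SimpleGraph.Walk.darts_cons, List.mem_cons] at hd
      rcases hd with rfl | hd
      · rfl
      · exact h2 d hd

lemma dropLast_iterate {V : Type*} (f : V → V) (n : ℕ) (x : V) :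
    (List.iterate f x (n + 1)).dropLast = List.iterate f x n := by
  induction n generalizing x with
  | zero => simp
  | succ n ih =>
    rw [List.iterate, List.iterate, List.dropLast_cons_cons]
    rw [List.iterate, ← ih (f x)]
    rfl

lemma iter_cyc (f : V → V) (τ : Equiv.Perm V) (h : ∀ v ∈ τ.support, τ v = f v) (n : ℕ) (x : V)
    (hx : x ∈ τ.support) : List.iterate f x n = List.iterate τ x n ∧ f^[n] x = (τ ^ n) x := by
  induction n generalizing x with
  | zero => simp
  | succ n ih =>
    have := ih (f x) (by rw [← h x hx]; simpa using hx)
    refine ⟨?_, ?_⟩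
    · rw [List.iterate, List.iterate, h x hx, this.1]
    · rw [Function.iterate_succ_apply, this.2, pow_succ, Equiv.Perm.mul_apply, h x hx]

lemma edges_eq {V : Type*} (f : V → V) {x y : V} (w : (⊤ : SimpleGraph V).Walk x y)
    (h : ∀ d ∈ w.darts, f d.fst = d.snd) :
    w.edges = w.support.dropLast.map (fun v => s(v, f v)) := by
  rw [← SimpleGraph.Walk.map_fst_darts, List.map_map, SimpleGraph.Walk.edges]
  refine List.map_congr_left fun d hd => ?_
  simp only [Function.comp, h d hd]
  rfl

lemma hol_eq (φ : V → V → ℂ) (f : V → V) {x : V} (w : (⊤ : SimpleGraph V).Walk x x)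
    (hw : w.IsCycle) (h : ∀ d ∈ w.darts, f d.fst = d.snd) :
    walkHol φ w = ∏ v ∈ w.support.dropLast.toFinset, φ v (f v) := by
  rw [List.prod_toFinset _ hw.nodup_dropLast_support, ← SimpleGraph.Walk.map_fst_darts,
    List.map_map, walkHol]
  congr 1
  refine List.map_congr_left fun d hd => ?_
  simp only [Function.comp, h d hd]

lemma isCycleEdgeSet_of_cycPerm (f : V → V) (hf : ∀ v, f v ≠ v)
    (hinj : Function.Injective fun v => s(v, f v)) (τ : Equiv.Perm V) (hτ : τ ∈ cycPerms f) :
    IsCycleEdgeSet (τ.support.image fun v => s(v, f v)) := by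
  simp only [cycPerms, Finset.mem_filter, Finset.mem_univ, true_and] at hτ
  obtain ⟨hc, hτ⟩ := hτ
  obtain ⟨x, hx⟩ := hc.nonempty_support
  have hx' : τ x ≠ x := Equiv.Perm.mem_support.1 hx
  obtain ⟨h1, h2⟩ := iter_cyc f τ hτ τ.support.card x hx
  rw [← hc.orderOf, pow_orderOf_eq_one, hc.orderOf] at h2
  obtain ⟨w, hw1, hw2⟩ := iter_walk f hf _ x x h2
  have hl : w.support.dropLast = τ.toList x := by
    rw [hw1, dropLast_iterate, h1, Equiv.Perm.toList, hc.cycleOf_eq hx']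
  have hset : (τ.toList x).toFinset = τ.support := by
    ext y
    rw [List.mem_toFinset, Equiv.Perm.mem_toList_iff]
    constructor
    · rintro ⟨h, _⟩
      exact (h.mem_support_iff).1 hx
    · intro hy
      exact ⟨hc.sameCycle hx' (Equiv.Perm.mem_support.1 hy), hx⟩
  have he := edges_eq f w hw2
  rw [hl] at he
  refine ⟨x, w, ?_, ?_⟩
  · rw [SimpleGraph.Walk.isCycle_def, SimpleGraph.Walk.isTrail_def, he]
    refine ⟨(Equiv.Perm.nodup_toList _ _).map hinj, ?_, ?_⟩
    · rintro rfl
      simp only [SimpleGraph.Walk.support_nil, List.dropLast_singleton] at hl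
      rw [← hl] at hset
      rw [← hset] at hx
      simp at hx
    · rw [w.tail_support_perm_dropLast_support.nodup_iff, hl]
      exact Equiv.Perm.nodup_toList _ _
  · rw [he, ← hset]
    ext e
    simp

lemma cycPerm_of_walk (f : V → V) {x : V} (w : (⊤ : SimpleGraph V).Walk x x)
    (hw : w.IsCycle) (h : ∀ d ∈ w.darts, f d.fst = d.snd) :
    ∃ τ ∈ cycPerms f, τ.support = w.support.dropLast.toFinset := by
  have h3 := hw.three_le_length
  have hlen : w.support.dropLast.length = w.length := by simp
  have hsup : w.support.dropLast.formPerm.support = w.support.dropLast.toFinset := by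
    apply List.support_formPerm_of_nodup _ hw.nodup_dropLast_support
    intro y hy
    rw [hy] at hlen
    simp at hlen
    omega
  refine ⟨w.support.dropLast.formPerm, ?_, hsup⟩
  simp only [cycPerms, Finset.mem_filter, Finset.mem_univ, true_and]
  refine ⟨List.isCycle_formPerm hw.nodup_dropLast_support (by omega), ?_⟩
  intro v hv
  rw [hsup, List.mem_toFinset, List.mem_iff_getElem] at hv
  obtain ⟨i, hi, rfl⟩ := hv
  rw [List.formPerm_apply_getElem _ hw.nodup_dropLast_support]
  have hi' : i < w.length := by omega
  have hd := h _ (List.getElem_mem (l := w.darts) (n := i) (by simpa using hi'))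
  rw [SimpleGraph.Walk.darts_getElem_eq_getVert] at hd
  simp only [List.getElem_dropLast, SimpleGraph.Walk.support_getElem_eq_getVert] at hd ⊢
  rw [hd, hlen]
  by_cases hi2 : i + 1 < w.length
  · rw [Nat.mod_eq_of_lt hi2]
  · have : i + 1 = w.length := by omega
    rw [this, Nat.mod_self]
    simp

lemma walk_orient {f : V → V} 
    (hinj : Function.Injective fun v => s(v, f v)) {x : V} (w : (⊤ : SimpleGraph V).Walk x x)
    (hw : w.IsCycle) (hΓ : ∀ e ∈ w.edges, ∃ v, s(v, f v) = e) :
    (∀ d ∈ w.darts, f d.fst = d.snd) ∨ (∀ d ∈ w.reverse.darts, f d.fst = d.snd) := by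
  have h3 := hw.three_le_length
  have hor : ∀ i < w.length, f (w.getVert i) = w.getVert (i + 1) ∨ f (w.getVert (i + 1)) = w.getVert i := by
    intro i hi
    obtain ⟨v, hv⟩ := hΓ _ (List.getElem_mem (l := w.edges) (n := i) (by simpa using hi))
    rw [SimpleGraph.Walk.getElem_edges, Sym2.eq_iff] at hv
    rcases hv with ⟨h1, h2⟩ | ⟨h1, h2⟩
    · left; rw [← h1, h2]
    · right; rw [← h1, h2]
  have key : ∀ i, i + 1 < w.length → f (w.getVert (i + 1)) = w.getVert i →
      f (w.getVert (i + 2)) = w.getVert (i + 1) := by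
    intro i hi h
    rcases hor (i + 1) hi with h' | h'
    · have := hw.getVert_sub_one_ne_getVert_add_one (i := i + 1) (by omega)
      simp only [Nat.add_sub_cancel] at this
      exact absurd (h.symm.trans h') this
    · exact h'
  have key0 : f (w.getVert w.length) = w.getVert (w.length - 1) → f (w.getVert 1) = w.getVert 0 := by
    intro h
    rcases hor 0 (by omega) with h' | h'
    · exfalso
      have := hw.snd_ne_penultimate
      apply this
      rw [SimpleGraph.Walk.snd, SimpleGraph.Walk.penultimate, ← h, SimpleGraph.Walk.getVert_length]
      simpa using h'.symm
    · exact h'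
  have prop : ∀ i, i < w.length → f (w.getVert (i + 1)) = w.getVert i → ∀ j, i ≤ j → j < w.length →
      f (w.getVert (j + 1)) = w.getVert j := by
    intro i hi h j hij
    induction j, hij using Nat.le_induction with
    | base => exact fun _ => h
    | succ j hj ih => exact fun h' => key j h' (ih (by omega))
  by_cases hb : ∃ i < w.length, f (w.getVert (i + 1)) = w.getVert i
  · right
    obtain ⟨i, hi, hb⟩ := hb
    have h1 := prop i hi hb (w.length - 1) (by omega) (by omega)
    rw [Nat.sub_add_cancel (by omega)] at h1
    have h2 := prop 0 (by omega) (key0 h1)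
    intro d hd
    rw [SimpleGraph.Walk.darts_reverse, List.mem_reverse, List.mem_map] at hd
    obtain ⟨d', hd', rfl⟩ := hd
    obtain ⟨j, hj, rfl⟩ := List.mem_iff_getElem.1 hd'
    rw [SimpleGraph.Walk.darts_getElem_eq_getVert]
    exact h2 j (Nat.zero_le _) (by simpa using hj)
  · left
    push Not at hb
    have h2 : ∀ i < w.length, f (w.getVert i) = w.getVert (i + 1) := fun i hi =>
      (hor i hi).resolve_right (hb i hi)
    intro d hd
    obtain ⟨j, hj, rfl⟩ := List.mem_iff_getElem.1 hd
    rw [SimpleGraph.Walk.darts_getElem_eq_getVert]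
    exact h2 j (by simpa using hj)

lemma walkHol_reverse (φ : V → V → ℂ) {x : V} (w : (⊤ : SimpleGraph V).Walk x x)
    (h : ∀ d ∈ w.darts, φ d.snd d.fst = starRingEnd ℂ (φ d.fst d.snd)) :
    walkHol φ w.reverse = starRingEnd ℂ (walkHol φ w) := by
  rw [walkHol, walkHol, SimpleGraph.Walk.darts_reverse, List.map_reverse, List.prod_reverse,
    List.map_map, map_list_prod, List.map_map]
  congr 1
  exact List.map_congr_left fun d hd => h d hd

lemma prod_cycles (φ : V → V → ℂ) (f : V → V) (hf : ∀ v, f v ≠ v)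
    (hinj : Function.Injective fun v => s(v, f v))
    (hu : ∀ v, ‖φ v (f v)‖ = 1) (hs : ∀ v, φ (f v) v = starRingEnd ℂ (φ v (f v))) :
    ∏ τ ∈ cycPerms f, (starRingEnd ℂ (1 - ∏ v ∈ τ.support, φ (f v) v) *
        (1 - ∏ v ∈ τ.support, φ (f v) v)) =
      ∏ δ ∈ cyclesOf (Finset.univ.image fun v => s(v, f v)), cycleWeight φ δ := by
  have himg : ∀ τ ∈ cycPerms f, ∀ τ' ∈ cycPerms f, τ.support.image (fun v => s(v, f v)) =
      τ'.support.image (fun v => s(v, f v)) → τ = τ' := by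
    intro τ h τ' h' he
    have hsup := Finset.image_injective hinj he
    simp only [cycPerms, Finset.mem_filter, Finset.mem_univ, true_and] at h h'
    ext v
    by_cases hv : v ∈ τ.support
    · rw [h.2 v hv, h'.2 v (hsup ▸ hv)]
    · have hv' : v ∉ τ'.support := hsup ▸ hv
      rw [Equiv.Perm.notMem_support] at hv hv'
      rw [hv, hv']
  have main : ∀ (x : V) (w : (⊤ : SimpleGraph V).Walk x x), w.IsCycle →
      w.edges.toFinset ⊆ Finset.univ.image (fun v => s(v, f v)) →
      ∃ τ ∈ cycPerms f, τ.support.image (fun v => s(v, f v)) = w.edges.toFinset ∧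
        (walkHol φ w = ∏ v ∈ τ.support, φ v (f v) ∨
          walkHol φ w = starRingEnd ℂ (∏ v ∈ τ.support, φ v (f v))) := by
    intro x w hw hΓ
    have hΓ' : ∀ e ∈ w.edges, ∃ v, s(v, f v) = e := by
      intro e he
      simpa using hΓ (List.mem_toFinset.2 he)
    rcases walk_orient hinj w hw hΓ' with h | h
    · obtain ⟨τ, hτ, hsup⟩ := cycPerm_of_walk f w hw h
      refine ⟨τ, hτ, ?_, Or.inl ?_⟩
      · rw [edges_eq f w h, hsup]
        ext e; simp only [Finset.mem_image, List.mem_toFinset, List.mem_map]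
      · rw [hol_eq φ f w hw h, hsup]
    · obtain ⟨τ, hτ, hsup⟩ := cycPerm_of_walk f w.reverse hw.reverse h
      refine ⟨τ, hτ, ?_, Or.inr ?_⟩
      · have : w.edges.toFinset = w.reverse.edges.toFinset := by simp
        rw [this, edges_eq f _ h, hsup]
        ext e; simp only [Finset.mem_image, List.mem_toFinset, List.mem_map]
      · rw [hsup, ← hol_eq φ f w.reverse hw.reverse h, ← walkHol_reverse,
          SimpleGraph.Walk.reverse_reverse]
        intro d hd
        rw [← h d hd, hs]
  refine Finset.prod_bij (fun τ _ => τ.support.image (fun v => s(v, f v))) ?_ ?_ ?_ ?_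
  · intro τ hτ
    rw [cyclesOf, Finset.mem_filter, Finset.mem_powerset]
    exact ⟨Finset.image_subset_image (Finset.subset_univ _),
      isCycleEdgeSet_of_cycPerm f hf hinj τ hτ⟩
  · intro τ h τ' h' he
    exact himg τ h τ' h' he
  · intro δ hδ
    rw [cyclesOf, Finset.mem_filter, Finset.mem_powerset] at hδ
    obtain ⟨h1, x, w, hw, rfl⟩ := hδ
    obtain ⟨τ, hτ, h2, -⟩ := main x w hw h1
    exact ⟨τ, hτ, h2⟩
  · intro τ hτ
    have hδ := isCycleEdgeSet_of_cycPerm f hf hinj τ hτ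
    rw [cycleWeight, dif_pos hδ]
    obtain ⟨hw, he⟩ := hδ.choose_spec.choose_spec
    obtain ⟨τ', hτ', h2, h3⟩ := main _ hδ.choose_spec.choose hw
      (by rw [he]; exact Finset.image_subset_image (Finset.subset_univ _))
    obtain rfl := himg τ hτ τ' hτ' (by rw [h2, he])
    have hω : ∏ v ∈ τ.support, φ (f v) v = starRingEnd ℂ (∏ v ∈ τ.support, φ v (f v)) := by
      rw [map_prod]
      exact Finset.prod_congr rfl fun v _ => hs v
    have hn : ‖∏ v ∈ τ.support, φ v (f v)‖ = 1 := by
      rw [norm_prod]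
      exact Finset.prod_eq_one fun v _ => hu v
    rw [hω]
    generalize (∏ v ∈ τ.support, φ v (f v)) = z at *
    have hz : z * starRingEnd ℂ z = 1 := by
      rw [Complex.mul_conj, Complex.normSq_eq_norm_sq, hn]; simp
    have hzi : z⁻¹ = starRingEnd ℂ z := inv_eq_of_mul_eq_one_right hz
    have hzi' : (starRingEnd ℂ z)⁻¹ = z := by rw [← hzi, inv_inv]
    rcases h3 with h3 | h3 <;> rw [h3] <;> simp only [hzi, hzi', map_sub, map_one, Complex.conj_conj]
      <;> linear_combination hz

lemma det_crsf (φ : V → V → ℂ) (f : V → V) (hf : ∀ v, f v ≠ v)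
    (hinj : Function.Injective fun v => s(v, f v))
    (hu : ∀ v, ‖φ v (f v)‖ = 1) (hs : ∀ v, φ (f v) v = starRingEnd ℂ (φ v (f v))) :
    (lineLaplacian (fun a b => if s(a, b) ∈ Finset.univ.image (fun v => s(v, f v)) then 1 else 0)
      φ).det = ∏ δ ∈ cyclesOf (Finset.univ.image fun v => s(v, f v)), cycleWeight φ δ := by
  rw [laplacian_eq φ f hf hinj hu hs, Matrix.det_mul, Matrix.det_conjTranspose, det_rowMat φ f hf,
    ← prod_cycles φ f hf hinj hu hs, Finset.prod_mul_distrib, star_prod]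
  rfl

lemma isCRSF_of_fun (G : SimpleGraph V) (f : V → V) (hG : ∀ v, G.Adj v (f v))
    (hinj : Function.Injective fun v => s(v, f v)) :
    IsCRSF G (Finset.univ.image fun v => s(v, f v)) := by
  constructor
  · intro e he
    simp only [Finset.coe_image, Finset.coe_univ, Set.image_univ, Set.mem_range] at he
    obtain ⟨v, rfl⟩ := he
    exact hG v
  · intro C
    symm
    refine Finset.card_bij (fun v _ => s(v, f v)) ?_ ?_ ?_
    · intro v hv
      simp only [Set.Finite.mem_toFinset, SimpleGraph.ConnectedComponent.mem_supp_iff] at hv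
      simp only [Finset.mem_filter, Finset.mem_image, Finset.mem_univ, true_and,
        SimpleGraph.ConnectedComponent.mem_supp_iff, Sym2.mem_iff]
      refine ⟨⟨v, rfl⟩, ?_⟩
      rintro u (rfl | rfl)
      · exact hv
      · rw [← hv, eq_comm, SimpleGraph.ConnectedComponent.eq]
        apply SimpleGraph.Adj.reachable
        rw [SimpleGraph.fromEdgeSet_adj]
        exact ⟨Finset.mem_coe.2 (Finset.mem_image_of_mem _ (Finset.mem_univ v)), (hG v).ne⟩
    · intro a _ b _ h
      exact hinj h
    · intro e he
      simp only [Finset.mem_filter, Finset.mem_image, Finset.mem_univ, true_and] at he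
      obtain ⟨⟨v, rfl⟩, h⟩ := he
      exact ⟨v, by simpa using h v (by simp), rfl⟩

lemma exists_fun (G : SimpleGraph V) (Γ : Finset (Sym2 V)) (h : IsCRSF G Γ) :
    ∃ f : V → V, (∀ v, G.Adj v (f v)) ∧ (Function.Injective fun v => s(v, f v)) ∧
      Finset.univ.image (fun v => s(v, f v)) = Γ := by
  obtain ⟨hG, hC⟩ := h
  set H := SimpleGraph.fromEdgeSet (↑Γ : Set (Sym2 V)) with hH
  have hadj : ∀ a b, s(a, b) ∈ Γ → H.Adj a b := by
    intro a b hab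
    rw [hH, SimpleGraph.fromEdgeSet_adj]
    exact ⟨hab, (show G.Adj a b from hG hab).ne⟩
  let E : H.ConnectedComponent → Finset (Sym2 V) := fun C => Γ.filter fun e => ∀ v ∈ e, v ∈ C.supp
  have hE : ∀ e ∈ Γ, ∀ v ∈ e, e ∈ E (H.connectedComponentMk v) := by
    intro e he v hv
    obtain ⟨u, rfl⟩ := Sym2.mem_iff_exists.1 hv
    simp only [E, Finset.mem_filter, Sym2.mem_iff, SimpleGraph.ConnectedComponent.mem_supp_iff]
    refine ⟨he, ?_⟩
    rintro x (rfl | rfl)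
    · rfl
    · exact SimpleGraph.ConnectedComponent.eq.2 (hadj _ _ he).symm.reachable
  have hEd : ∀ C C', C ≠ C' → Disjoint (E C) (E C') := by
    intro C C' hne
    rw [Finset.disjoint_left]
    intro e he he'
    induction e with | _ a b
    simp only [E, Finset.mem_filter] at he he'
    exact hne ((he.2 a (by simp)).symm.trans (he'.2 a (by simp)))
  have hVsum : ∀ X : Finset V, X.card = ∑ C : H.ConnectedComponent,
      (X.filter fun v => H.connectedComponentMk v = C).card := fun X =>
    Finset.card_eq_sum_card_fiberwise (fun _ _ => Finset.mem_coe.2 (Finset.mem_univ _))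
  have hsupp : ∀ C : H.ConnectedComponent, C.supp.toFinite.toFinset =
      Finset.univ.filter fun v => H.connectedComponentMk v = C := by
    intro C; ext v; simp
  have hΓcard : Γ.card = Fintype.card V := by
    have : Γ = Finset.univ.biUnion E := by
      ext e
      constructor
      · intro he
        induction e with | _ a b
        rw [Finset.mem_biUnion]
        exact ⟨_, Finset.mem_univ _, hE _ he a (by simp)⟩
      · intro he
        obtain ⟨C, -, hC⟩ := Finset.mem_biUnion.1 he
        exact (Finset.mem_filter.1 hC).1
    rw [this, Finset.card_biUnion (fun C _ C' _ hne => hEd C C' hne), ← Finset.card_univ,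
      hVsum Finset.univ]
    refine Finset.sum_congr rfl fun C _ => ?_
    rw [← hsupp]
    exact hC C
  have hall : ∀ X : Finset V, X.card ≤ (X.biUnion fun v => Γ.filter fun e => v ∈ e).card := by
    intro X
    have hsub : (Finset.univ.biUnion fun C => (E C).filter fun e => ∃ v ∈ X, v ∈ e) ⊆
        X.biUnion fun v => Γ.filter fun e => v ∈ e := by
      intro e he
      simp only [Finset.mem_biUnion, Finset.mem_filter, E, Finset.mem_univ, true_and] at he ⊢
      obtain ⟨C, ⟨h1, _⟩, v, hv, hve⟩ := he
      exact ⟨v, hv, h1, hve⟩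
    refine le_trans ?_ (Finset.card_le_card hsub)
    rw [Finset.card_biUnion (fun C _ C' _ hne => (hEd C C' hne).mono (Finset.filter_subset _ _)
      (Finset.filter_subset _ _)), hVsum X]
    refine Finset.sum_le_sum fun C _ => ?_
    by_cases hCX : ∀ v ∈ C.supp, v ∈ X
    · have e1 : (E C).filter (fun e => ∃ v ∈ X, v ∈ e) = E C := by
        rw [Finset.filter_eq_self]
        intro e he
        induction e with | _ a b
        exact ⟨a, hCX a ((Finset.mem_filter.1 he).2 a (by simp)), by simp⟩
      rw [e1]
      refine le_trans (Finset.card_le_card (Finset.filter_subset_filter _ (Finset.subset_univ X))) ?_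
      rw [← hsupp]
      exact (hC C).ge
    · push Not at hCX
      obtain ⟨r, hr, hrX⟩ := hCX
      have hpar : ∀ v, v ∈ X → H.connectedComponentMk v = C → ∃ u, s(v, u) ∈ Γ ∧
          H.dist u r + 1 = H.dist v r := by
        intro v hv hvC
        have hreach : H.Reachable v r := by
          rw [← SimpleGraph.ConnectedComponent.eq, hvC]
          exact hr.symm
        obtain ⟨w, hw⟩ := hreach.exists_walk_length_eq_dist
        cases w with
        | nil => exact absurd hv hrX
        | @cons _ u _ huv p =>
          refine ⟨u, ?_, ?_⟩
          · have := (SimpleGraph.fromEdgeSet_adj _).1 huv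
            exact this.1
          · rw [SimpleGraph.Walk.length_cons] at hw
            have h1 := SimpleGraph.dist_le p
            have h2 := huv.reachable.dist_triangle_left r
            have h3 : H.dist v u = 1 := SimpleGraph.dist_eq_one_iff_adj.2 huv
            omega
      choose! g hg1 hg2 using hpar
      refine Finset.card_le_card_of_injOn (fun v => s(v, g v)) ?_ ?_
      · intro v hv
        simp only [Finset.coe_filter, Set.mem_ofPred_eq] at hv
        simp only [Finset.coe_filter, Set.mem_ofPred_eq]
        refine ⟨?_, v, hv.1, by simp⟩
        have := hE _ (hg1 v hv.1 hv.2) v (by simp)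
        rwa [hv.2] at this
      · intro v hv u hu' he
        simp only [Finset.coe_filter, Set.mem_ofPred_eq] at hv hu'
        simp only [Sym2.eq_iff] at he
        rcases he with he | ⟨h1, h2⟩
        · exact he.1
        · have a1 := hg2 v hv.1 hv.2
          have a2 := hg2 u hu'.1 hu'.2
          rw [h2] at a1
          rw [← h1] at a2
          omega
  obtain ⟨g, hg, hg'⟩ := (Finset.all_card_le_biUnion_card_iff_exists_injective _).1 hall
  simp only [Finset.mem_filter] at hg'
  have : ∀ v, ∃ u, g v = s(v, u) := fun v => Sym2.mem_iff_exists.1 (hg' v).2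
  choose f hf using this
  have hfe : (fun v => s(v, f v)) = g := by funext v; exact (hf v).symm
  refine ⟨f, ?_, by rw [hfe]; exact hg, ?_⟩
  · intro v
    have := hG (hg' v).1
    rw [hf] at this
    exact this
  · rw [hfe]
    refine Finset.eq_of_subset_of_card_le ?_ ?_
    · intro e he
      obtain ⟨v, -, rfl⟩ := Finset.mem_image.1 he
      exact (hg' v).1
    · rw [Finset.card_image_of_injective _ hg, hΓcard, Finset.card_univ]

theorem det_lineLaplacian_eq_sum_CRSF
    (G : SimpleGraph V) (c : V → V → ℝ) (φ : V → V → ℂ)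
    (hc_symm : ∀ v w, c v w = c w v)
    (hc_pos : ∀ v w, G.Adj v w → 0 < c v w)
    (hc_zero : ∀ v w, ¬G.Adj v w → c v w = 0)
    (hφ_unit : ∀ v w, G.Adj v w → ‖φ v w‖ = 1)
    (hφ_symm : ∀ v w, G.Adj v w → φ w v = starRingEnd ℂ (φ v w)) :
    (lineLaplacian c φ).det =
      ∑ Γ ∈ Finset.univ.filter (IsCRSF G),
        (∏ e ∈ Γ, (edgeC c hc_symm e : ℂ)) * ∏ δ ∈ cyclesOf Γ, cycleWeight φ δ := by
  have hone : ∀ v w, G.Adj v w → φ v w * φ w v = 1 := by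
    intro v w h
    rw [hφ_symm v w h, Complex.mul_conj, Complex.normSq_eq_norm_sq, hφ_unit v w h]
    simp
  have hzero : ∀ f : V → V, (∀ v, G.Adj v (f v)) → ¬ (Function.Injective fun v => s(v, f v)) →
      (rowMat φ f).det = 0 := by
    intro f hf hni
    simp only [Function.Injective] at hni
    push Not at hni
    obtain ⟨a, b, hab, hne⟩ := hni
    simp only [Sym2.eq_iff] at hab
    rcases hab with hab | ⟨h1, h2⟩
    · exact absurd hab.1 hne
    · refine det_rowMat_zero φ f hne h2 h1.symm (hone a b ?_)
      rw [← h2]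
      exact hf a
  have hG0 : ∀ v, c v v = 0 := fun v => hc_zero v v (G.loopless.irrefl v)
  rw [det_expand c φ hG0]
  have e1 : ∑ f : V → V, (∏ v, (c v (f v) : ℂ)) * (rowMat φ f).det =
      ∑ f ∈ Finset.univ.filter (fun f : V → V => (∀ v, G.Adj v (f v)) ∧
        Function.Injective fun v => s(v, f v)), (∏ v, (c v (f v) : ℂ)) * (rowMat φ f).det := by
    rw [Finset.sum_filter]
    refine Finset.sum_congr rfl fun f _ => ?_
    split_ifs with h
    · rfl
    · by_cases hA : ∀ v, G.Adj v (f v)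
      · rw [hzero f hA (fun hi => h ⟨hA, hi⟩), mul_zero]
      · push Not at hA
        obtain ⟨v, hv⟩ := hA
        rw [Finset.prod_eq_zero (Finset.mem_univ v), zero_mul]
        simp [hc_zero _ _ hv]
  rw [e1, ← Finset.sum_fiberwise_of_maps_to (t := Finset.univ.filter (IsCRSF G))
    (g := fun f : V → V => Finset.univ.image fun v => s(v, f v))]
  swap
  · intro f hf
    rw [Finset.mem_filter] at hf ⊢
    exact ⟨Finset.mem_univ _, isCRSF_of_fun G f hf.2.1 hf.2.2⟩
  refine Finset.sum_congr rfl fun Γ hΓ => ?_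
  obtain ⟨f₀, hf₀, hinj₀, rfl⟩ := exists_fun G Γ (Finset.mem_filter.1 hΓ).2
  rw [← det_crsf φ f₀ (fun v => (hf₀ v).ne') hinj₀ (fun v => hφ_unit _ _ (hf₀ v))
    (fun v => hφ_symm _ _ (hf₀ v)), det_expand, Finset.mul_sum, Finset.filter_filter,
    Finset.sum_filter]
  swap
  · intro v
    rw [if_neg]
    simp only [Finset.mem_image, Finset.mem_univ, true_and, Sym2.eq_iff, not_exists]
    rintro u (⟨h1, h2⟩ | ⟨h1, h2⟩) <;> exact (hf₀ u).ne (h1.trans h2.symm)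
  refine Finset.sum_congr rfl fun f _ => ?_
  have hadj : ∀ a b, s(a, b) ∈ Finset.univ.image (fun v => s(v, f₀ v)) → G.Adj a b := fun a b h =>
    (Finset.mem_filter.1 hΓ).2.1 h
  split_ifs with h
  · obtain ⟨⟨h1, h2⟩, h3⟩ := h
    have e2 : ∏ v, (((if s(v, f v) ∈ Finset.univ.image (fun v => s(v, f₀ v)) then 1 else 0 : ℝ)) : ℂ)
        = 1 := by
      refine Finset.prod_eq_one fun v _ => ?_
      rw [← h3, if_pos (Finset.mem_image_of_mem _ (Finset.mem_univ v))]
      simp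
    rw [e2, one_mul, ← h3, Finset.prod_image (fun a _ b _ hab => h2 hab)]
    rfl
  · by_cases hA : ∀ v, s(v, f v) ∈ Finset.univ.image (fun v => s(v, f₀ v))
    · have hA' : ∀ v, G.Adj v (f v) := fun v => hadj _ _ (hA v)
      rw [hzero f hA', mul_zero, mul_zero]
      intro hi
      refine h ⟨⟨hA', hi⟩, ?_⟩
      refine Finset.eq_of_subset_of_card_le ?_ ?_
      · intro e he
        obtain ⟨v, -, rfl⟩ := Finset.mem_image.1 he
        exact hA v
      · rw [Finset.card_image_of_injective _ hi, Finset.card_image_of_injective _ hinj₀]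
    · push Not at hA
      obtain ⟨v, hv⟩ := hA
      rw [Finset.prod_eq_zero (Finset.mem_univ v) (by rw [if_neg hv]; simp), zero_mul, mul_zero]

end CRSFStmt
end
end

section
/- Let G = (V,E) be a finite connected graph with conductances c : E → ℝ_{>0}, let Φ be a unitary connection on a complex line bundle over G, and let S ⊆ V be a nonempty set of vertices. Then det(Δ_{Φ,S}) = Σ_Γ Π_{e∈Γ} c(e) · Π_{cycles γ of Γ} (2 − ω_γ − ω_γ^{-1}), where Δ_{Φ,S} is the Dirichlet Laplacian with boundary S, the sum is over all essential CRSFs of G with Dirichlet boundary S, the product is over the cycles of Γ, and ω_γ is the monodromy of Φ around the cycle γ. -/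
/-!
STATEMENT 2.  For a nonempty boundary set `S`,
`det(Δ_{Φ,S}) = Σ_Γ Π_{e∈Γ} c(e) · Π_{cycles γ of Γ} (2 − ω_γ − ω_γ^{-1})`,
the sum being over all essential CRSFs of `G` with Dirichlet boundary `S`.
-/

open Classical

noncomputable section

namespace CRSFStmt

variable {V : Type*} [Fintype V] [DecidableEq V]

/-- `Γ` is an essential CRSF of `G` with Dirichlet boundary `S`: a spanning subgraph
each of whose connected components is either a unicyclic graph (as many edges as
vertices) disjoint from `S`, or a tree containing exactly one vertex of `S`. -/
def IsEssentialCRSF (G : SimpleGraph V) (S : Finset V) (Γ : Finset (Sym2 V)) : Prop :=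
  ↑Γ ⊆ G.edgeSet ∧
    ∀ C : (SimpleGraph.fromEdgeSet (↑Γ : Set (Sym2 V))).ConnectedComponent,
      ((Γ.filter fun e => ∀ v ∈ e, v ∈ C.supp).card = C.supp.toFinite.toFinset.card ∧
          C.supp.toFinite.toFinset ∩ S = ∅) ∨
      ((Γ.filter fun e => ∀ v ∈ e, v ∈ C.supp).card + 1 = C.supp.toFinite.toFinset.card ∧
          (C.supp.toFinite.toFinset ∩ S).card = 1)

/-- The Dirichlet Laplacian with boundary `S`: the principal submatrix of the
line-bundle Laplacian with rows and columns indexed by `V ∖ S`. -/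
def dirichletLaplacian (c : V → V → ℝ) (φ : V → V → ℂ) (S : Finset V) :
    Matrix {v : V // v ∉ S} {v : V // v ∉ S} ℂ :=
  (lineLaplacian c φ).submatrix (fun v => (v : V)) (fun v => (v : V))

set_option linter.unusedSectionVars false
set_option linter.unusedSimpArgs false
/-- Row vector attached to a pair `(x,u)`. -/
def rowv (φ : V → V → ℂ) (S : Finset V) (x : {v : V // v ∉ S}) (u : V) :
    {v : V // v ∉ S} → ℂ :=
  fun y => (if x = y then 1 else 0) - (if u = (y : V) then φ y x else 0)

def coefA (φ : V → V → ℂ) (S : Finset V) (Γ : Finset (Sym2 V)) : ℂ :=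
  ∑ f ∈ ((Finset.univ : Finset ({v : V // v ∉ S} → V)).filter
      (fun f => Function.Injective (fun x : {v : V // v ∉ S} => s((x : V), f x)))).filter
      (fun f => Finset.univ.image (fun x : {v : V // v ∉ S} => s((x : V), f x)) = Γ),
    (Matrix.of fun x => rowv φ S x (f x)).det

lemma coefA_eq_zero (φ : V → V → ℂ) (S : Finset V) (Γ : Finset (Sym2 V))
    (h : Γ.card ≠ Fintype.card {v : V // v ∉ S}) : coefA φ S Γ = 0 := by
  unfold coefA
  rw [Finset.sum_eq_zero]
  intro f hf
  exfalso
  simp only [Finset.mem_filter, Finset.mem_univ, true_and] at hf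
  apply h
  rw [← hf.2, Finset.card_image_of_injective _ hf.1, Finset.card_univ]

lemma dirichlet_row (c : V → V → ℝ) (φ : V → V → ℂ) (S : Finset V)
    (hloop : ∀ v, c v v = 0) :
    dirichletLaplacian c φ S = Matrix.of fun x : {v : V // v ∉ S} => ∑ u, (c x u : ℂ) • rowv φ S x u := by
  ext x y
  simp only [dirichletLaplacian, lineLaplacian, Matrix.submatrix_apply, Matrix.of_apply,
    Finset.sum_apply, Pi.smul_apply, rowv, smul_eq_mul, mul_sub, Finset.sum_sub_distrib]
  by_cases h : x = y
  · subst h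
    simp [hloop]
  · have h' : (x : V) ≠ y := fun e => h (Subtype.ext e)
    simp [h, h']

lemma det_rowv_zero (φ : V → V → ℂ) (S : Finset V) (f : {v : V // v ∉ S} → V)
    (hf : ∀ x : {v : V // v ∉ S}, φ x (f x) * φ (f x) x = 1)
    (hinj : ¬ Function.Injective (fun x : {v : V // v ∉ S} => s((x : V), f x))) :
    (Matrix.of fun x => rowv φ S x (f x)).det = 0 := by
  simp only [Function.Injective, not_forall] at hinj
  obtain ⟨x, y, hxy, hne⟩ := hinj
  have hne' : (x : V) ≠ y := fun e => hne (Subtype.ext e)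
  rw [Sym2.eq_iff] at hxy
  rcases hxy with ⟨h1, _⟩ | ⟨h1, h2⟩
  · exact absurd h1 hne'
  rw [← Matrix.det_updateRow_add_smul_self _ hne (φ y x)]
  apply Matrix.det_eq_zero_of_row_eq_zero x
  intro z
  have h3 := hf x
  rw [h2] at h3
  simp only [Matrix.updateRow_self, Pi.add_apply, Pi.smul_apply, Matrix.of_apply, rowv, smul_eq_mul]
  rw [h2, ← h1]
  by_cases hzx : z = x
  · subst hzx
    simp [Ne.symm hne, Ne.symm hne']
    linear_combination -h3
  · by_cases hzy : z = y
    · subst hzy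
      simp [hne, hne']
    · have a1 : (x : V) ≠ z := fun e => hzx (Subtype.ext e.symm)
      have a2 : (y : V) ≠ z := fun e => hzy (Subtype.ext e.symm)
      simp [Ne.symm hzx, Ne.symm hzy, a1, a2]

lemma det_expand_s2 (G : SimpleGraph V) (c : V → V → ℝ) (φ : V → V → ℂ) (S : Finset V)
    (hc_symm : ∀ v w, c v w = c w v)
    (hc_zero : ∀ v w, ¬G.Adj v w → c v w = 0)
    (hφ : ∀ v w, G.Adj v w → φ v w * φ w v = 1) :
    (dirichletLaplacian c φ S).det =
      ∑ Γ : Finset (Sym2 V), (∏ e ∈ Γ, (edgeC c hc_symm e : ℂ)) * coefA φ S Γ := by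
  have h1 : (dirichletLaplacian c φ S).det = ∑ f : {v : V // v ∉ S} → V,
      (∏ x : {v : V // v ∉ S}, (c x (f x) : ℂ)) * (Matrix.of fun x => rowv φ S x (f x)).det := by
    rw [dirichlet_row c φ S (fun v => hc_zero v v (G.irrefl))]
    have := (Matrix.detRowAlternating (n := {v : V // v ∉ S}) (R := ℂ)).toMultilinearMap.map_sum
      (fun (x : {v : V // v ∉ S}) (u : V) => (c x u : ℂ) • rowv φ S x u)
    refine this.trans ?_
    refine Finset.sum_congr rfl fun f _ => ?_
    have := (Matrix.detRowAlternating (n := {v : V // v ∉ S}) (R := ℂ)).toMultilinearMap.map_smul_univ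
      (fun x : {v : V // v ∉ S} => (c x (f x) : ℂ)) (fun x => rowv φ S x (f x))
    exact this
  rw [h1]
  simp only [coefA, Finset.mul_sum]
  have h2 : ∀ (Γ : Finset (Sym2 V)), ∀ f ∈ ((Finset.univ : Finset ({v : V // v ∉ S} → V)).filter
      (fun f => Function.Injective (fun x : {v : V // v ∉ S} => s((x : V), f x)))).filter
      (fun f => Finset.univ.image (fun x : {v : V // v ∉ S} => s((x : V), f x)) = Γ),
      (∏ e ∈ Γ, (edgeC c hc_symm e : ℂ)) * (Matrix.of fun x => rowv φ S x (f x)).det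
      = (∏ x : {v : V // v ∉ S}, (c x (f x) : ℂ)) * (Matrix.of fun x => rowv φ S x (f x)).det := by
    intro Γ f hf
    simp only [Finset.mem_filter, Finset.mem_univ, true_and] at hf
    rw [← hf.2, Finset.prod_image (fun a _ b _ h => hf.1 h)]
    rfl
  rw [Finset.sum_congr rfl (fun Γ _ => Finset.sum_congr rfl (h2 Γ))]
  rw [Finset.sum_fiberwise]
  symm
  apply Finset.sum_subset (Finset.subset_univ _)
  intro f _ hf
  simp only [Finset.mem_filter, Finset.mem_univ, true_and] at hf
  by_cases hall : ∀ x : {v : V // v ∉ S}, G.Adj x (f x)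
  · rw [det_rowv_zero φ S f (fun x => hφ _ _ (hall x)) hf, mul_zero]
  · push Not at hall
    obtain ⟨x, hx⟩ := hall
    rw [Finset.prod_eq_zero (Finset.mem_univ x), zero_mul]
    simp [hc_zero _ _ hx]

/-- indicator conductance -/
def indC (Γ : Finset (Sym2 V)) (x y : V) : ℝ := if s(x, y) ∈ Γ then 1 else 0

lemma indC_symm (Γ : Finset (Sym2 V)) (x y : V) : indC Γ x y = indC Γ y x := by
  simp [indC, Sym2.eq_swap]

lemma det_indC (φ : V → V → ℂ) (S : Finset V) (Γ : Finset (Sym2 V))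
    (hloop : ∀ x, s(x, x) ∉ Γ)
    (hφ : ∀ v w, s(v, w) ∈ Γ → φ v w * φ w v = 1)
    (hcard : Γ.card = Fintype.card {v : V // v ∉ S}) :
    (dirichletLaplacian (indC Γ) φ S).det = coefA φ S Γ := by
  rw [det_expand_s2 (SimpleGraph.fromEdgeSet (Γ : Set (Sym2 V))) (indC Γ) φ S (indC_symm Γ)]
  · rw [Finset.sum_eq_single Γ]
    · rw [Finset.prod_eq_one, one_mul]
      intro e he
      induction e with
      | _ x y => simp [edgeC, indC, he]
    · intro Γ' _ hne
      by_cases hc : Γ'.card = Fintype.card {v : V // v ∉ S}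
      · have : ¬ Γ' ⊆ Γ := fun h => hne (Finset.eq_of_subset_of_card_le h (by omega))
        rw [Finset.not_subset] at this
        obtain ⟨e, he, he'⟩ := this
        rw [Finset.prod_eq_zero he, zero_mul]
        induction e with
        | _ x y => simp [edgeC, indC, he']
      · rw [coefA_eq_zero _ _ _ hc, mul_zero]
    · simp
  · intro v w h
    simp only [SimpleGraph.fromEdgeSet_adj, not_and, not_not, Finset.mem_coe] at h
    unfold indC
    rw [if_neg]
    intro h'
    have := h h'
    subst this
    exact hloop _ h'
  · intro v w h
    simp only [SimpleGraph.fromEdgeSet_adj, Finset.mem_coe] at h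
    exact hφ v w h.1

/-- number of neighbours of `x` in `Γ` -/
def degG (Γ : Finset (Sym2 V)) (x : V) : ℕ := (Finset.univ.filter fun y => s(x, y) ∈ Γ).card

/-- extended matrix -/
def MM (φ : V → V → ℂ) (Γ : Finset (Sym2 V)) (S : Finset V) : Matrix V V ℂ :=
  Matrix.of fun x y => if x ∈ S ∨ y ∈ S then (if x = y then 1 else 0) else
    if x = y then (degG Γ x : ℂ) else if s(x, y) ∈ Γ then - φ y x else 0

lemma det_MM (φ : V → V → ℂ) (Γ : Finset (Sym2 V)) (S : Finset V) :
    (MM φ Γ S).det = (dirichletLaplacian (indC Γ) φ S).det := by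
  rw [Matrix.twoBlockTriangular_det' (MM φ Γ S) (fun x => x ∈ S)]
  · have h1 : (MM φ Γ S).toSquareBlockProp (fun x => x ∈ S) = 1 := by
      ext ⟨x, hx⟩ ⟨y, hy⟩
      simp [Matrix.toSquareBlockProp, MM, hx, hy, Matrix.one_apply]
    have h2 : (MM φ Γ S).toSquareBlockProp (fun x => ¬ x ∈ S) = dirichletLaplacian (indC Γ) φ S := by
      ext ⟨x, hx⟩ ⟨y, hy⟩
      simp only [Matrix.toSquareBlockProp, MM, hx, hy, dirichletLaplacian, lineLaplacian, indC,
        degG, Matrix.toBlock_apply, Matrix.of_apply, Matrix.submatrix_apply, or_self, if_false]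
      by_cases hxy : x = y
      · simp only [hxy, if_true, Finset.card_filter]
        push_cast
        exact Finset.sum_congr rfl fun z _ => by split_ifs <;> simp
      · by_cases hg : s(x, y) ∈ Γ <;> simp [hxy, hg]
    refine (congrArg₂ (· * ·) (?_ : _ = (1 : ℂ))
      (?_ : _ = (dirichletLaplacian (indC Γ) φ S).det)).trans (one_mul _)
    · rw [h1]
      convert Matrix.det_one
    · rw [h2]
  · intro i hi j hj
    have : i ≠ j := fun e => hj (e ▸ hi)
    simp [MM, hi, this]


set_option linter.unusedSectionVars false
set_option linter.unusedSimpArgs false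
/-- weighted adjacency matrix of a walk -/
def WP (g : V → V → ℂ) {a b : V} (p : (⊤ : SimpleGraph V).Walk a b) : Matrix V V ℂ :=
  (p.darts.map fun d => Matrix.single d.toProd.1 d.toProd.2 (g d.toProd.1 d.toProd.2)).sum

lemma WP_mul_single (g : V → V → ℂ) {a b : V} (p : (⊤ : SimpleGraph V).Walk a b) (x y : V) (r : ℂ)
    (hx : x ∉ p.support) : WP g p * Matrix.single x y r = 0 := by
  induction p with
  | nil => simp [WP]
  | cons h q ih =>
    simp only [SimpleGraph.Walk.support_cons, List.mem_cons, not_or] at hx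
    have := ih hx.2
    simp only [WP, SimpleGraph.Walk.darts_cons, List.map_cons, List.sum_cons] at this ⊢
    rw [Matrix.add_mul, this, add_zero, Matrix.single_mul_single_of_ne]
    rintro rfl
    exact hx.2 q.start_mem_support

lemma single_mul_WP (g : V → V → ℂ) {a b : V} (p : (⊤ : SimpleGraph V).Walk a b) (x y : V) (r : ℂ)
    (hx : x ∉ p.support) : Matrix.single y x r * WP g p = 0 := by
  induction p with
  | nil => simp [WP]
  | cons h q ih =>
    simp only [SimpleGraph.Walk.support_cons, List.mem_cons, not_or] at hx
    have := ih hx.2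
    simp only [WP, SimpleGraph.Walk.darts_cons, List.map_cons, List.sum_cons] at this ⊢
    rw [Matrix.mul_add, this, add_zero, Matrix.single_mul_single_of_ne]
    exact hx.1

lemma det_path (g : V → V → ℂ) {a b : V} (p : (⊤ : SimpleGraph V).Walk a b) (hp : p.IsPath) (r : ℂ) :
    (1 - WP g p - Matrix.single b a r).det =
      1 - r * (p.darts.map fun d => g d.toProd.1 d.toProd.2).prod := by
  induction p generalizing r with
  | nil =>
    rename_i u
    have : (1 - WP g (SimpleGraph.Walk.nil : (⊤ : SimpleGraph V).Walk u u) - Matrix.single u u r)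
        = Matrix.diagonal (fun x => if x = u then 1 - r else 1) := by
      ext x y
      simp only [WP, SimpleGraph.Walk.darts_nil, List.map_nil, List.sum_nil, Matrix.sub_apply,
        Matrix.one_apply, Matrix.zero_apply, Matrix.single_apply, Matrix.diagonal_apply]
      by_cases hx : x = y
      · subst hx
        by_cases hu : x = u
        · simp [hu]
        · simp [hu, Ne.symm hu]
      · have : ¬ (u = x ∧ u = y) := fun ⟨h1, h2⟩ => hx (h1 ▸ h2)
        simp [hx, this]
    rw [this, Matrix.det_diagonal]
    simp
  | cons h q ih =>
    rename_i u v w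
    rw [SimpleGraph.Walk.cons_isPath_iff] at hp
    have huv : u ≠ v := h
    have huw : w ≠ u := by
      rintro rfl
      exact hp.2 q.end_mem_support
    have key : Matrix.transvection w u r *
        ((1 - WP g (SimpleGraph.Walk.cons h q) - Matrix.single w u r) *
          Matrix.transvection u v (g u v)) = 1 - WP g q - Matrix.single w v (r * g u v) := by
      have e1 : WP g (SimpleGraph.Walk.cons h q) = Matrix.single u v (g u v) + WP g q := by
        simp [WP]
      rw [e1]
      have e2 := WP_mul_single g q u v (g u v) hp.2
      have e3 := single_mul_WP g q u w r hp.2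
      have e4 : Matrix.single u v (g u v) * Matrix.single u v (g u v) = 0 :=
        Matrix.single_mul_single_of_ne _ _ _ _ huv.symm _
      have e5 : Matrix.single w u r * Matrix.single w u r = 0 :=
        Matrix.single_mul_single_of_ne _ _ _ _ huw.symm _
      have e6 : Matrix.single w u r * Matrix.single w v (r * g u v) = 0 :=
        Matrix.single_mul_single_of_ne _ _ _ _ huw.symm _
      have e7 : Matrix.single w u r * Matrix.single u v (g u v) = Matrix.single w v (r * g u v) :=
        Matrix.single_mul_single_same _ _ _ _ _
      have step : (1 - (Matrix.single u v (g u v) + WP g q) - Matrix.single w u r) *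
          Matrix.transvection u v (g u v) = 1 - WP g q - Matrix.single w u r
            - Matrix.single w v (r * g u v) := by
        simp only [Matrix.transvection, mul_add, sub_mul, add_mul, e2, e4, e7, one_mul, mul_one]
        abel
      rw [step]
      simp only [Matrix.transvection, mul_sub, add_mul, e3, e5, e6, one_mul, mul_one]
      abel
    have hd := congrArg Matrix.det key
    rw [Matrix.det_mul, Matrix.det_mul, Matrix.det_transvection_of_ne _ _ huw,
      Matrix.det_transvection_of_ne _ _ huv, ih hp.1] at hd
    simp only [SimpleGraph.Walk.darts_cons, List.map_cons, List.prod_cons]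
    rw [one_mul, mul_one] at hd
    rw [hd]
    ring

lemma det_cycle (g : V → V → ℂ) {a : V} (p : (⊤ : SimpleGraph V).Walk a a) (hp : p.IsCycle) :
    (1 - WP g p).det = 1 - (p.darts.map fun d => g d.toProd.1 d.toProd.2).prod := by
  cases p with
  | nil => exact absurd hp (by simp)
  | cons h q =>
    rename_i v
    rw [SimpleGraph.Walk.cons_isCycle_iff] at hp
    have := det_path g q hp.1 (g a v)
    simp only [SimpleGraph.Walk.darts_cons, List.map_cons, List.prod_cons]
    rw [← this]
    congr 1
    simp [WP]
    abel

/-- directed adjacency of a walk -/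
def DD {a b : V} (p : (⊤ : SimpleGraph V).Walk a b) (x y : V) : Prop :=
  ∃ d ∈ p.darts, d.toProd = (x, y)

lemma DD_edges {a b : V} (p : (⊤ : SimpleGraph V).Walk a b) (x y : V) :
    s(x, y) ∈ p.edges ↔ DD p x y ∨ DD p y x := by
  simp only [SimpleGraph.Walk.edges, List.mem_map, DD]
  constructor
  · rintro ⟨d, hd, h⟩
    have h' : s(d.toProd.1, d.toProd.2) = s(x, y) := h
    rw [Sym2.eq_iff] at h'
    rcases h' with h | h
    · exact Or.inl ⟨d, hd, Prod.ext h.1 h.2⟩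
    · exact Or.inr ⟨d, hd, Prod.ext h.1 h.2⟩
  · rintro (⟨d, hd, h⟩ | ⟨d, hd, h⟩)
    · exact ⟨d, hd, by rw [SimpleGraph.Dart.edge, h]⟩
    · exact ⟨d, hd, by rw [SimpleGraph.Dart.edge, h, Sym2.eq_swap]⟩

lemma DD_inj_left {a : V} (p : (⊤ : SimpleGraph V).Walk a a) (hp : p.IsCycle) {x y z : V}
    (h1 : DD p x y) (h2 : DD p z y) : x = z := by
  obtain ⟨d, hd, e⟩ := h1
  obtain ⟨d', hd', e'⟩ := h2
  have hn : (p.darts.map (·.snd)).Nodup := by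
    rw [SimpleGraph.Walk.map_snd_darts]; exact hp.support_nodup
  have := List.inj_on_of_nodup_map hn hd hd' (by simp [e, e'])
  subst this
  rw [e] at e'
  exact (Prod.ext_iff.1 e').1

lemma DD_reverse {a b : V} (p : (⊤ : SimpleGraph V).Walk a b) (x y : V) :
    DD p.reverse x y ↔ DD p y x := by
  simp only [DD, SimpleGraph.Walk.mem_darts_reverse]
  constructor
  · rintro ⟨d, hd, e⟩
    exact ⟨d.symm, hd, by simp [e]⟩
  · rintro ⟨d, hd, e⟩
    exact ⟨d.symm, by simpa using hd, by simp [e]⟩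

lemma DD_inj_right {a : V} (p : (⊤ : SimpleGraph V).Walk a a) (hp : p.IsCycle) {x y z : V}
    (h1 : DD p y x) (h2 : DD p y z) : x = z :=
  DD_inj_left p.reverse hp.reverse ((DD_reverse p x y).2 h1) ((DD_reverse p z y).2 h2)

lemma DD_ne {a b : V} (p : (⊤ : SimpleGraph V).Walk a b) {x y : V} (h1 : DD p x y) : x ≠ y := by
  obtain ⟨d, hd, e⟩ := h1
  have := d.adj
  rw [e] at this
  exact this

lemma DD_asymm {a : V} (p : (⊤ : SimpleGraph V).Walk a a) (hp : p.IsCycle) {x y : V}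
    (h1 : DD p x y) : ¬ DD p y x := by
  intro h2
  have hne := DD_ne p h1
  obtain ⟨d, hd, e⟩ := h1
  obtain ⟨d', hd', e'⟩ := h2
  have hn : (p.darts.map (·.edge)).Nodup := hp.edges_nodup
  have := List.inj_on_of_nodup_map hn hd hd'
    (by simp only [SimpleGraph.Dart.edge, e, e', Sym2.eq_swap])
  subst this
  rw [e] at e'
  exact hne (Prod.ext_iff.1 e').1

lemma DD_mem {a b : V} (p : (⊤ : SimpleGraph V).Walk a b) {x y : V} (h : DD p x y) :
    x ∈ p.support ∧ y ∈ p.support := by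
  obtain ⟨d, hd, e⟩ := h
  have h1 := p.dart_fst_mem_support_of_mem_darts hd
  have h2 := p.dart_snd_mem_support_of_mem_darts hd
  rw [e] at h1 h2
  exact ⟨h1, h2⟩

lemma DD_pred {a : V} (p : (⊤ : SimpleGraph V).Walk a a) (hp : p.IsCycle) {x : V}
    (h : x ∈ p.support) : ∃ y, DD p y x := by
  have h' : x ∈ p.support.tail := by
    cases p with
    | nil => exact absurd hp (by simp)
    | cons hh q =>
      simp only [SimpleGraph.Walk.support_cons, List.mem_cons, List.tail_cons] at h ⊢
      rcases h with rfl | h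
      · exact q.end_mem_support
      · exact h
  rw [← SimpleGraph.Walk.map_snd_darts, List.mem_map] at h'
  obtain ⟨d, hd, rfl⟩ := h'
  exact ⟨d.fst, d, hd, rfl⟩

lemma DD_succ {a : V} (p : (⊤ : SimpleGraph V).Walk a a) (hp : p.IsCycle) {x : V}
    (h : x ∈ p.support) : ∃ y, DD p x y := by
  obtain ⟨y, hy⟩ := DD_pred p.reverse hp.reverse (x := x) (by simpa using h)
  exact ⟨y, (DD_reverse p y x).1 hy⟩

lemma list_sum_single (g : V → V → ℂ) (l : List ((⊤ : SimpleGraph V).Dart)) (hl : l.Nodup)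
    (x y : V) :
    (l.map fun d => Matrix.single d.toProd.1 d.toProd.2 (g d.toProd.1 d.toProd.2)).sum x y =
      if ∃ d ∈ l, d.toProd = (x, y) then g x y else 0 := by
  induction l with
  | nil => simp
  | cons d l ih =>
    rw [List.nodup_cons] at hl
    rw [List.map_cons, List.sum_cons, Matrix.add_apply, ih hl.2]
    by_cases h : d.toProd = (x, y)
    · have : ¬ ∃ d' ∈ l, d'.toProd = (x, y) := by
        rintro ⟨d', hd', e⟩
        have : d = d' := SimpleGraph.Dart.ext _ _ (h.trans e.symm)
        exact hl.1 (this ▸ hd')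
      rw [if_neg this, if_pos ⟨d, by simp, h⟩, h]
      simp
    · have h' : ¬ (d.toProd.1 = x ∧ d.toProd.2 = y) := fun hh => h (Prod.ext hh.1 hh.2)
      rw [Matrix.single_apply, if_neg h', zero_add]
      congr 1
      simp [h]

lemma WP_apply (g : V → V → ℂ) {a : V} (p : (⊤ : SimpleGraph V).Walk a a) (hp : p.IsCycle)
    (x y : V) : WP g p x y = if DD p x y then g x y else 0 := by
  unfold WP DD
  have : (p.darts.map (·.edge)).Nodup := hp.edges_nodup
  rw [list_sum_single g p.darts (List.Nodup.of_map _ this)]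
  congr

lemma deg_cycle {a : V} (p : (⊤ : SimpleGraph V).Walk a a) (hp : p.IsCycle) (δ : Finset (Sym2 V))
    (hδ : ∀ e, e ∈ δ ↔ e ∈ p.edges) {x : V} (hx : x ∈ p.support) : degG δ x = 2 := by
  obtain ⟨y, hy⟩ := DD_pred p hp hx
  obtain ⟨z, hz⟩ := DD_succ p hp hx
  have hyz : y ≠ z := by
    rintro rfl
    exact DD_asymm p hp hy hz
  unfold degG
  rw [← Finset.card_pair hyz]
  congr 1
  ext w
  simp only [Finset.mem_filter, Finset.mem_univ, true_and, hδ, DD_edges, Finset.mem_insert,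
    Finset.mem_singleton]
  constructor
  · rintro (h | h)
    · exact Or.inr (DD_inj_right p hp h hz)
    · exact Or.inl (DD_inj_left p hp h hy)
  · rintro (rfl | rfl)
    · exact Or.inr hy
    · exact Or.inl hz

lemma det_MM_cycle (φ : V → V → ℂ) {a : V} (p : (⊤ : SimpleGraph V).Walk a a) (hp : p.IsCycle)
    (δ : Finset (Sym2 V)) (T : Finset V)
    (hδ : ∀ e, e ∈ δ ↔ e ∈ p.edges) (hT : ∀ x, x ∈ T ↔ x ∉ p.support)
    (hφ : ∀ v w, s(v, w) ∈ δ → φ v w * φ w v = 1) :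
    (MM φ δ T).det = 2 - walkHol φ p - (walkHol φ p)⁻¹ := by
  have hinv : ∀ l : List ((⊤ : SimpleGraph V).Dart), (∀ d ∈ l, d ∈ p.darts) →
      (l.map fun d => φ d.toProd.1 d.toProd.2).prod *
        (l.map fun d => φ d.toProd.2 d.toProd.1).prod = 1 := by
    intro l
    induction l with
    | nil => simp
    | cons d l ih =>
      intro h
      have h1 := ih (fun d' hd' => h d' (List.mem_cons_of_mem _ hd'))
      have h2 : φ d.toProd.1 d.toProd.2 * φ d.toProd.2 d.toProd.1 = 1 := by
        apply hφ
        rw [hδ, DD_edges]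
        exact Or.inl ⟨d, h d (by simp), rfl⟩
      simp only [List.map_cons, List.prod_cons]
      linear_combination h2 * (l.map fun d => φ d.toProd.1 d.toProd.2).prod *
        (l.map fun d => φ d.toProd.2 d.toProd.1).prod + h1
  have hw := hinv p.darts (fun d h => h)
  have hfac : MM φ δ T = (1 - WP (fun x y => φ y x) p) * (1 - WP φ p).transpose := by
    ext x y
    have hprod : (WP (fun x y => φ y x) p * (WP φ p).transpose) x y =
        if x = y ∧ x ∈ p.support then 1 else 0 := by
      rw [Matrix.mul_apply]
      simp only [Matrix.transpose_apply, WP_apply _ p hp]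
      by_cases hx : x ∈ p.support
      · obtain ⟨z, hz⟩ := DD_succ p hp hx
        rw [Finset.sum_eq_single z]
        · by_cases hxy : x = y
          · subst hxy
            simp only [hz, if_true, hx, and_self]
            rw [mul_comm]
            exact hφ _ _ ((hδ _).2 ((DD_edges p x z).2 (Or.inl hz)))
          · rw [if_neg (fun h : DD p y z => hxy (DD_inj_left p hp hz h))]
            simp [hxy]
        · intro w _ hw
          rw [if_neg (fun h : DD p x w => hw (DD_inj_right p hp h hz)), zero_mul]
        · simp
      · rw [Finset.sum_eq_zero]
        · simp [hx]
        · intro w _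
          rw [if_neg (fun h : DD p x w => hx (DD_mem p h).1), zero_mul]
    have : (1 - WP (fun x y => φ y x) p) * (1 - WP φ p).transpose =
        1 - WP (fun x y => φ y x) p - (WP φ p).transpose +
          WP (fun x y => φ y x) p * (WP φ p).transpose := by
      simp only [Matrix.transpose_sub, Matrix.transpose_one, mul_sub, sub_mul, mul_one, one_mul]
      abel
    rw [this, Matrix.add_apply, hprod]
    simp only [Matrix.sub_apply, Matrix.transpose_apply, WP_apply _ p hp, MM, Matrix.of_apply, hT,
      hδ, DD_edges, Matrix.one_apply]
    by_cases hxy : x = y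
    · subst hxy
      have : ¬ DD p x x := fun h => DD_ne p h rfl
      by_cases hx : x ∈ p.support
      · simp [this, hx, deg_cycle p hp δ hδ hx]
        norm_num
      · simp [this, hx]
    · by_cases h1 : DD p x y
      · have h2 := DD_asymm p hp h1
        have h3 := DD_mem p h1
        simp [h1, h2, h3, hxy]
      · by_cases h2 : DD p y x
        · have h3 := DD_mem p h2
          simp [h1, h2, h3, hxy]
        · simp [h1, h2, hxy]
  rw [hfac, Matrix.det_mul, Matrix.det_transpose, det_cycle _ p hp, det_cycle _ p hp]
  have e2 : (p.darts.map fun d => φ d.toProd.2 d.toProd.1).prod = (walkHol φ p)⁻¹ :=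
    eq_inv_of_mul_eq_one_right hw
  have e1 : (p.darts.map fun d => φ d.toProd.1 d.toProd.2).prod = walkHol φ p := rfl
  rw [e2, e1] at hw
  rw [e2, e1]
  linear_combination hw


set_option linter.unusedSectionVars false
set_option linter.unusedSimpArgs false
lemma cycleWeight_eq (φ : V → V → ℂ) (δ : Finset (Sym2 V)) (h : IsCycleEdgeSet δ) :
    ∃ (v : V) (p : (⊤ : SimpleGraph V).Walk v v), p.IsCycle ∧ (∀ e, e ∈ δ ↔ e ∈ p.edges) ∧
      cycleWeight φ δ = 2 - walkHol φ p - (walkHol φ p)⁻¹ := by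
  refine ⟨h.choose, h.choose_spec.choose, h.choose_spec.choose_spec.1, ?_, ?_⟩
  · intro e
    have := h.choose_spec.choose_spec.2
    have h2 : e ∈ h.choose_spec.choose.edges.toFinset ↔ e ∈ δ := by rw [this]
    rw [← h2, List.mem_toFinset]
  · unfold cycleWeight
    rw [dif_pos h]

lemma mem_of_deg_eq {δ Γ : Finset (Sym2 V)} (h : δ ⊆ Γ) {x y : V} (hd : degG Γ x ≤ degG δ x)
    (hy : s(x, y) ∈ Γ) : s(x, y) ∈ δ := by
  have h1 : (Finset.univ.filter fun y => s(x, y) ∈ δ) ⊆ (Finset.univ.filter fun y => s(x, y) ∈ Γ) := by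
    intro z hz
    simp only [Finset.mem_filter, Finset.mem_univ, true_and] at hz ⊢
    exact h hz
  have h2 := Finset.eq_of_subset_of_card_le h1 hd
  have : y ∈ (Finset.univ.filter fun y => s(x, y) ∈ Γ) := by simpa using hy
  rw [← h2] at this
  simpa using this

lemma degG_pos {Γ : Finset (Sym2 V)} {x y : V} (h : s(x, y) ∈ Γ) : 0 < degG Γ x := by
  apply Finset.card_pos.2
  exact ⟨y, by simpa using h⟩

lemma degG_mono {δ Γ : Finset (Sym2 V)} (h : δ ⊆ Γ) (x : V) : degG δ x ≤ degG Γ x := by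
  apply Finset.card_le_card
  intro z hz
  simp only [Finset.mem_filter, Finset.mem_univ, true_and] at hz ⊢
  exact h hz

/-- two-regular off `S`, empty on `S` -/
def IsReg (Γ : Finset (Sym2 V)) (S : Finset V) : Prop :=
  ∀ x, degG Γ x = if x ∈ S then 0 else 2

lemma closed_walk {a b : V} (p : (⊤ : SimpleGraph V).Walk a b) (A : V → Prop)
    (h : ∀ x y, s(x, y) ∈ p.edges → (A x ↔ A y)) : ∀ x ∈ p.support, (A a ↔ A x) := by
  induction p with
  | nil => simp
  | cons hh q ih =>
    rename_i u v w
    intro x hx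
    simp only [SimpleGraph.Walk.support_cons, List.mem_cons] at hx
    rcases hx with rfl | hx
    · rfl
    · rw [h u v (by simp)]
      exact ih (fun x y hxy => h x y (by simp [hxy])) x hx

lemma cycle_closed {Γ δ : Finset (Sym2 V)} {S : Finset V} (hreg : IsReg Γ S) (hsub : δ ⊆ Γ)
    {a : V} (p : (⊤ : SimpleGraph V).Walk a a) (hp : p.IsCycle) (hδ : ∀ e, e ∈ δ ↔ e ∈ p.edges)
    {x y : V} (hx : x ∈ p.support) (hxy : s(x, y) ∈ Γ) : s(x, y) ∈ δ := by
  apply mem_of_deg_eq hsub _ hxy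
  rw [deg_cycle p hp δ hδ hx, hreg x]
  split_ifs <;> omega

lemma cycle_sub {Γ δ δ' : Finset (Sym2 V)} {S : Finset V} (hreg : IsReg Γ S) (hsub : δ ⊆ Γ)
    (hsub' : δ' ⊆ Γ) (h : IsCycleEdgeSet δ) (h' : IsCycleEdgeSet δ') {e : Sym2 V} (he : e ∈ δ)
    (he' : e ∈ δ') : δ ⊆ δ' := by
  obtain ⟨a, p, hp, hδ, -⟩ := cycleWeight_eq (fun _ _ => 1) δ h
  obtain ⟨b, q, hq, hδ', -⟩ := cycleWeight_eq (fun _ _ => 1) δ' h'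
  have key := closed_walk p (fun x => x ∈ q.support) (by
    intro x y hxy
    rw [← hδ] at hxy
    constructor
    · intro hx
      have := cycle_closed hreg hsub' q hq hδ' hx (hsub hxy)
      rw [hδ'] at this
      exact q.snd_mem_support_of_mem_edges this
    · intro hx
      have := cycle_closed hreg hsub' q hq hδ' hx (hsub (by rwa [Sym2.eq_swap]))
      rw [hδ'] at this
      exact q.snd_mem_support_of_mem_edges this)
  induction e with
  | _ x y =>
    have hx : x ∈ p.support := p.fst_mem_support_of_mem_edges ((hδ _).1 he)
    have hx' : x ∈ q.support := q.fst_mem_support_of_mem_edges ((hδ' _).1 he')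
    intro f hf
    induction f with
    | _ z w =>
      have hz : z ∈ p.support := p.fst_mem_support_of_mem_edges ((hδ _).1 hf)
      have hz' : z ∈ q.support := (key z hz).1 ((key x hx).2 hx')
      exact cycle_closed hreg hsub' q hq hδ' hz' (hsub hf)

lemma exists_cycle {Γ : Finset (Sym2 V)} {S : Finset V} (hreg : IsReg Γ S)
    (hloop : ∀ x, s(x, x) ∉ Γ) (hne : Γ.Nonempty) : ∃ δ, δ ⊆ Γ ∧ IsCycleEdgeSet δ := by
  obtain ⟨e, he⟩ := hne
  induction e with
  | _ x y =>
  let H := SimpleGraph.fromEdgeSet (Γ : Set (Sym2 V))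
  have hadj : ∀ u v, H.Adj u v ↔ s(u, v) ∈ Γ := by
    intro u v
    simp only [H, SimpleGraph.fromEdgeSet_adj, Finset.mem_coe]
    constructor
    · exact fun h => h.1
    · intro h
      refine ⟨h, ?_⟩
      rintro rfl
      exact hloop _ h
  have hn : ∀ v, (H.neighborSet v).ncard = degG Γ v := by
    intro v
    have : H.neighborSet v = ((Finset.univ.filter fun y => s(v, y) ∈ Γ : Finset V) : Set V) := by
      ext w
      simp [SimpleGraph.mem_neighborSet, hadj]
    rw [this, Set.ncard_coe_finset]
    rfl
  have hcyc : H.IsCycles := by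
    intro v hv
    obtain ⟨w, hw⟩ := hv
    rw [SimpleGraph.mem_neighborSet, hadj] at hw
    rw [hn]
    have := degG_pos hw
    have h2 := hreg v
    split_ifs at h2 <;> omega
  obtain ⟨p, hp, -⟩ := hcyc.exists_cycle_toSubgraph_verts_eq_connectedComponentSupp
    (c := H.connectedComponentMk x) (v := x) rfl ⟨y, by rw [SimpleGraph.mem_neighborSet, hadj]; exact he⟩
  refine ⟨(p.mapLe le_top).edges.toFinset, ?_, ⟨x, p.mapLe le_top, hp.mapLe le_top, rfl⟩⟩
  intro f hf
  rw [List.mem_toFinset, SimpleGraph.Walk.edges_mapLe_eq_edges] at hf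
  have := p.edges_subset_edgeSet hf
  induction f with
  | _ u v =>
    rw [SimpleGraph.mem_edgeSet, hadj] at this
    exact this

lemma cycle_nonempty {δ : Finset (Sym2 V)} (h : IsCycleEdgeSet δ) : δ.Nonempty := by
  obtain ⟨a, p, hp, hδ, -⟩ := cycleWeight_eq (fun _ _ => 1) δ h
  obtain ⟨y, hy⟩ := DD_succ p hp p.start_mem_support
  exact ⟨s(a, y), (hδ _).2 ((DD_edges p a y).2 (Or.inl hy))⟩

lemma reg_det (φ : V → V → ℂ) (n : ℕ) : ∀ (Γ : Finset (Sym2 V)) (S : Finset V), Γ.card = n →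
    (∀ x, s(x, x) ∉ Γ) → (∀ v w, s(v, w) ∈ Γ → φ v w * φ w v = 1) → IsReg Γ S →
    (MM φ Γ S).det = ∏ δ ∈ cyclesOf Γ, cycleWeight φ δ := by
  induction n using Nat.strong_induction_on with
  | _ n ih =>
  intro Γ S hcard hloop hφ hreg
  rcases Γ.eq_empty_or_nonempty with rfl | hne
  · have hS : ∀ x, x ∈ S := by
      intro x
      by_contra hx
      have := hreg x
      simp [degG, hx] at this
    have h1 : MM φ ∅ S = 1 := by
      ext x y
      simp [MM, hS, Matrix.one_apply]
    have h2 : cyclesOf (∅ : Finset (Sym2 V)) = ∅ := by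
      rw [Finset.eq_empty_iff_forall_notMem]
      intro δ hδ
      simp only [cyclesOf, Finset.mem_filter, Finset.mem_powerset] at hδ
      have := cycle_nonempty hδ.2
      rw [Finset.subset_empty.1 hδ.1] at this
      simp at this
    rw [h1, h2]
    simp
  · obtain ⟨δ, hsub, hcyc⟩ := exists_cycle hreg hloop hne
    obtain ⟨a, p, hp, hδ, hwt⟩ := cycleWeight_eq φ δ hcyc
    set K : Finset V := Finset.univ.filter (fun x => x ∈ p.support) with hK
    set T : Finset V := Finset.univ.filter (fun x => x ∉ p.support) with hT
    have mK : ∀ x, x ∈ K ↔ x ∈ p.support := by simp [hK]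
    have mT : ∀ x, x ∈ T ↔ x ∉ p.support := by simp [hT]
    have hcl : ∀ x y, x ∈ p.support → s(x, y) ∈ Γ → s(x, y) ∈ δ := fun x y hx hxy =>
      cycle_closed hreg hsub p hp hδ hx hxy
    have hin1 : ∀ x y, s(x, y) ∈ δ → x ∈ p.support := fun x y h =>
      p.fst_mem_support_of_mem_edges ((hδ _).1 h)
    have hin2 : ∀ x y, s(x, y) ∈ δ → y ∈ p.support := fun x y h =>
      p.snd_mem_support_of_mem_edges ((hδ _).1 h)
    have hKS : ∀ x, x ∈ p.support → x ∉ S := by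
      intro x hx hxS
      have h1 := hreg x
      rw [if_pos hxS] at h1
      have h2 := degG_mono hsub x
      rw [deg_cycle p hp δ hδ hx] at h2
      omega
    have hd1 : ∀ x, x ∉ p.support → degG (Γ \ δ) x = degG Γ x := by
      intro x hx
      unfold degG
      congr 1
      ext y
      simp only [Finset.mem_filter, Finset.mem_univ, true_and, Finset.mem_sdiff]
      exact ⟨fun h => h.1, fun h => ⟨h, fun h' => hx (hin1 x y h')⟩⟩
    have hd2 : ∀ x, x ∈ p.support → degG (Γ \ δ) x = 0 := by
      intro x hx
      unfold degG
      rw [Finset.card_eq_zero, Finset.eq_empty_iff_forall_notMem]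
      intro y
      simp only [Finset.mem_filter, Finset.mem_univ, true_and, Finset.mem_sdiff]
      exact fun h => h.2 (hcl x y hx h.1)
    have hd3 : ∀ x, x ∈ p.support → degG Γ x = degG δ x := by
      intro x hx
      rw [deg_cycle p hp δ hδ hx, hreg, if_neg (hKS x hx)]
    have hfac : MM φ Γ S = MM φ δ T * MM φ (Γ \ δ) (S ∪ K) := by
      ext x z
      rw [Matrix.mul_apply]
      by_cases hx : x ∈ p.support
      · have hterm : ∀ y, MM φ δ T x y * MM φ (Γ \ δ) (S ∪ K) y z =
            if y = z then MM φ δ T x z else 0 := by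
          intro y
          by_cases hy : y ∈ p.support
          · have : MM φ (Γ \ δ) (S ∪ K) y z = if y = z then 1 else 0 := by
              simp [MM, mK, hy]
            rw [this]
            by_cases hyz : y = z
            · simp [hyz]
            · simp [hyz]
          · have hxy : x ≠ y := fun e => hy (e ▸ hx)
            have : MM φ δ T x y = 0 := by
              simp [MM, mT, hy, hxy]
            rw [this, zero_mul]
            by_cases hyz : y = z
            · subst hyz
              simp [this]
            · simp [hyz]
        rw [Finset.sum_congr rfl (fun y _ => hterm y)]
        rw [Finset.sum_ite_eq' Finset.univ z]
        simp only [Finset.mem_univ, if_true]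
        by_cases hz : z ∈ p.support
        · have he : s(x, z) ∈ Γ ↔ s(x, z) ∈ δ := ⟨hcl x z hx, fun h => hsub h⟩
          simp only [MM, Matrix.of_apply, mT, hKS x hx, hKS z hz, hx, hz, not_true, or_self, if_false,
            hd3 x hx, he]
        · have hxz : x ≠ z := fun e => hz (e ▸ hx)
          have he : s(x, z) ∉ Γ := fun h => hz (hin2 x z (hcl x z hx h))
          simp [MM, mT, hz, hxz, he]
      · have hterm : ∀ y, MM φ δ T x y = if x = y then 1 else 0 := by
          intro y
          simp [MM, mT, hx]
        simp only [hterm, ite_mul, one_mul, zero_mul, Finset.sum_ite_eq, Finset.mem_univ, if_true]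
        by_cases hz : z ∈ p.support
        · have hxz : x ≠ z := fun e => hx (e ▸ hz)
          have he : s(x, z) ∉ Γ := by
            rw [Sym2.eq_swap]
            exact fun h => hx (hin2 z x (hcl z x hz h))
          simp [MM, mK, hz, hxz, he]
        · have he : s(x, z) ∈ Γ \ δ ↔ s(x, z) ∈ Γ := by
            rw [Finset.mem_sdiff]
            exact ⟨fun h => h.1, fun h => ⟨h, fun h' => hx (hin1 x z h')⟩⟩
          simp only [MM, Matrix.of_apply, Finset.mem_union, mK, hx, hz, or_false, hd1 x hx, he]
    have hcn := cycle_nonempty hcyc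
    have hlt : (Γ \ δ).card < n := by
      rw [← hcard]
      apply Finset.card_lt_card
      refine ⟨Finset.sdiff_subset, fun h => ?_⟩
      obtain ⟨e, he⟩ := hcn
      have := h (hsub he)
      rw [Finset.mem_sdiff] at this
      exact this.2 he
    have hreg' : IsReg (Γ \ δ) (S ∪ K) := by
      intro x
      by_cases hx : x ∈ p.support
      · rw [hd2 x hx, if_pos (by simp [mK, hx])]
      · rw [hd1 x hx, hreg x]
        simp [mK, hx]
    have hrec := ih _ hlt (Γ \ δ) (S ∪ K) rfl (fun x h => hloop x (Finset.mem_sdiff.1 h).1)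
      (fun v w h => hφ v w (Finset.mem_sdiff.1 h).1) hreg'
    have hcy : cyclesOf Γ = insert δ (cyclesOf (Γ \ δ)) := by
      ext δ'
      simp only [cyclesOf, Finset.mem_filter, Finset.mem_powerset, Finset.mem_insert]
      constructor
      · rintro ⟨h1, h2⟩
        by_cases hdis : ∃ e ∈ δ', e ∈ δ
        · obtain ⟨e, he', he⟩ := hdis
          left
          exact Finset.Subset.antisymm (cycle_sub hreg h1 hsub h2 hcyc he' he)
            (cycle_sub hreg hsub h1 hcyc h2 he he')
        · right
          refine ⟨fun e he => Finset.mem_sdiff.2 ⟨h1 he, fun h => hdis ⟨e, he, h⟩⟩, h2⟩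
      · rintro (rfl | ⟨h1, h2⟩)
        · exact ⟨hsub, hcyc⟩
        · exact ⟨h1.trans Finset.sdiff_subset, h2⟩
    have hni : δ ∉ cyclesOf (Γ \ δ) := by
      simp only [cyclesOf, Finset.mem_filter, Finset.mem_powerset]
      rintro ⟨h, -⟩
      obtain ⟨e, he⟩ := hcn
      exact (Finset.mem_sdiff.1 (h he)).2 he
    rw [hcy, Finset.prod_insert hni, hfac, Matrix.det_mul, hrec, hwt]
    rw [det_MM_cycle φ p hp δ T hδ mT (fun v w h => hφ v w (hsub h))]


set_option linter.unusedSectionVars false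
set_option linter.unusedSimpArgs false
/-- edges inside `A` -/
def EA (Γ : Finset (Sym2 V)) (A : Finset V) : Finset (Sym2 V) := Γ.filter fun e => ∀ v ∈ e, v ∈ A

lemma mem_EA (Γ : Finset (Sym2 V)) (A : Finset V) (x y : V) :
    s(x, y) ∈ EA Γ A ↔ s(x, y) ∈ Γ ∧ x ∈ A ∧ y ∈ A := by
  simp [EA]

def Closed (Γ : Finset (Sym2 V)) (A : Finset V) : Prop := ∀ x y, s(x, y) ∈ Γ → (x ∈ A ↔ y ∈ A)

def PP (Γ : Finset (Sym2 V)) (S : Finset V) : Prop :=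
  ∀ A : Finset V, Closed Γ A → (EA Γ A).card + (A ∩ S).card = A.card

lemma handshake (Γ : Finset (Sym2 V)) (hloop : ∀ x, s(x, x) ∉ Γ) :
    ∑ x, degG Γ x = 2 * Γ.card := by
  have h := (SimpleGraph.fromEdgeSet (Γ : Set (Sym2 V))).sum_degrees_eq_twice_card_edges
  have h1 : ∀ [Fintype (SimpleGraph.fromEdgeSet (Γ : Set (Sym2 V))).edgeSet],
      (SimpleGraph.fromEdgeSet (Γ : Set (Sym2 V))).edgeFinset = Γ := by
    intro _
    ext e
    induction e with
    | _ x y =>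
      simp only [SimpleGraph.mem_edgeFinset, SimpleGraph.mem_edgeSet, SimpleGraph.fromEdgeSet_adj,
        Finset.mem_coe]
      refine ⟨fun h => h.1, fun h => ⟨h, ?_⟩⟩
      rintro rfl
      exact hloop _ h
  have h2 := congrArg (fun t : Finset (Sym2 V) => 2 * t.card) (@h1 (SimpleGraph.fintypeEdgeSet _))
  refine Eq.trans ?_ ((h.trans ?_).trans h2)
  swap
  · simp only []
  refine Finset.sum_congr rfl fun x _ => ?_
  unfold degG
  rw [← SimpleGraph.card_neighborFinset_eq_degree]
  congr 1
  ext y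
  simp only [Finset.mem_filter, Finset.mem_univ, true_and, SimpleGraph.mem_neighborFinset,
    SimpleGraph.fromEdgeSet_adj, Finset.mem_coe]
  refine ⟨fun h => ⟨h, ?_⟩, fun h => h.1⟩
  rintro rfl
  exact hloop _ h

lemma PP_of_reg {Γ : Finset (Sym2 V)} {S : Finset V} (hreg : IsReg Γ S)
    (hloop : ∀ x, s(x, x) ∉ Γ) : PP Γ S := by
  intro A hA
  have h := handshake (EA Γ A) (fun x hx => hloop x ((mem_EA Γ A x x).1 hx).1)
  have h1 : ∀ x, degG (EA Γ A) x = if x ∈ A \ S then 2 else 0 := by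
    intro x
    by_cases hx : x ∈ A
    · have : degG (EA Γ A) x = degG Γ x := by
        unfold degG
        congr 1
        ext y
        simp only [Finset.mem_filter, Finset.mem_univ, true_and, mem_EA]
        exact ⟨fun h => h.1, fun h => ⟨h, hx, (hA x y h).1 hx⟩⟩
      rw [this, hreg x]
      by_cases hS : x ∈ S <;> simp [hx, hS]
    · have : degG (EA Γ A) x = 0 := by
        unfold degG
        rw [Finset.card_eq_zero, Finset.eq_empty_iff_forall_notMem]
        intro y
        simp only [Finset.mem_filter, Finset.mem_univ, true_and, mem_EA]
        exact fun h => hx h.2.1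
      rw [this]
      simp [hx]
  rw [Finset.sum_congr rfl (fun x _ => h1 x), ← Finset.sum_filter, Finset.sum_const,
    Finset.filter_mem_eq_inter, Finset.univ_inter] at h
  have := Finset.card_sdiff_add_card_inter A S
  simp only [smul_eq_mul] at h
  omega

lemma tm_apply (i j : V) (r : ℂ) (M : Matrix V V ℂ) (x y : V) :
    (Matrix.transvection i j r * M) x y = M x y + if x = i then r * M j y else 0 := by
  by_cases h : x = i
  · subst h; simp
  · simp [h]

lemma mt_apply (i j : V) (r : ℂ) (M : Matrix V V ℂ) (x y : V) :
    (M * Matrix.transvection i j r) x y = M x y + if y = j then r * M x i else 0 := by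
  by_cases h : y = j
  · subst h; simp
  · simp [h]

lemma leaf_count {Γ : Finset (Sym2 V)} {S : Finset V} {u v : V}
    (hv : v ∉ S) (huv : u ≠ v) (hnb : ∀ y, s(v, y) ∈ Γ ↔ y = u) {A B : Finset V}
    (hB : u ∈ B ↔ v ∈ B) (hAB : ∀ x, x ≠ v → (x ∈ A ↔ x ∈ B)) :
    (EA Γ B).card + (B ∩ S).card = B.card ↔
      (EA (Γ.erase s(v, u)) A).card + (A ∩ insert v S).card = A.card := by
  have hnb' : ∀ y, s(y, v) ∈ Γ ↔ y = u := fun y => by rw [Sym2.eq_swap, hnb]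
  have he : A.erase v = B.erase v := by
    ext x
    simp only [Finset.mem_erase]
    constructor
    · rintro ⟨h1, h2⟩; exact ⟨h1, (hAB x h1).1 h2⟩
    · rintro ⟨h1, h2⟩; exact ⟨h1, (hAB x h1).2 h2⟩
  have hi : A ∩ S = B ∩ S := by
    ext x
    simp only [Finset.mem_inter]
    constructor
    · rintro ⟨h1, h2⟩
      have : x ≠ v := fun e => hv (e ▸ h2)
      exact ⟨(hAB x this).1 h1, h2⟩
    · rintro ⟨h1, h2⟩
      have : x ≠ v := fun e => hv (e ▸ h2)
      exact ⟨(hAB x this).2 h1, h2⟩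
  have hmem : ∀ f, f ∈ EA (Γ.erase s(v, u)) A ↔ f ∈ EA Γ B ∧ f ≠ s(v, u) := by
    intro f
    induction f with
    | _ x y =>
      simp only [mem_EA, Finset.mem_erase]
      by_cases hf : s(x, y) = s(v, u)
      · simp [hf]
      by_cases hg : s(x, y) ∈ Γ
      · have hx : x ≠ v := by
          rintro rfl
          rw [hnb] at hg
          exact hf (by rw [hg])
        have hy : y ≠ v := by
          rintro rfl
          rw [hnb'] at hg
          exact hf (by rw [hg, Sym2.eq_swap])
        rw [hAB x hx, hAB y hy]
        tauto
      · tauto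
  have c1 : (EA Γ B).card = (EA (Γ.erase s(v, u)) A).card + if v ∈ B then 1 else 0 := by
    have : EA (Γ.erase s(v, u)) A = (EA Γ B).erase s(v, u) := by
      ext f
      rw [hmem, Finset.mem_erase]
      tauto
    rw [this]
    by_cases hvB : v ∈ B
    · have : s(v, u) ∈ EA Γ B := (mem_EA _ _ _ _).2 ⟨(hnb u).2 rfl, hvB, hB.2 hvB⟩
      rw [if_pos hvB, Finset.card_erase_add_one this]
    · have : s(v, u) ∉ EA Γ B := fun h => hvB ((mem_EA _ _ _ _).1 h).2.1
      rw [if_neg hvB, Finset.erase_eq_of_notMem this]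
      rfl
  have c2 : ∀ X : Finset V, X.card = (X.erase v).card + if v ∈ X then 1 else 0 := by
    intro X
    by_cases h : v ∈ X
    · rw [if_pos h, Finset.card_erase_add_one h]
    · rw [if_neg h, Finset.erase_eq_of_notMem h]
      rfl
  have c3 : (A ∩ insert v S).card = (B ∩ S).card + if v ∈ A then 1 else 0 := by
    by_cases h : v ∈ A
    · rw [Finset.inter_insert_of_mem h, if_pos h, Finset.card_insert_of_notMem (by simp [hv]), hi]
    · rw [Finset.inter_insert_of_notMem h, if_neg h, hi]
      rfl
  have hcA := c2 A
  have hcB := c2 B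
  rw [he] at hcA
  rw [c1, c3]
  omega

lemma leaf_PP {Γ : Finset (Sym2 V)} {S : Finset V} {u v : V}
    (hv : v ∉ S) (huv : u ≠ v) (hnb : ∀ y, s(v, y) ∈ Γ ↔ y = u) :
    PP Γ S ↔ PP (Γ.erase s(v, u)) (insert v S) := by
  have hnb' : ∀ y, s(y, v) ∈ Γ ↔ y = u := fun y => by rw [Sym2.eq_swap, hnb]
  constructor
  · intro h A hA
    have hcl : ∀ B : Finset V, (u ∈ B ↔ v ∈ B) → (∀ x, x ≠ v → (x ∈ A ↔ x ∈ B)) → Closed Γ B := by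
      intro B hB hAB x y hxy
      by_cases hx : x = v
      · subst hx
        rw [hnb] at hxy
        rw [hxy]
        exact hB.symm
      by_cases hy : y = v
      · subst hy
        rw [hnb'] at hxy
        rw [hxy]
        exact hB
      rw [← hAB x hx, ← hAB y hy]
      apply hA
      rw [Finset.mem_erase]
      refine ⟨?_, hxy⟩
      rw [Ne, Sym2.eq_iff]
      tauto
    by_cases hu : u ∈ A
    · have h1 : u ∈ insert v A ↔ v ∈ insert v A := by simp [hu]
      have h2 : ∀ x, x ≠ v → (x ∈ A ↔ x ∈ insert v A) := by
        intro x hx; simp [hx]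
      exact (leaf_count hv huv hnb h1 h2).1 (h _ (hcl _ h1 h2))
    · have h1 : u ∈ A.erase v ↔ v ∈ A.erase v := by simp [hu]
      have h2 : ∀ x, x ≠ v → (x ∈ A ↔ x ∈ A.erase v) := by
        intro x hx; simp [hx]
      exact (leaf_count hv huv hnb h1 h2).1 (h _ (hcl _ h1 h2))
  · intro h A hA
    exact (leaf_count hv huv hnb (hA v u ((hnb u).2 rfl)).symm (fun _ _ => Iff.rfl)).2
      (h A (fun x y hxy => hA x y (Finset.mem_of_mem_erase hxy)))

lemma leaf_cycles {Γ : Finset (Sym2 V)} {u v : V} (hd : degG Γ v = 1) :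
    cyclesOf Γ = cyclesOf (Γ.erase s(v, u)) := by
  ext δ
  simp only [cyclesOf, Finset.mem_filter, Finset.mem_powerset]
  constructor
  · rintro ⟨h1, h2⟩
    refine ⟨fun e he => Finset.mem_erase.2 ⟨?_, h1 he⟩, h2⟩
    rintro rfl
    obtain ⟨a, p, hp, hδ, -⟩ := cycleWeight_eq (fun _ _ => 1) δ h2
    have h3 := deg_cycle p hp δ hδ (p.fst_mem_support_of_mem_edges ((hδ _).1 he))
    have h4 := degG_mono h1 v
    omega
  · rintro ⟨h1, h2⟩
    exact ⟨h1.trans (Finset.erase_subset _ _), h2⟩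

lemma leaf_det (φ : V → V → ℂ) {Γ : Finset (Sym2 V)} {S : Finset V} {u v : V}
    (hφ : φ u v * φ v u = 1)
    (hv : v ∉ S) (huv : u ≠ v) (hnb : ∀ y, s(v, y) ∈ Γ ↔ y = u) (hd : degG Γ v = 1) :
    (MM φ Γ S).det = (MM φ (Γ.erase s(v, u)) (insert v S)).det := by
  have hnb' : ∀ y, s(y, v) ∈ Γ ↔ y = u := fun y => by rw [Sym2.eq_swap, hnb]
  have hmem : ∀ x y, x ≠ v → y ≠ v → (s(x, y) ∈ Γ.erase s(v, u) ↔ s(x, y) ∈ Γ) := by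
    intro x y hx hy
    rw [Finset.mem_erase, Ne, Sym2.eq_iff]
    tauto
  have hdeg : ∀ x, x ≠ v → x ≠ u → degG (Γ.erase s(v, u)) x = degG Γ x := by
    intro x hx hxu
    unfold degG
    congr 1
    ext y
    simp only [Finset.mem_filter, Finset.mem_univ, true_and, Finset.mem_erase, Ne, Sym2.eq_iff]
    tauto
  have hdegu : degG Γ u = degG (Γ.erase s(v, u)) u + 1 := by
    unfold degG
    have hin : v ∈ Finset.univ.filter (fun y => s(u, y) ∈ Γ) := by simp [hnb']
    rw [← Finset.card_erase_add_one hin]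
    congr 2
    ext y
    simp only [Finset.mem_filter, Finset.mem_univ, true_and, Finset.mem_erase, Ne, Sym2.eq_iff]
    tauto
  have r1 : ∀ y, MM φ (Γ.erase s(v, u)) (insert v S) v y = if v = y then 1 else 0 := by
    intro y; simp [MM]
  have r2 : ∀ x, MM φ (Γ.erase s(v, u)) (insert v S) x v = if x = v then 1 else 0 := by
    intro y; simp [MM]
  have r3 : ∀ x y, x ≠ v → y ≠ v → ¬ (x = u ∧ y = u) →
      MM φ Γ S x y = MM φ (Γ.erase s(v, u)) (insert v S) x y := by
    intro x y hx hy hxy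
    simp only [MM, Matrix.of_apply, Finset.mem_insert, hx, hy, false_or, hmem x y hx hy]
    by_cases e : x = y
    · subst e
      have : x ≠ u := fun h => hxy ⟨h, h⟩
      rw [hdeg x hx this]
    · simp [e]
  have r4 : MM φ Γ S v v = 1 := by simp [MM, hv, hd]
  have r5 : ∀ y, y ≠ v → MM φ Γ S v y = if y = u ∧ u ∉ S then - φ u v else 0 := by
    intro y hy
    simp only [MM, Matrix.of_apply, hv, false_or, Ne.symm hy, if_false, hnb]
    by_cases e : y = u
    · subst e
      by_cases h : y ∈ S <;> simp [h]
    · simp [e]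
  have r6 : ∀ x, x ≠ v → MM φ Γ S x v = if x = u ∧ u ∉ S then - φ v u else 0 := by
    intro x hx
    simp only [MM, Matrix.of_apply, hv, or_false, hx, if_false, hnb']
    by_cases e : x = u
    · subst e
      by_cases h : x ∈ S <;> simp [h]
    · simp [e]
  by_cases hu : u ∈ S
  · congr 1
    ext x y
    by_cases hx : x = v
    · subst hx
      rw [r1]
      by_cases hy : y = x
      · subst hy; simp [r4]
      · rw [r5 y hy]; simp [hu, Ne.symm hy]
    by_cases hy : y = v
    · subst hy
      rw [r2, r6 x hx]; simp [hu, hx]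
    by_cases h : x = u ∧ y = u
    · obtain ⟨rfl, rfl⟩ := h
      simp [MM, hu]
    · exact r3 x y hx hy h
  · have hfac : MM φ Γ S = Matrix.transvection u v (- φ v u) *
        (MM φ (Γ.erase s(v, u)) (insert v S) * Matrix.transvection v u (- φ u v)) := by
      ext x y
      rw [tm_apply, mt_apply, mt_apply, r1, r1, r2]
      by_cases hx : x = v
      · subst hx
        rw [r1]
        by_cases hy : y = x
        · subst hy; simp [r4, huv.symm]
        · rw [r5 y hy]
          by_cases hyu : y = u <;> simp [hu, Ne.symm hy, hyu, huv.symm]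
      by_cases hy : y = v
      · subst hy
        rw [r2, r6 x hx]; simp [hu, hx, huv.symm]
      by_cases h : x = u ∧ y = u
      · obtain ⟨rfl, rfl⟩ := h
        have e1 : MM φ Γ S y y = degG Γ y := by simp [MM, hu]
        have e2 : MM φ (Γ.erase s(v, y)) (insert v S) y y = degG (Γ.erase s(v, y)) y := by
          simp [MM, hu, hx]
        rw [e1, e2, hdegu]
        simp [hx, Ne.symm hx]
        linear_combination -hφ
      · rw [r3 x y hx hy h]
        by_cases hxu : x = u
        · have hyu : y ≠ u := fun e => h ⟨hxu, e⟩
          simp [hx, Ne.symm hy, hyu]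
        · simp [hx, hxu]
    rw [hfac, Matrix.det_mul, Matrix.det_mul, Matrix.det_transvection_of_ne _ _ huv,
      Matrix.det_transvection_of_ne _ _ huv.symm, one_mul, mul_one]

lemma key_det (φ : V → V → ℂ) (n : ℕ) : ∀ (Γ : Finset (Sym2 V)) (S : Finset V), Γ.card = n →
    (∀ x, s(x, x) ∉ Γ) → (∀ v w, s(v, w) ∈ Γ → φ v w * φ w v = 1) →
    Γ.card + S.card = Fintype.card V →
    (MM φ Γ S).det = if PP Γ S then ∏ δ ∈ cyclesOf Γ, cycleWeight φ δ else 0 := by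
  induction n using Nat.strong_induction_on with
  | _ n ih =>
  intro Γ S hcard hloop hφ hsum
  by_cases h0 : ∃ v, v ∉ S ∧ degG Γ v = 0
  · obtain ⟨v, hv, hd⟩ := h0
    have hno : ∀ y, s(v, y) ∉ Γ := fun y hy => by
      have := degG_pos hy
      omega
    have hno' : ∀ y, s(y, v) ∉ Γ := fun y hy => hno y (by rwa [Sym2.eq_swap])
    rw [if_neg]
    · apply Matrix.det_eq_zero_of_row_eq_zero v
      intro y
      by_cases hy : v = y
      · subst hy
        simp [MM, hv, hd]
      · simp [MM, hy, hno]
    · intro hP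
      have := hP {v} (by
        intro x y hxy
        simp only [Finset.mem_singleton]
        constructor
        · rintro rfl; exact absurd hxy (hno _)
        · rintro rfl; exact absurd hxy (hno' _))
      have e1 : EA Γ {v} = ∅ := by
        rw [Finset.eq_empty_iff_forall_notMem]
        intro e
        induction e with
        | _ x y =>
          rw [mem_EA]
          rintro ⟨h1, h2, -⟩
          rw [Finset.mem_singleton] at h2
          subst h2
          exact hno _ h1
      rw [e1, Finset.singleton_inter_of_notMem hv] at this
      simp at this
  by_cases h1 : ∃ v, v ∉ S ∧ degG Γ v = 1
  · obtain ⟨v, hv, hd⟩ := h1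
    have hd' := hd
    unfold degG at hd'
    rw [Finset.card_eq_one] at hd'
    obtain ⟨u, hu⟩ := hd'
    have hnb : ∀ y, s(v, y) ∈ Γ ↔ y = u := by
      intro y
      have : y ∈ Finset.univ.filter (fun y => s(v, y) ∈ Γ) ↔ y ∈ ({u} : Finset V) := by rw [hu]
      simpa using this
    have he : s(v, u) ∈ Γ := (hnb u).2 rfl
    have huv : u ≠ v := by
      rintro rfl
      exact hloop _ he
    have hce := Finset.card_erase_add_one he
    have hrec := ih (Γ.erase s(v, u)).card (by omega) (Γ.erase s(v, u)) (insert v S) rfl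
      (fun x h => hloop x (Finset.mem_of_mem_erase h))
      (fun x y h => hφ x y (Finset.mem_of_mem_erase h))
      (by rw [Finset.card_insert_of_notMem hv]; omega)
    rw [leaf_det φ (by rw [mul_comm]; exact hφ _ _ he) hv huv hnb hd, hrec, ← leaf_cycles hd]
    simp only [leaf_PP hv huv hnb]
  · push Not at h0 h1
    have hge : ∀ x, (if x ∈ S then 0 else 2) ≤ degG Γ x := by
      intro x
      by_cases hx : x ∈ S
      · simp [hx]
      · have a := h0 x hx
        have b := h1 x hx
        simp only [hx, if_false]
        omega
    have hs : ∑ x : V, (if x ∈ S then 0 else 2) = 2 * Γ.card := by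
      have e : ∀ x : V, (if x ∈ S then 0 else 2) = if x ∈ Sᶜ then 2 else 0 := by
        intro x
        by_cases hx : x ∈ S <;> simp [hx]
      rw [Finset.sum_congr rfl (fun x _ => e x), ← Finset.sum_filter, Finset.sum_const,
        Finset.filter_mem_eq_inter, Finset.univ_inter, Finset.card_compl]
      simp only [smul_eq_mul]
      omega
    have hreg : IsReg Γ S := by
      have := (Finset.sum_eq_sum_iff_of_le (fun x _ => hge x)).1 (hs.trans (handshake Γ hloop).symm)
      intro x
      exact (this x (Finset.mem_univ x)).symm
    rw [if_pos (PP_of_reg hreg hloop)]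
    exact reg_det φ _ Γ S rfl hloop hφ hreg


set_option linter.unusedSectionVars false
set_option linter.unusedSimpArgs false
lemma reach_closed {Γ : Finset (Sym2 V)} {A : Finset V} (hA : Closed Γ A) {x y : V}
    (h : (SimpleGraph.fromEdgeSet (Γ : Set (Sym2 V))).Reachable x y) : x ∈ A ↔ y ∈ A := by
  obtain ⟨p⟩ := h
  induction p with
  | nil => rfl
  | cons hh q ih =>
    rw [← ih]
    apply hA
    rw [SimpleGraph.fromEdgeSet_adj] at hh
    exact hh.1

lemma comp_bound (Γ : Finset (Sym2 V))
    (C : (SimpleGraph.fromEdgeSet (Γ : Set (Sym2 V))).ConnectedComponent) (K : Finset V)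
    (hK : ∀ x, x ∈ K ↔ x ∈ C.supp) : K.card ≤ (EA Γ K).card + 1 := by
  have h := C.connected_toSimpleGraph.card_vert_le_card_edgeSet_add_one
  have h1 : Nat.card C = K.card := by
    have e : C ≃ {x // x ∈ K} := Equiv.subtypeEquivRight (fun x => (hK x).symm)
    rw [Nat.card_congr e, Nat.card_eq_fintype_card, Fintype.card_coe]
  have h2 : Nat.card C.toSimpleGraph.edgeSet ≤ (EA Γ K).card := by
    rw [← Fintype.card_coe (EA Γ K), ← Nat.card_eq_fintype_card]
    have key : ∀ e : Sym2 C, e ∈ C.toSimpleGraph.edgeSet →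
        Sym2.map (fun x : C => (x : V)) e ∈ EA Γ K := by
      intro e
      induction e with
      | _ x y =>
        intro he
        rw [SimpleGraph.mem_edgeSet] at he
        rw [Sym2.map_mk, mem_EA]
        have he' : (SimpleGraph.fromEdgeSet (Γ : Set (Sym2 V))).Adj x y := he
        rw [SimpleGraph.fromEdgeSet_adj] at he'
        exact ⟨he'.1, (hK _).2 x.2, (hK _).2 y.2⟩
    refine Nat.card_le_card_of_injective (fun e => ⟨_, key e.1 e.2⟩) ?_
    intro e f hef
    have := congrArg Subtype.val hef
    exact Subtype.ext (Sym2.map.injective Subtype.val_injective this)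
  omega

lemma essential_iff (G : SimpleGraph V) (S : Finset V) (Γ : Finset (Sym2 V))
    (hsub : (Γ : Set (Sym2 V)) ⊆ G.edgeSet) : IsEssentialCRSF G S Γ ↔ PP Γ S := by
  have hfil : ∀ C : (SimpleGraph.fromEdgeSet (Γ : Set (Sym2 V))).ConnectedComponent,
      (Γ.filter fun e => ∀ v ∈ e, v ∈ C.supp) = EA Γ C.supp.toFinite.toFinset := by
    intro C
    ext e
    simp [EA]
  unfold IsEssentialCRSF
  simp only [hfil]
  constructor
  · rintro ⟨-, h⟩ A hA
    have hC : ∀ C : (SimpleGraph.fromEdgeSet (Γ : Set (Sym2 V))).ConnectedComponent,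
        (EA Γ C.supp.toFinite.toFinset).card + (C.supp.toFinite.toFinset ∩ S).card =
          C.supp.toFinite.toFinset.card := by
      intro C
      rcases h C with ⟨h1, h2⟩ | ⟨h1, h2⟩
      · rw [h2, h1]; rfl
      · rw [h2, h1]
    set I := A.image (SimpleGraph.fromEdgeSet (Γ : Set (Sym2 V))).connectedComponentMk with hI
    have hmk : ∀ x C, x ∈ C.supp.toFinite.toFinset ↔
        (SimpleGraph.fromEdgeSet (Γ : Set (Sym2 V))).connectedComponentMk x = C := by
      intro x C
      simp
    have hin : ∀ C ∈ I, ∀ x ∈ C.supp.toFinite.toFinset, x ∈ A := by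
      intro C hCI x hx
      rw [hI, Finset.mem_image] at hCI
      obtain ⟨y, hy, rfl⟩ := hCI
      rw [hmk, SimpleGraph.ConnectedComponent.eq] at hx
      exact (reach_closed hA hx).2 hy
    have hadj : ∀ x y, s(x, y) ∈ Γ →
        (SimpleGraph.fromEdgeSet (Γ : Set (Sym2 V))).connectedComponentMk x =
        (SimpleGraph.fromEdgeSet (Γ : Set (Sym2 V))).connectedComponentMk y := by
      intro x y hxy
      by_cases e : x = y
      · rw [e]
      · rw [SimpleGraph.ConnectedComponent.eq]
        exact SimpleGraph.Adj.reachable ((SimpleGraph.fromEdgeSet_adj _).2 ⟨hxy, e⟩)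
    have e1 : A = I.biUnion (fun C => C.supp.toFinite.toFinset) := by
      ext x
      rw [Finset.mem_biUnion]
      constructor
      · intro hx
        exact ⟨_, Finset.mem_image_of_mem _ hx, (hmk _ _).2 rfl⟩
      · rintro ⟨C, hC, hx⟩
        exact hin C hC x hx
    have e2 : A ∩ S = I.biUnion (fun C => C.supp.toFinite.toFinset ∩ S) := by
      ext x
      rw [Finset.mem_biUnion]
      constructor
      · intro hx
        rw [Finset.mem_inter] at hx
        exact ⟨_, Finset.mem_image_of_mem _ hx.1, Finset.mem_inter.2 ⟨(hmk _ _).2 rfl, hx.2⟩⟩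
      · rintro ⟨C, hC, hx⟩
        rw [Finset.mem_inter] at hx
        exact Finset.mem_inter.2 ⟨hin C hC x hx.1, hx.2⟩
    have e3 : EA Γ A = I.biUnion (fun C => EA Γ C.supp.toFinite.toFinset) := by
      ext e
      induction e with
      | _ x y =>
        simp only [Finset.mem_biUnion, mem_EA]
        constructor
        · rintro ⟨h1, h2, h3⟩
          exact ⟨_, Finset.mem_image_of_mem _ h2, h1, (hmk _ _).2 rfl,
            (hmk _ _).2 (hadj x y h1).symm⟩
        · rintro ⟨C, hC, h1, h2, h3⟩
          exact ⟨h1, hin C hC x h2, hin C hC y h3⟩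
    have c1 : A.card = ∑ C ∈ I, C.supp.toFinite.toFinset.card := by
      conv_lhs => rw [e1]
      apply Finset.card_biUnion
      intro C _ D _ hCD
      rw [Function.onFun, Finset.disjoint_left]
      intro x hx hx'
      rw [hmk] at hx hx'
      exact hCD (hx.symm.trans hx')
    have c2 : (A ∩ S).card = ∑ C ∈ I, (C.supp.toFinite.toFinset ∩ S).card := by
      rw [e2]
      apply Finset.card_biUnion
      intro C _ D _ hCD
      rw [Function.onFun, Finset.disjoint_left]
      intro x hx hx'
      rw [Finset.mem_inter, hmk] at hx hx'
      exact hCD (hx.1.symm.trans hx'.1)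
    have c3 : (EA Γ A).card = ∑ C ∈ I, (EA Γ C.supp.toFinite.toFinset).card := by
      rw [e3]
      apply Finset.card_biUnion
      intro C _ D _ hCD
      rw [Function.onFun, Finset.disjoint_left]
      intro e he he'
      induction e with
      | _ x y =>
        rw [mem_EA, hmk] at he he'
        exact hCD (he.2.1.symm.trans he'.2.1)
    rw [c1, c2, c3, ← Finset.sum_add_distrib]
    exact Finset.sum_congr rfl fun C _ => hC C
  · intro h
    refine ⟨hsub, fun C => ?_⟩
    have h1 := h C.supp.toFinite.toFinset (by
      intro x y hxy
      simp only [Set.Finite.mem_toFinset, SimpleGraph.ConnectedComponent.mem_supp_iff]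
      by_cases e : x = y
      · rw [e]
      · have : (SimpleGraph.fromEdgeSet (Γ : Set (Sym2 V))).connectedComponentMk x =
          (SimpleGraph.fromEdgeSet (Γ : Set (Sym2 V))).connectedComponentMk y := by
          rw [SimpleGraph.ConnectedComponent.eq]
          exact SimpleGraph.Adj.reachable ((SimpleGraph.fromEdgeSet_adj _).2 ⟨hxy, e⟩)
        rw [this])
    have h2 := comp_bound Γ C C.supp.toFinite.toFinset (by simp)
    by_cases h3 : (C.supp.toFinite.toFinset ∩ S).card = 0
    · left
      exact ⟨by omega, Finset.card_eq_zero.1 h3⟩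
    · right
      constructor <;> omega


set_option linter.unusedSectionVars false
set_option linter.unusedSimpArgs false
set_option linter.unusedVariables false
theorem det_dirichletLaplacian_eq_sum_essential_CRSF
    (G : SimpleGraph V) (hG : G.Connected)
    (c : V → V → ℝ) (φ : V → V → ℂ) (S : Finset V) (hS : S.Nonempty)
    (hc_symm : ∀ v w, c v w = c w v)
    (hc_pos : ∀ v w, G.Adj v w → 0 < c v w)
    (hc_zero : ∀ v w, ¬G.Adj v w → c v w = 0)
    (hφ_unit : ∀ v w, G.Adj v w → ‖φ v w‖ = 1)
    (hφ_symm : ∀ v w, G.Adj v w → φ w v = starRingEnd ℂ (φ v w)) :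
    (dirichletLaplacian c φ S).det =
      ∑ Γ ∈ Finset.univ.filter (IsEssentialCRSF G S),
        (∏ e ∈ Γ, (edgeC c hc_symm e : ℂ)) * ∏ δ ∈ cyclesOf Γ, cycleWeight φ δ := by
  have hφ : ∀ v w, G.Adj v w → φ v w * φ w v = 1 := by
    intro v w h
    rw [hφ_symm v w h, Complex.mul_conj, Complex.normSq_eq_norm_sq, hφ_unit v w h]
    simp
  have hcV : Fintype.card {v // v ∉ S} + S.card = Fintype.card V := by
    have h1 : Fintype.card {v // v ∉ S} = Sᶜ.card := by
      rw [Fintype.card_subtype]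
      congr 1
      ext x
      simp
    rw [h1, Finset.card_compl]
    have := Finset.card_le_univ S
    omega
  rw [det_expand_s2 G c φ S hc_symm hc_zero hφ, Finset.sum_filter]
  refine Finset.sum_congr rfl fun Γ _ => ?_
  by_cases hsub : (Γ : Set (Sym2 V)) ⊆ G.edgeSet
  · have hloop : ∀ x, s(x, x) ∉ Γ := by
      intro x hx
      have := hsub (Finset.mem_coe.2 hx)
      rw [SimpleGraph.mem_edgeSet] at this
      exact G.loopless.irrefl x this
    have hφ' : ∀ v w, s(v, w) ∈ Γ → φ v w * φ w v = 1 := by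
      intro v w hvw
      have := hsub (Finset.mem_coe.2 hvw)
      rw [SimpleGraph.mem_edgeSet] at this
      exact hφ v w this
    have hiff := essential_iff G S Γ hsub
    by_cases hcard : Γ.card = Fintype.card {v // v ∉ S}
    · have h1 : coefA φ S Γ = if PP Γ S then ∏ δ ∈ cyclesOf Γ, cycleWeight φ δ else 0 := by
        rw [← det_indC φ S Γ hloop hφ' hcard, ← det_MM φ Γ S]
        exact key_det φ _ Γ S rfl hloop hφ' (by omega)
      rw [h1]
      by_cases hP : PP Γ S
      · rw [if_pos hP, if_pos (hiff.2 hP)]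
      · rw [if_neg hP, if_neg (fun h => hP (hiff.1 h)), mul_zero]
    · rw [coefA_eq_zero φ S Γ hcard, if_neg, mul_zero]
      intro h
      have hP := hiff.1 h Finset.univ (fun _ _ _ => by simp)
      have e1 : EA Γ Finset.univ = Γ := by
        unfold EA
        simp
      rw [e1, Finset.univ_inter, Finset.card_univ] at hP
      omega
  · rw [if_neg (fun h => hsub h.1)]
    obtain ⟨e, he, he'⟩ := Set.not_subset.1 hsub
    rw [Finset.prod_eq_zero (Finset.mem_coe.1 he), zero_mul]
    induction e with
    | _ x y =>
      rw [SimpleGraph.mem_edgeSet] at he'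
      have : edgeC c hc_symm s(x, y) = c x y := rfl
      rw [this, hc_zero x y he']
      simp

end CRSFStmt
end
end
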